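/- (Almost multiplicativity) There is an absolute constant c such that for every real p with 4 < p < 6 and all δ₁, δ₂ with 1/δ₁ ∈ ℕ and 1/δ₂ ∈ ℕ, the decoupling constants satisfy D_p(δ₁ δ₂) ≤ c · D_p(δ₁) · D_p(δ₂). -/

import Mathlib

open MeasureTheory

noncomputable section

/-- The weight `w_B` attached to the axis-parallel square of center `c` and side length `R`:
`w_B(x) = (1 + |x - c|/R)^(-100)` with `|·|` the Euclidean norm on `ℝ²`. -/
def wB (c : ℝ × ℝ) (R : ℝ) (x : ℝ × ℝ) : ℝ :=
  (1 + Real.sqrt ((x.1 - c.1) ^ 2 + (x.2 - c.2) ^ 2) / R) ^ (-100 : ℤ)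

/-- The product weight `w̃_B(x) = (1 + |x₁ - c₁|/R)^(-100) * (1 + |x₂ - c₂|/R)^(-100)`. -/
def wtB (c : ℝ × ℝ) (R : ℝ) (x : ℝ × ℝ) : ℝ :=
  (1 + |x.1 - c.1| / R) ^ (-100 : ℤ) * (1 + |x.2 - c.2| / R) ^ (-100 : ℤ)

/-- The axis-parallel square `B(c, R)` with center `c` and side length `R`, as a subset of `ℝ²`. -/
def sqr (c : ℝ × ℝ) (R : ℝ) : Set (ℝ × ℝ) :=
  Set.Icc (c.1 - R / 2) (c.1 + R / 2) ×ˢ Set.Icc (c.2 - R / 2) (c.2 + R / 2)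

/-- The extension operator associated to the parabola, over the interval `[a, b]`:
`(E_{[a,b]} g)(x) = ∫_{[a,b]} g(ξ) e(ξ x₁ + ξ² x₂) dξ`. -/
def extOp (a b : ℝ) (g : ℝ → ℂ) (x : ℝ × ℝ) : ℂ :=
  ∫ ξ in Set.Icc a b,
    g ξ * Complex.exp (2 * Real.pi * Complex.I * ((ξ * x.1 + ξ ^ 2 * x.2 : ℝ) : ℂ))

/-- Weighted `L^p` norm `‖f‖_{L^p(w)} = (∫_{ℝ²} |f|^p w)^{1/p}`. -/
def wLp (p : ℝ) (w : ℝ × ℝ → ℝ) (f : ℝ × ℝ → ℂ) : ℝ :=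
  (∫ x : ℝ × ℝ, ‖f x‖ ^ p * w x) ^ (1 / p)

/-- `L^p` norm over the square of center `c` and side `R`. -/
def sqLp (p : ℝ) (c : ℝ × ℝ) (R : ℝ) (f : ℝ × ℝ → ℂ) : ℝ :=
  (∫ x in sqr c R, ‖f x‖ ^ p) ^ (1 / p)

/-- Normalized weighted `L^p` norm `‖f‖_{L^p_#(w)} = (|B|⁻¹ ∫_{ℝ²} |f|^p w)^{1/p}` where the
normalizing square has side length `R` (so `|B| = R²`). -/
def shLp (p R : ℝ) (w : ℝ × ℝ → ℝ) (f : ℝ × ℝ → ℂ) : ℝ :=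
  ((R ^ 2)⁻¹ * ∫ x : ℝ × ℝ, ‖f x‖ ^ p * w x) ^ (1 / p)

/-- Normalized `L^p` norm over the square of center `c` and side `R`:
`‖f‖_{L^p_#(B)} = (|B|⁻¹ ∫_B |f|^p)^{1/p}`. -/
def shLpSq (p : ℝ) (c : ℝ × ℝ) (R : ℝ) (f : ℝ × ℝ → ℂ) : ℝ :=
  ((R ^ 2)⁻¹ * ∫ x in sqr c R, ‖f x‖ ^ p) ^ (1 / p)

/-- `DecIneq p n D` says that the constant `D` is admissible in the `l²L^p` decoupling
inequality for the parabola at scale `δ = 1/n`: for every integrable `g : [0,1] → ℂ` and every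
axis-parallel square `B` of side length `δ⁻² = n²`,
`‖E_{[0,1]} g‖_{L^p(B)} ≤ D (Σ_{J ∈ P_δ([0,1])} ‖E_J g‖_{L^p(w_B)}²)^{1/2}`. -/
def DecIneq (p : ℝ) (n : ℕ) (D : ℝ) : Prop :=
  ∀ g : ℝ → ℂ, IntegrableOn g (Set.Icc 0 1) → ∀ c : ℝ × ℝ,
    sqLp p c ((n : ℝ) ^ 2) (extOp 0 1 g) ≤
      D * (∑ k ∈ Finset.range n,
        wLp p (wB c ((n : ℝ) ^ 2)) (extOp ((k : ℝ) / (n : ℝ)) (((k : ℝ) + 1) / (n : ℝ)) g) ^ 2)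
        ^ (1 / 2 : ℝ)

/-- The decoupling constant `D_p(δ)` for the parabola at scale `δ = 1/n`, i.e. the smallest
admissible constant in the decoupling inequality. -/
def Dconst (p : ℝ) (n : ℕ) : ℝ := sInf {D : ℝ | 0 ≤ D ∧ DecIneq p n D}

/-- Center of the `(i,j)` square in the partition of the axis-parallel square of center `c` and
side length `Rb` into axis-parallel squares of side length `r`. -/
def subCtr (c : ℝ × ℝ) (Rb r : ℝ) (i j : ℕ) : ℝ × ℝ :=
  (c.1 - Rb / 2 + ((i : ℝ) + 1 / 2) * r, c.2 - Rb / 2 + ((j : ℝ) + 1 / 2) * r)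

/-- `BilIneq p n k b M` says `M` is admissible in the bilinear decoupling inequality with
`δ = 1/n`, `ν = 1/k`: for every square `B` of side `δ⁻² = n²`, every integrable `g`, and all
`ν`-separated intervals `I = [i/k, (i+1)/k]`, `I' = [i'/k, (i'+1)/k]` of the partition
`P_ν([0,1])`,
`Avg_{Δ ∈ P_{ν^{-b}}(B)} Π (Σ_{J ∈ P_{ν^b}} ‖E_J g‖_{L²_#(w̃_Δ)}²)^{p/4}
  ≤ M^p Π (Σ_{J ∈ P_δ} ‖E_J g‖_{L^p_#(w_B)}²)^{p/4}`. -/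
def BilIneq (p : ℝ) (n k b : ℕ) (M : ℝ) : Prop :=
  ∀ g : ℝ → ℂ, IntegrableOn g (Set.Icc 0 1) → ∀ c : ℝ × ℝ,
    ∀ i i' : ℕ, i < k → i' < k → (i + 1 < i' ∨ i' + 1 < i) →
    (((n ^ 2 / k ^ b : ℕ) : ℝ) ^ 2)⁻¹ *
        ∑ a ∈ Finset.range (n ^ 2 / k ^ b), ∑ a' ∈ Finset.range (n ^ 2 / k ^ b),
          ((∑ J ∈ Finset.range (k ^ (b - 1)),
              shLp 2 ((k : ℝ) ^ b)
                (wtB (subCtr c ((n : ℝ) ^ 2) ((k : ℝ) ^ b) a a') ((k : ℝ) ^ b))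
                (extOp ((i : ℝ) / (k : ℝ) + (J : ℝ) / (k : ℝ) ^ b)
                  ((i : ℝ) / (k : ℝ) + ((J : ℝ) + 1) / (k : ℝ) ^ b) g) ^ 2) ^ (p / 4) *
            (∑ J ∈ Finset.range (k ^ (b - 1)),
              shLp 2 ((k : ℝ) ^ b)
                (wtB (subCtr c ((n : ℝ) ^ 2) ((k : ℝ) ^ b) a a') ((k : ℝ) ^ b))
                (extOp ((i' : ℝ) / (k : ℝ) + (J : ℝ) / (k : ℝ) ^ b)
                  ((i' : ℝ) / (k : ℝ) + ((J : ℝ) + 1) / (k : ℝ) ^ b) g) ^ 2) ^ (p / 4))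
      ≤ M ^ p *
        ((∑ J ∈ Finset.range (n / k),
            shLp p ((n : ℝ) ^ 2) (wB c ((n : ℝ) ^ 2))
              (extOp ((i : ℝ) / (k : ℝ) + (J : ℝ) / (n : ℝ))
                ((i : ℝ) / (k : ℝ) + ((J : ℝ) + 1) / (n : ℝ)) g) ^ 2) ^ (p / 4) *
          (∑ J ∈ Finset.range (n / k),
            shLp p ((n : ℝ) ^ 2) (wB c ((n : ℝ) ^ 2))
              (extOp ((i' : ℝ) / (k : ℝ) + (J : ℝ) / (n : ℝ))
                ((i' : ℝ) / (k : ℝ) + ((J : ℝ) + 1) / (n : ℝ)) g) ^ 2) ^ (p / 4))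

/-- The bilinear decoupling constant `M_{p,b}(δ, ν)` with `δ = 1/n`, `ν = 1/k`. -/
def Mconst (p : ℝ) (n k b : ℕ) : ℝ := sInf {M : ℝ | 0 ≤ M ∧ BilIneq p n k b M}

/-- The Fourier transform of a function on `ℝ²`. -/
def ftR2 (η : ℝ × ℝ → ℝ) (ξ : ℝ × ℝ) : ℂ :=
  ∫ x : ℝ × ℝ, (η x : ℂ) * Complex.exp (-(2 * Real.pi * Complex.I) * ((x.1 * ξ.1 + x.2 * ξ.2 : ℝ) : ℂ))

end

namespace ParabolaDecoupling

open MeasureTheory Real Set Filter Topology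
open scoped ENNReal NNReal ContDiff FourierTransform

/-! ### The character `t ↦ e(t)` and the extension operator -/

/-- The character `e(t) = exp(2πit)`. -/
noncomputable def ch (t : ℝ) : ℂ := Complex.exp (2 * Real.pi * Complex.I * (t : ℂ))

lemma ch_add (s t : ℝ) : ch (s + t) = ch s * ch t := by
  simp only [ch, ← Complex.exp_add]; congr 1; push_cast; ring

lemma ch_eq (t : ℝ) : ch t = Complex.exp (((2 * Real.pi * t : ℝ) : ℂ) * Complex.I) := by
  simp only [ch]; congr 1; push_cast; ring

@[simp] lemma norm_ch (t : ℝ) : ‖ch t‖ = 1 := by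
  rw [ch_eq]; exact Complex.norm_exp_ofReal_mul_I _

@[simp] lemma enorm_ch (t : ℝ) : ‖ch t‖ₑ = 1 := by
  rw [← ofReal_norm, norm_ch, ENNReal.ofReal_one]

@[simp] lemma ch_zero : ch 0 = 1 := by simp [ch]

lemma contDiff_ch : ContDiff ℝ ∞ ch := by
  unfold ch
  exact (contDiff_const.mul Complex.ofRealCLM.contDiff).cexp

@[fun_prop] lemma continuous_ch : Continuous ch := contDiff_ch.continuous

lemma hasDerivAt_ch (t : ℝ) : HasDerivAt ch (2 * Real.pi * Complex.I * ch t) t := by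
  have h : HasDerivAt (fun t : ℝ => 2 * Real.pi * Complex.I * (t : ℂ))
      (2 * Real.pi * Complex.I * 1) t :=
    (Complex.ofRealCLM.hasDerivAt (x := t)).const_mul (2 * Real.pi * Complex.I)
  refine h.cexp.congr_deriv ?_
  simp only [ch]; ring

lemma extOp_eq (a b : ℝ) (g : ℝ → ℂ) (x : ℝ × ℝ) :
    extOp a b g x = ∫ ξ in Icc a b, g ξ * ch (ξ * x.1 + ξ ^ 2 * x.2) := rfl

lemma integrable_mul_ch {μ : Measure ℝ} {g : ℝ → ℂ} (hg : Integrable g μ) {φ : ℝ → ℝ}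
    (hφ : Continuous φ) : Integrable (fun ξ => g ξ * ch (φ ξ)) μ := by
  refine hg.mul_bdd (c := 1) ?_ ?_
  · exact (continuous_ch.comp hφ).aestronglyMeasurable
  · exact Eventually.of_forall fun _ => by simp

lemma continuous_extOp {a b : ℝ} {g : ℝ → ℂ} (hg : IntegrableOn g (Icc a b)) :
    Continuous (extOp a b g) := by
  have : extOp a b g = fun x => ∫ ξ in Icc a b, g ξ * ch (ξ * x.1 + ξ ^ 2 * x.2) := rfl
  rw [this]
  refine continuous_of_dominated (bound := fun ξ => ‖g ξ‖) ?_ ?_ hg.norm ?_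
  · intro x
    exact (integrable_mul_ch hg (by fun_prop)).aestronglyMeasurable
  · intro x; exact Eventually.of_forall fun ξ => by simp
  · exact Eventually.of_forall fun ξ => by fun_prop

lemma norm_extOp_le {a b : ℝ} (g : ℝ → ℂ) (x : ℝ × ℝ) :
    ‖extOp a b g x‖ ≤ ∫ ξ in Icc a b, ‖g ξ‖ := by
  rw [extOp_eq]
  refine (norm_integral_le_integral_norm _).trans_eq ?_
  simp

/-! ### Fourier transforms of smooth compactly supported functions -/

/-- The inverse Fourier transform `y ↦ ∫ b(τ) e(τy) dτ`. -/
noncomputable def cft (b : ℝ → ℂ) (y : ℝ) : ℂ := ∫ τ, b τ * ch (τ * y)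

lemma cft_eq_fourierInv (b : ℝ → ℂ) : cft b = 𝓕⁻ b := by
  ext y
  rw [Real.fourierInv_eq', cft]
  congr 1; ext τ
  simp only [ch, smul_eq_mul, mul_comm (b τ)]
  congr 2
  simp; ring

lemma cft_decay {b : ℝ → ℂ} (hb : ContDiff ℝ ∞ b) (hc : HasCompactSupport b) (M : ℕ) :
    ∃ C : ℝ, ∀ y, (1 + |y|) ^ M * ‖cft b y‖ ≤ C := by
  let f : SchwartzMap ℝ ℂ := hc.toSchwartzMap hb
  have hf : cft b = 𝓕⁻ f := by
    rw [cft_eq_fourierInv, SchwartzMap.fourierInv_coe]; rfl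
  refine ⟨2 ^ M * (Finset.Iic (M, 0)).sup (fun m => SchwartzMap.seminorm ℝ m.1 m.2) (𝓕⁻ f),
    fun y => ?_⟩
  have := SchwartzMap.one_add_le_sup_seminorm_apply (𝕜 := ℝ) (m := (M, 0)) (k := M) (n := 0)
    le_rfl le_rfl (𝓕⁻ f) y
  rw [norm_iteratedFDeriv_zero, Real.norm_eq_abs] at this
  rw [hf]
  exact this

lemma continuous_cft {b : ℝ → ℂ} (hb : ContDiff ℝ ∞ b) (hc : HasCompactSupport b) :
    Continuous (cft b) := by
  let f : SchwartzMap ℝ ℂ := hc.toSchwartzMap hb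
  have hf : cft b = 𝓕⁻ f := by
    rw [cft_eq_fourierInv, SchwartzMap.fourierInv_coe]; rfl
  rw [hf]; exact (𝓕⁻ f).continuous

lemma integrable_cft {b : ℝ → ℂ} (hb : ContDiff ℝ ∞ b) (hc : HasCompactSupport b) :
    Integrable (cft b) := by
  let f : SchwartzMap ℝ ℂ := hc.toSchwartzMap hb
  have hf : cft b = 𝓕⁻ f := by
    rw [cft_eq_fourierInv, SchwartzMap.fourierInv_coe]; rfl
  rw [hf]; exact (𝓕⁻ f).integrable

lemma cft_inversion {b : ℝ → ℂ} (hb : ContDiff ℝ ∞ b) (hc : HasCompactSupport b) (ξ : ℝ) :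
    b ξ = ∫ y, cft b y * ch (-(y * ξ)) := by
  have hi : Integrable b := hb.continuous.integrable_of_hasCompactSupport hc
  have h2 := integrable_cft hb hc
  rw [cft_eq_fourierInv] at h2 ⊢
  have hF : Integrable (𝓕 b) := by
    have : 𝓕 b = fun y => (𝓕⁻ b) (-y) := by
      ext y; rw [Real.fourierInv_eq_fourier_neg, neg_neg]
    rw [this]; exact h2.comp_neg
  have h3 := congrFun (hb.continuous.fourier_fourierInv_eq hi hF) ξ
  rw [Real.fourier_eq'] at h3
  rw [← h3]
  congr 1; ext y
  simp only [ch, smul_eq_mul, mul_comm ((𝓕⁻ b) y)]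
  congr 2
  simp; ring

/-- Two derivatives bounded by `A` on a compact set give an `L¹` bound for the kernel. -/
lemma cft_decay_two {b : ℝ → ℂ} (hb : ContDiff ℝ ∞ b) (hc : HasCompactSupport b) (y : ℝ) :
    (1 + y ^ 2) * ‖cft b y‖ ≤ (∫ τ, ‖b τ‖) + ∫ τ, ‖deriv (deriv b) τ‖ := by
  have hd : ∀ n : ℕ, (n : ℕ∞) ≤ 2 → Integrable (iteratedDeriv n b) := by
    intro n hn
    refine Continuous.integrable_of_hasCompactSupport ?_ ?_
    · exact hb.continuous_iteratedDeriv n (by exact_mod_cast le_top)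
    · clear hn
      induction n with
      | zero => simpa using hc
      | succ n ih => rw [iteratedDeriv_succ]; exact ih.deriv
  have h := Real.fourier_iteratedDeriv (n := 2) (N := 2) (f := b)
    (hb.of_le (by exact_mod_cast le_top)) hd le_rfl
  have h2 := congrFun h (-y)
  have e1 : cft b y = 𝓕 b (-y) := by
    rw [cft_eq_fourierInv, Real.fourierInv_eq_fourier_neg]
  have e2 : ‖(𝓕 b) (-y)‖ ≤ ∫ τ, ‖b τ‖ := by
    rw [Real.fourier_eq]
    refine (norm_integral_le_integral_norm _).trans_eq ?_
    simp
  have e3 : ‖(𝓕 (iteratedDeriv 2 b)) (-y)‖ ≤ ∫ τ, ‖deriv (deriv b) τ‖ := by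
    rw [Real.fourier_eq]
    refine (norm_integral_le_integral_norm _).trans_eq ?_
    simp [iteratedDeriv_succ]
  rw [h2] at e3
  rw [norm_smul] at e3
  have e4 : ‖(2 * (Real.pi : ℂ) * Complex.I * ((-y : ℝ) : ℂ)) ^ 2‖ = (2 * Real.pi) ^ 2 * y ^ 2 := by
    rw [norm_pow]; simp [mul_pow, abs_of_pos Real.pi_pos]
  rw [e4] at e3
  rw [e1]
  have h5 : (1 : ℝ) ≤ (2 * Real.pi) ^ 2 := by nlinarith [Real.pi_gt_three]
  have h6 : y ^ 2 * ‖(𝓕 b) (-y)‖ ≤ (2 * Real.pi) ^ 2 * y ^ 2 * ‖(𝓕 b) (-y)‖ := by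
    have : 0 ≤ y ^ 2 * ‖(𝓕 b) (-y)‖ := by positivity
    nlinarith
  nlinarith

/-! ### Hölder and Young inequalities -/

lemma rpow_lintegral_mul_le {α : Type*} [MeasurableSpace α] {μ : Measure α} {p : ℝ} (hp : 1 ≤ p)
    {k f : α → ℝ≥0∞} (hk : AEMeasurable k μ) (hf : AEMeasurable f μ) :
    (∫⁻ y, k y * f y ∂μ) ^ p ≤ (∫⁻ y, k y ∂μ) ^ (p - 1) * ∫⁻ y, k y * f y ^ p ∂μ := by
  have hp0 : 0 < p := by linarith
  have h := ENNReal.lintegral_mul_norm_pow_le (μ := μ) hk (hk.mul (hf.pow_const p))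
    (p := 1 - 1 / p) (q := 1 / p) (by rw [sub_nonneg, div_le_one hp0]; exact hp) (by positivity)
    (by ring)
  have h2 : ∀ y, k y ^ (1 - 1 / p) * (k y * f y ^ p) ^ (1 / p) = k y * f y := by
    intro y
    rw [ENNReal.mul_rpow_of_nonneg _ _ (by positivity), ← mul_assoc,
      ← ENNReal.rpow_add_of_nonneg _ _ (by rw [sub_nonneg, div_le_one hp0]; exact hp)
        (by positivity), ← ENNReal.rpow_mul, mul_one_div_cancel hp0.ne']
    simp
  have h3 : ∫⁻ y, k y * f y ∂μ = ∫⁻ y, k y ^ (1 - 1 / p) * (k y * f y ^ p) ^ (1 / p) ∂μ := by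
    simp_rw [h2]
  rw [h3]
  calc _ ≤ ((∫⁻ y, k y ∂μ) ^ (1 - 1 / p) * (∫⁻ y, k y * f y ^ p ∂μ) ^ (1 / p)) ^ p :=
        ENNReal.rpow_le_rpow h hp0.le
    _ = _ := by
      rw [ENNReal.mul_rpow_of_nonneg _ _ hp0.le, ← ENNReal.rpow_mul, ← ENNReal.rpow_mul,
        one_div_mul_cancel hp0.ne', ENNReal.rpow_one]
      congr 2
      field_simp

lemma lintegral_young {p : ℝ} (hp : 1 ≤ p) {k f w ρ : ℝ → ℝ≥0∞} (hk : Measurable k)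
    (hf : Measurable f) (hw : Measurable w) (hρ : Measurable ρ) {s : ℝ → ℝ} (hs : Measurable s)
    (h : ∀ x y, w x ≤ w (x - s y) * ρ y) :
    ∫⁻ x, (∫⁻ y, k y * f (x - s y)) ^ p * w x ≤
      (∫⁻ y, k y) ^ (p - 1) * (∫⁻ y, k y * ρ y) * ∫⁻ x, f x ^ p * w x := by
  calc ∫⁻ x, (∫⁻ y, k y * f (x - s y)) ^ p * w x
      ≤ ∫⁻ x, (∫⁻ y, k y) ^ (p - 1) *
          ∫⁻ y, (k y * ρ y) * (f (x - s y) ^ p * w (x - s y)) := by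
        refine lintegral_mono fun x => ?_
        calc _ ≤ ((∫⁻ y, k y) ^ (p - 1) * ∫⁻ y, k y * f (x - s y) ^ p) * w x := by
              gcongr
              exact rpow_lintegral_mul_le hp hk.aemeasurable (by fun_prop)
          _ = (∫⁻ y, k y) ^ (p - 1) * ∫⁻ y, k y * f (x - s y) ^ p * w x := by
              rw [mul_assoc, lintegral_mul_const _ (by fun_prop)]
          _ ≤ _ := by
              refine mul_le_mul' le_rfl (lintegral_mono fun y => ?_)
              calc _ ≤ k y * f (x - s y) ^ p * (w (x - s y) * ρ y) := by gcongr; exact h x y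
                _ = _ := by ring
    _ = (∫⁻ y, k y) ^ (p - 1) *
          ∫⁻ y, ∫⁻ x, (k y * ρ y) * (f (x - s y) ^ p * w (x - s y)) := by
        rw [lintegral_const_mul _ (by fun_prop), lintegral_lintegral_swap (by fun_prop)]
    _ = _ := by
        rw [mul_assoc]
        congr 1
        rw [← lintegral_mul_const _ (by fun_prop)]
        congr 1; ext y
        rw [lintegral_const_mul _ (by fun_prop)]
        congr 1
        exact lintegral_sub_right_eq_self (fun x => f x ^ p * w x) (s y)

/-! ### Fourier multipliers acting on the extension operator -/

lemma extOp_multiplier {b : ℝ → ℂ} (hb : ContDiff ℝ ∞ b) (hc : HasCompactSupport b) {u v : ℝ}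
    {g : ℝ → ℂ} (hg : IntegrableOn g (Icc u v)) (l ξ₀ : ℝ) (x : ℝ × ℝ) :
    extOp u v (fun ξ => b (l * (ξ - ξ₀)) * g ξ) x =
      ∫ y, cft b y * ch (l * ξ₀ * y) * extOp u v g (x.1 - l * y, x.2) := by
  have hK := integrable_cft hb hc
  have hI : Integrable (fun z : ℝ × ℝ => (g z.1 * cft b z.2) *
      ch (-(z.2 * (l * (z.1 - ξ₀))) + (z.1 * x.1 + z.1 ^ 2 * x.2)))
      ((volume.restrict (Icc u v)).prod volume) := by
    refine (Integrable.mul_prod hg hK).mul_bdd (c := 1) ?_ ?_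
    · exact Continuous.aestronglyMeasurable (by fun_prop)
    · exact Eventually.of_forall fun _ => by simp
  calc extOp u v (fun ξ => b (l * (ξ - ξ₀)) * g ξ) x
      = ∫ ξ in Icc u v, ∫ y, (g ξ * cft b y) *
          ch (-(y * (l * (ξ - ξ₀))) + (ξ * x.1 + ξ ^ 2 * x.2)) := by
        rw [extOp_eq]
        congr 1; ext ξ
        rw [cft_inversion hb hc (l * (ξ - ξ₀)), mul_assoc, ← integral_mul_const]
        congr 1; ext y
        rw [ch_add (-(y * (l * (ξ - ξ₀)))) _]; ring
    _ = ∫ y, ∫ ξ in Icc u v, (g ξ * cft b y) *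
          ch (-(y * (l * (ξ - ξ₀))) + (ξ * x.1 + ξ ^ 2 * x.2)) := integral_integral_swap hI
    _ = _ := by
        congr 1; ext y
        rw [extOp_eq, ← integral_const_mul]
        congr 1; ext ξ
        have : -(y * (l * (ξ - ξ₀))) + (ξ * x.1 + ξ ^ 2 * x.2) =
          l * ξ₀ * y + (ξ * (x.1 - l * y) + ξ ^ 2 * x.2) := by ring
        rw [this, ch_add (l * ξ₀ * y) _]; ring

lemma enorm_extOp_multiplier_le {b : ℝ → ℂ} (hb : ContDiff ℝ ∞ b) (hc : HasCompactSupport b)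
    {u v : ℝ} {g : ℝ → ℂ} (hg : IntegrableOn g (Icc u v)) (l ξ₀ : ℝ) (x₁ x₂ : ℝ) :
    ‖extOp u v (fun ξ => b (l * (ξ - ξ₀)) * g ξ) (x₁, x₂)‖ₑ ≤
      ∫⁻ y, ‖cft b y‖ₑ * ‖extOp u v g (x₁ - l * y, x₂)‖ₑ := by
  rw [extOp_multiplier hb hc hg]
  refine (enorm_integral_le_lintegral_enorm _).trans_eq ?_
  simp [enorm_mul]

/-- Weighted `L^p` bound on a horizontal line for a smooth multiplier. -/
lemma lintegral_extOp_multiplier_le {b : ℝ → ℂ} (hb : ContDiff ℝ ∞ b) (hc : HasCompactSupport b)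
    {u v : ℝ} {g : ℝ → ℂ} (hg : IntegrableOn g (Icc u v)) (l ξ₀ : ℝ) (x₂ : ℝ) {p : ℝ}
    (hp : 1 ≤ p) {w ρ : ℝ → ℝ≥0∞} (hw : Measurable w) (hρ : Measurable ρ)
    (h : ∀ x y, w x ≤ w (x - l * y) * ρ y) :
    ∫⁻ x₁, ‖extOp u v (fun ξ => b (l * (ξ - ξ₀)) * g ξ) (x₁, x₂)‖ₑ ^ p * w x₁ ≤
      (∫⁻ y, ‖cft b y‖ₑ) ^ (p - 1) * (∫⁻ y, ‖cft b y‖ₑ * ρ y) *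
        ∫⁻ x₁, ‖extOp u v g (x₁, x₂)‖ₑ ^ p * w x₁ := by
  have hm : Measurable fun x₁ : ℝ => ‖extOp u v g (x₁, x₂)‖ₑ :=
    ((continuous_extOp hg).comp (by fun_prop : Continuous fun x₁ : ℝ => (x₁, x₂))).enorm.measurable
  refine le_trans ?_ (lintegral_young hp (continuous_cft hb hc).enorm.measurable hm hw hρ
    (s := fun y => l * y) (by fun_prop) h)
  gcongr with x
  exact enorm_extOp_multiplier_le hb hc hg l ξ₀ x x₂

/-! ### Bump functions -/

/-- A smooth function equal to `1` on `[-2, 2]` and supported in `[-3, 3]`. -/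
noncomputable def bump (η : ℝ) : ℂ := (((⟨2, 3, by norm_num, by norm_num⟩ :
  ContDiffBump (0 : ℝ)) η : ℝ) : ℂ)

lemma contDiff_ofReal_bump {c : ℝ} (f : ContDiffBump c) :
    ContDiff ℝ ∞ fun η : ℝ => ((f η : ℝ) : ℂ) :=
  Complex.ofRealCLM.contDiff.comp f.contDiff

lemma hasCompactSupport_ofReal_bump {c : ℝ} (f : ContDiffBump c) :
    HasCompactSupport fun η : ℝ => ((f η : ℝ) : ℂ) :=
  f.hasCompactSupport.comp_left (g := fun x : ℝ => (x : ℂ)) (by simp)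

lemma contDiff_bump : ContDiff ℝ ∞ bump := contDiff_ofReal_bump _

lemma hasCompactSupport_bump : HasCompactSupport bump := hasCompactSupport_ofReal_bump _

lemma bump_eq_one {η : ℝ} (h0 : 0 ≤ η) (h1 : η ≤ 1) : bump η = 1 := by
  rw [bump, ContDiffBump.one_of_mem_closedBall]
  · simp
  · simp [abs_le]; constructor <;> linarith

/-- The localized quadratic phase. -/
noncomputable def chirp (t η : ℝ) : ℂ := bump η * ch (t * η ^ 2)

lemma contDiff_chirp (t : ℝ) : ContDiff ℝ ∞ (chirp t) :=
  contDiff_bump.mul (contDiff_ch.comp (by fun_prop))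

lemma hasCompactSupport_chirp (t : ℝ) : HasCompactSupport (chirp t) :=
  hasCompactSupport_bump.mul_right

lemma deriv_deriv_chirp (t η : ℝ) : deriv (deriv (chirp t)) η =
    (deriv (deriv bump) η + (2 * t * η * deriv bump η) * (4 * Real.pi * Complex.I) +
      (t * bump η) * (4 * Real.pi * Complex.I) +
        (t * η) ^ 2 * bump η * (4 * Real.pi * Complex.I) ^ 2) * ch (t * η ^ 2) := by
  have hch : ∀ η : ℝ, HasDerivAt (fun η : ℝ => ch (t * η ^ 2))
      ((4 * Real.pi * Complex.I * (t * η)) * ch (t * η ^ 2)) η := by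
    intro η
    have h1 : HasDerivAt (fun η : ℝ => t * η ^ 2) (t * (2 * η)) η := by
      simpa using (hasDerivAt_pow 2 η).const_mul t
    have := (hasDerivAt_ch (t * η ^ 2)).scomp η h1
    refine this.congr_deriv ?_
    rw [Complex.real_smul]; push_cast; ring
  have hb : ∀ η, HasDerivAt bump (deriv bump η) η := fun η =>
    (contDiff_bump.differentiable (by simp) η).hasDerivAt
  have hb' : ∀ η, HasDerivAt (deriv bump) (deriv (deriv bump) η) η := fun η =>
    (((contDiff_infty_iff_deriv.1 contDiff_bump).2).differentiable (by simp) η).hasDerivAt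
  have h1 : deriv (chirp t) = fun η => deriv bump η * ch (t * η ^ 2) +
      bump η * ((4 * Real.pi * Complex.I * (t * η)) * ch (t * η ^ 2)) := by
    ext η
    exact ((hb η).mul (hch η)).deriv
  rw [h1]
  have h3 : HasDerivAt (fun η : ℝ => 4 * Real.pi * Complex.I * ((t : ℂ) * (η : ℂ)))
      (4 * Real.pi * Complex.I * (t * 1)) η :=
    ((Complex.ofRealCLM.hasDerivAt (x := η)).const_mul (t : ℂ)).const_mul _
  have h2 := ((hb' η).mul (hch η)).add ((hb η).mul (h3.mul (hch η)))
  refine h2.deriv.trans ?_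
  simp only [Pi.mul_apply]
  ring

/-- A pointwise majorant for the chirp and its second derivative. -/
noncomputable def chirpMajorant (η : ℝ) : ℝ :=
  ‖bump η‖ + (‖deriv (deriv bump) η‖ + 8 * Real.pi * ‖(η : ℂ) * deriv bump η‖ +
    4 * Real.pi * ‖bump η‖ + 16 * Real.pi ^ 2 * ‖(η : ℂ) ^ 2 * bump η‖)

lemma integrable_chirpMajorant : Integrable chirpMajorant := by
  have cb := contDiff_bump.continuous
  have cb' : Continuous (deriv bump) := contDiff_bump.continuous_deriv (by simp)
  have cb'' : Continuous (deriv (deriv bump)) :=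
    ((contDiff_infty_iff_deriv.1 contDiff_bump).2).continuous_deriv (by simp)
  have sb := hasCompactSupport_bump
  have c3 : Continuous fun η : ℝ => (η : ℂ) * deriv bump η := by fun_prop
  have c4 : Continuous fun η : ℝ => (η : ℂ) ^ 2 * bump η := by fun_prop
  have s3 : HasCompactSupport fun η : ℝ => (η : ℂ) * deriv bump η :=
    HasCompactSupport.mul_left (f := fun η : ℝ => (η : ℂ)) sb.deriv
  have s4 : HasCompactSupport fun η : ℝ => (η : ℂ) ^ 2 * bump η :=
    HasCompactSupport.mul_left (f := fun η : ℝ => (η : ℂ) ^ 2) sb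
  have i1 : Integrable bump := cb.integrable_of_hasCompactSupport sb
  have i2 : Integrable (deriv (deriv bump)) := cb''.integrable_of_hasCompactSupport sb.deriv.deriv
  have i3 := c3.integrable_of_hasCompactSupport s3 (μ := volume)
  have i4 := c4.integrable_of_hasCompactSupport s4 (μ := volume)
  exact i1.norm.add (((i2.norm.add (i3.norm.const_mul _)).add (i1.norm.const_mul _)).add
    (i4.norm.const_mul _))

lemma chirpMajorant_nonneg (η : ℝ) : 0 ≤ chirpMajorant η := by
  unfold chirpMajorant; positivity

lemma chirp_kernel_bound : ∃ C : ℝ≥0, ∀ t : ℝ,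
    ∫⁻ y, ‖cft (chirp t) y‖ₑ ≤ C * ENNReal.ofReal (1 + t ^ 2) := by
  have hBi := integrable_chirpMajorant
  have hB0 : 0 ≤ ∫ η, chirpMajorant η := integral_nonneg chirpMajorant_nonneg
  refine ⟨((∫ η, chirpMajorant η) * Real.pi).toNNReal, fun t => ?_⟩
  have key : (∫ τ, ‖chirp t τ‖) + ∫ τ, ‖deriv (deriv (chirp t)) τ‖ ≤ (1 + t ^ 2) * ∫ η, chirpMajorant η := by
    have j1 : Integrable fun τ => ‖chirp t τ‖ := ((contDiff_chirp t).continuous.integrable_of_hasCompactSupport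
      (hasCompactSupport_chirp t)).norm
    have j2 : Integrable fun τ => ‖deriv (deriv (chirp t)) τ‖ :=
      (Continuous.integrable_of_hasCompactSupport
        (((contDiff_infty_iff_deriv.1 (contDiff_chirp t)).2).continuous_deriv (by simp))
        (hasCompactSupport_chirp t).deriv.deriv).norm
    rw [← integral_add j1 j2, ← integral_const_mul]
    refine integral_mono (j1.add j2) (hBi.const_mul _) fun η => ?_
    have hp := Real.pi_pos
    have n4 : ‖(4 * (Real.pi : ℂ) * Complex.I)‖ = 4 * Real.pi := by
      simp [abs_of_pos hp]
    have e1 : ‖deriv (deriv (chirp t)) η‖ ≤ ‖deriv (deriv bump) η‖ +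
        2 * |t| * ‖(η : ℂ) * deriv bump η‖ * (4 * Real.pi) + |t| * ‖bump η‖ * (4 * Real.pi) +
          t ^ 2 * ‖(η : ℂ) ^ 2 * bump η‖ * (4 * Real.pi) ^ 2 := by
      rw [deriv_deriv_chirp, norm_mul, norm_ch, mul_one]
      refine (norm_add_le _ _).trans (add_le_add ((norm_add_le _ _).trans (add_le_add
        ((norm_add_le _ _).trans (add_le_add le_rfl ?_)) ?_)) ?_)
      · rw [norm_mul, n4]; apply le_of_eq; simp only [norm_mul, Complex.norm_real,
          Real.norm_eq_abs, Complex.norm_ofNat]; ring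
      · rw [norm_mul, n4, norm_mul]; simp
      · rw [norm_mul, norm_pow, n4]; apply le_of_eq; simp only [norm_mul, norm_pow, mul_pow,
          Complex.norm_real, Real.norm_eq_abs, sq_abs]; ring
    have e2 : ‖chirp t η‖ = ‖bump η‖ := by simp [chirp]
    have ht : |t| ≤ 1 + t ^ 2 := by
      rw [← sq_abs]; nlinarith [sq_nonneg (|t| - 1), abs_nonneg t]
    have ht2 : t ^ 2 ≤ 1 + t ^ 2 := by linarith
    have ht1 : 1 ≤ 1 + t ^ 2 := by nlinarith [sq_nonneg t]
    simp only [e2, chirpMajorant]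
    have a0 := norm_nonneg (bump η)
    have a1 := norm_nonneg (deriv (deriv bump) η)
    have a2 : 0 ≤ ‖(η : ℂ) * deriv bump η‖ * (8 * Real.pi) := by positivity
    have a3 : 0 ≤ ‖bump η‖ * (4 * Real.pi) := by positivity
    have a4 : 0 ≤ ‖(η : ℂ) ^ 2 * bump η‖ * (16 * Real.pi ^ 2) := by positivity
    have b0 := mul_le_mul_of_nonneg_right ht1 a0
    have b1 := mul_le_mul_of_nonneg_right ht1 a1
    have b2 := mul_le_mul_of_nonneg_right ht a2
    have b3 := mul_le_mul_of_nonneg_right ht a3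
    have b4 := mul_le_mul_of_nonneg_right ht2 a4
    refine (add_le_add le_rfl e1).trans ?_
    linarith
  have hpt : ∀ y, ‖cft (chirp t) y‖ₑ ≤ ENNReal.ofReal (((1 + t ^ 2) * ∫ η, chirpMajorant η) * (1 + y ^ 2)⁻¹) := by
    intro y
    rw [← ofReal_norm]
    refine ENNReal.ofReal_le_ofReal ?_
    have h1 := (cft_decay_two (contDiff_chirp t) (hasCompactSupport_chirp t) y).trans key
    rw [← div_eq_mul_inv, le_div_iff₀ (by positivity)]
    linarith
  refine (lintegral_mono hpt).trans ?_
  rw [← ofReal_integral_eq_lintegral_ofReal (integrable_inv_one_add_sq.const_mul _)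
    (Eventually.of_forall fun y => by positivity), integral_const_mul, integral_univ_inv_one_add_sq]
  have hE : ((((∫ η, chirpMajorant η) * Real.pi).toNNReal : ℝ≥0) : ℝ≥0∞) =
      ENNReal.ofReal ((∫ η, chirpMajorant η) * Real.pi) := rfl
  rw [hE, ← ENNReal.ofReal_mul (by positivity)]
  apply le_of_eq; congr 1; ring

/-! ### Propagation between horizontal lines -/

lemma extOp_propagate {n : ℝ} (hn : 0 < n) (ξ₀ x₁ s t : ℝ) (g : ℝ → ℂ) :
    extOp ξ₀ (ξ₀ + 1 / n) g (x₁, s) = ch (-(ξ₀ ^ 2 * (s - t))) *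
      extOp ξ₀ (ξ₀ + 1 / n) (fun ξ => chirp ((s - t) / n ^ 2) (n * (ξ - ξ₀)) * g ξ)
        (x₁ + 2 * ξ₀ * (s - t), t) := by
  rw [extOp_eq, extOp_eq, ← integral_const_mul]
  refine setIntegral_congr_fun measurableSet_Icc fun ξ hξ => ?_
  have h0 : 0 ≤ n * (ξ - ξ₀) := mul_nonneg hn.le (by linarith [hξ.1])
  have h1 : n * (ξ - ξ₀) ≤ 1 := by
    have : ξ - ξ₀ ≤ 1 / n := by linarith [hξ.2]
    rwa [le_div_iff₀ hn, mul_comm] at this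
  simp only [chirp, bump_eq_one h0 h1, one_mul]
  have e : ξ * x₁ + ξ ^ 2 * s = -(ξ₀ ^ 2 * (s - t)) + ((s - t) / n ^ 2 * (n * (ξ - ξ₀)) ^ 2 +
      (ξ * (x₁ + 2 * ξ₀ * (s - t)) + ξ ^ 2 * t)) := by
    field_simp; ring
  rw [e, ch_add, ch_add]; ring

/-- The `L^p` norms of `E_J g` on two horizontal lines are comparable, with polynomial loss. -/
lemma extOp_line_le : ∃ C : ℝ≥0, ∀ p : ℝ, 1 ≤ p → ∀ n : ℝ, 0 < n → ∀ (ξ₀ s t : ℝ) (g : ℝ → ℂ),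
    IntegrableOn g (Icc ξ₀ (ξ₀ + 1 / n)) →
    ∫⁻ x₁, ‖extOp ξ₀ (ξ₀ + 1 / n) g (x₁, s)‖ₑ ^ p ≤
      (C * ENNReal.ofReal (1 + ((s - t) / n ^ 2) ^ 2)) ^ p *
        ∫⁻ x₁, ‖extOp ξ₀ (ξ₀ + 1 / n) g (x₁, t)‖ₑ ^ p := by
  obtain ⟨C, hC⟩ := chirp_kernel_bound
  refine ⟨C, fun p hp n hn ξ₀ s t g hg => ?_⟩
  set T := (s - t) / n ^ 2
  have h1 : ∀ x₁, ‖extOp ξ₀ (ξ₀ + 1 / n) g (x₁, s)‖ₑ ^ p =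
      ‖extOp ξ₀ (ξ₀ + 1 / n) (fun ξ => chirp T (n * (ξ - ξ₀)) * g ξ)
        (x₁ + 2 * ξ₀ * (s - t), t)‖ₑ ^ p := by
    intro x₁
    rw [extOp_propagate hn ξ₀ x₁ s t g, enorm_mul, enorm_ch, one_mul]
  simp_rw [h1]
  rw [lintegral_add_right_eq_self (fun x₁ => ‖extOp ξ₀ (ξ₀ + 1 / n)
    (fun ξ => chirp T (n * (ξ - ξ₀)) * g ξ) (x₁, t)‖ₑ ^ p)]
  have h2 := lintegral_extOp_multiplier_le (contDiff_chirp T) (hasCompactSupport_chirp T) hg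
    n ξ₀ t hp (w := 1) (ρ := 1) measurable_one measurable_one (by simp)
  simp only [Pi.one_apply, mul_one] at h2
  refine h2.trans ?_
  gcongr
  set A := ∫⁻ y, ‖cft (chirp T) y‖ₑ
  have : A ^ (p - 1) * A = A ^ p := by
    nth_rewrite 2 [← ENNReal.rpow_one A]
    rw [← ENNReal.rpow_add_of_nonneg _ _ (by linarith) (by norm_num)]
    congr 1; ring
  rw [this]
  gcongr
  exact hC T

/-! ### Minkowski's inequality for squared `L^p` norms -/

lemma lintegral_sum_rpow_le {α ι : Type*} [MeasurableSpace α] {μ : Measure α} {r : ℝ}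
    (hr : 1 ≤ r) (s : Finset ι) {f : ι → α → ℝ≥0∞} (hf : ∀ k, AEMeasurable (f k) μ) :
    (∫⁻ u, (∑ k ∈ s, f k u) ^ r ∂μ) ^ (1 / r) ≤ ∑ k ∈ s, (∫⁻ u, f k u ^ r ∂μ) ^ (1 / r) := by
  classical
  induction s using Finset.induction_on with
  | empty =>
    have h0 : 0 < r := by linarith
    simp [ENNReal.zero_rpow_of_pos h0, h0]
  | insert a s ha ih =>
    simp only [Finset.sum_insert ha]
    have := ENNReal.lintegral_Lp_add_le (μ := μ) (hf a)
      (Finset.aemeasurable_fun_sum s fun k _ => hf k) hr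
    exact this.trans (by gcongr)

lemma lintegral_rpow_le_sum {α ι : Type*} [MeasurableSpace α] {μ : Measure α} {p : ℝ}
    (hp : 2 ≤ p) (s : Finset ι) (K : ℝ≥0∞) {X : α → ℝ≥0∞} {Y : ι → α → ℝ≥0∞}
    (hY : ∀ k, AEMeasurable (Y k) μ)
    (h : ∀ u, X u ^ (2 / p) ≤ K * ∑ k ∈ s, Y k u ^ (2 / p)) :
    (∫⁻ u, X u ∂μ) ^ (2 / p) ≤ K * ∑ k ∈ s, (∫⁻ u, Y k u ∂μ) ^ (2 / p) := by
  have hp0 : 0 < p := by linarith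
  have hr : 1 ≤ p / 2 := by linarith
  have hinv : ∀ z : ℝ≥0∞, (z ^ (2 / p)) ^ (p / 2) = z := by
    intro z
    rw [← ENNReal.rpow_mul, show 2 / p * (p / 2) = 1 by field_simp, ENNReal.rpow_one]
  have h1 : ∀ u, X u ≤ K ^ (p / 2) * (∑ k ∈ s, Y k u ^ (2 / p)) ^ (p / 2) := by
    intro u
    rw [← ENNReal.mul_rpow_of_nonneg _ _ (by positivity), ← hinv (X u)]
    exact ENNReal.rpow_le_rpow (h u) (by positivity)
  have h2 := lintegral_sum_rpow_le (μ := μ) hr s (f := fun k u => Y k u ^ (2 / p))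
    fun k => (hY k).pow_const _
  simp only [hinv, one_div_div] at h2
  calc (∫⁻ u, X u ∂μ) ^ (2 / p)
      ≤ (K ^ (p / 2) * ∫⁻ u, (∑ k ∈ s, Y k u ^ (2 / p)) ^ (p / 2) ∂μ) ^ (2 / p) := by
        refine ENNReal.rpow_le_rpow ?_ (by positivity)
        rw [← lintegral_const_mul'']
        · exact lintegral_mono h1
        · exact (Finset.aemeasurable_fun_sum s fun k _ => (hY k).pow_const _).pow_const _
    _ = K * (∫⁻ u, (∑ k ∈ s, Y k u ^ (2 / p)) ^ (p / 2) ∂μ) ^ (2 / p) := by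
        rw [ENNReal.mul_rpow_of_nonneg _ _ (by positivity), ← ENNReal.rpow_mul,
          show p / 2 * (2 / p) = 1 by field_simp, ENNReal.rpow_one]
    _ ≤ _ := by gcongr

lemma mul_rpow_two_div_le {p : ℝ} (hp : 2 ≤ p) {C : ℝ≥0∞} (hC : 1 ≤ C) (X : ℝ≥0∞) :
    (C * X) ^ (2 / p) ≤ C * X ^ (2 / p) := by
  rw [ENNReal.mul_rpow_of_nonneg _ _ (by positivity)]
  gcongr
  calc C ^ (2 / p) ≤ C ^ (1 : ℝ) := by
        refine ENNReal.rpow_le_rpow_of_exponent_le hC ?_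
        rw [div_le_one (by linarith)]; exact hp
    _ = C := ENNReal.rpow_one C

lemma rpow_mul_rpow_two_div {p : ℝ} (hp : 0 < p) (C X : ℝ≥0∞) :
    (C ^ p * X) ^ (2 / p) = C ^ 2 * X ^ (2 / p) := by
  rw [ENNReal.mul_rpow_of_nonneg _ _ (by positivity), ← ENNReal.rpow_mul,
    show p * (2 / p) = (2 : ℕ) by field_simp; norm_num, ENNReal.rpow_natCast]

lemma rpow_le_pow_six {p : ℝ} (hp : p ≤ 6) {C : ℝ≥0∞} (hC : 1 ≤ C) : C ^ p ≤ C ^ 6 := by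
  rw [← ENNReal.rpow_natCast]
  exact ENNReal.rpow_le_rpow_of_exponent_le hC (by simpa using hp)

/-! ### The decoupling inequality with extended nonnegative integrals -/

/-- The squared weighted `L^p` norm `(∫ |f|^p w)^{2/p}`. -/
noncomputable def sqNorm (p : ℝ) (f : ℝ × ℝ → ℂ) (w : ℝ × ℝ → ℝ≥0∞) : ℝ≥0∞ :=
  (∫⁻ x, ‖f x‖ₑ ^ p * w x) ^ (2 / p)

/-- The decoupling weight with values in `ℝ≥0∞`. -/
noncomputable def ewB (c : ℝ × ℝ) (R : ℝ) (x : ℝ × ℝ) : ℝ≥0∞ := ENNReal.ofReal (wB c R x)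

/-- The indicator function of a square with values in `ℝ≥0∞`. -/
noncomputable def esqr (c : ℝ × ℝ) (R : ℝ) : ℝ × ℝ → ℝ≥0∞ := (sqr c R).indicator 1

/-- The `k`-th interval piece of `E g` at scale `1/n`. -/
noncomputable def extPiece (n k : ℕ) (g : ℝ → ℂ) : ℝ × ℝ → ℂ :=
  extOp ((k : ℝ) / (n : ℝ)) (((k : ℝ) + 1) / (n : ℝ)) g

lemma measurableSet_sqr (c : ℝ × ℝ) (R : ℝ) : MeasurableSet (sqr c R) :=
  measurableSet_Icc.prod measurableSet_Icc

lemma measurable_esqr (c : ℝ × ℝ) (R : ℝ) : Measurable (esqr c R) :=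
  measurable_one.indicator (measurableSet_sqr c R)

lemma sqNorm_const_mul_le {p : ℝ} (hp : 2 ≤ p) (f : ℝ × ℝ → ℂ) {w w' : ℝ × ℝ → ℝ≥0∞} {C : ℝ≥0}
    (hC : 1 ≤ C) (h : ∀ x, w x ≤ C * w' x) : sqNorm p f w ≤ C * sqNorm p f w' := by
  unfold sqNorm
  refine le_trans ?_ (mul_rpow_two_div_le hp (by exact_mod_cast hC) _)
  rw [← lintegral_const_mul' _ _ ENNReal.coe_ne_top]
  refine ENNReal.rpow_le_rpow (lintegral_mono fun x => ?_) (by positivity)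
  calc ‖f x‖ₑ ^ p * w x ≤ ‖f x‖ₑ ^ p * (C * w' x) := by gcongr; exact h x
    _ = _ := by ring

lemma sqNorm_esqr (p : ℝ) (f : ℝ × ℝ → ℂ) (c : ℝ × ℝ) (R : ℝ) :
    sqNorm p f (esqr c R) = (∫⁻ x in sqr c R, ‖f x‖ₑ ^ p) ^ (2 / p) := by
  rw [sqNorm, ← lintegral_indicator (measurableSet_sqr c R)]
  congr 2; ext x
  by_cases hx : x ∈ sqr c R <;> simp [esqr, hx]

lemma wB_pos (c : ℝ × ℝ) {R : ℝ} (hR : 0 < R) (x : ℝ × ℝ) : 0 < wB c R x := by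
  unfold wB; positivity

lemma measurable_wB (c : ℝ × ℝ) (R : ℝ) : Measurable (wB c R) := by
  have h : wB c R = fun x => ((1 + Real.sqrt ((x.1 - c.1) ^ 2 + (x.2 - c.2) ^ 2) / R) ^ 100)⁻¹ := by
    ext x
    rw [wB, show (-100 : ℤ) = -((100 : ℕ) : ℤ) by norm_num, zpow_neg, zpow_natCast]
  rw [h]
  exact Measurable.inv (Continuous.measurable (by fun_prop))

lemma integrable_wB (c : ℝ × ℝ) {R : ℝ} (hR : 0 < R) : Integrable (wB c R) := by
  have h := integrable_one_add_norm (E := ℝ × ℝ) (μ := volume) (r := 100) (by norm_num)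
  have h2 := (h.comp_smul (inv_pos.2 hR).ne').comp_sub_right c
  refine h2.mono' (measurable_wB c R).aestronglyMeasurable (Eventually.of_forall fun x => ?_)
  rw [Real.norm_eq_abs, abs_of_pos (wB_pos c hR x), wB]
  have hs : ‖x - c‖ ≤ Real.sqrt ((x.1 - c.1) ^ 2 + (x.2 - c.2) ^ 2) := by
    rw [Prod.norm_def]
    refine max_le ?_ ?_
    · rw [Real.norm_eq_abs]; exact Real.abs_le_sqrt (by simp; positivity)
    · rw [Real.norm_eq_abs]; exact Real.abs_le_sqrt (by simp; positivity)
  rw [norm_smul, Real.norm_eq_abs, abs_of_pos (inv_pos.2 hR), inv_mul_eq_div,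
    Real.rpow_neg (by positivity), show (-100 : ℤ) = -((100 : ℕ) : ℤ) by norm_num, zpow_neg,
    zpow_natCast, show (100 : ℝ) = ((100 : ℕ) : ℝ) by norm_num, Real.rpow_natCast]
  gcongr

lemma integrable_norm_rpow_mul {μ : Measure (ℝ × ℝ)} {p : ℝ} (hp : 0 ≤ p) {a b : ℝ} {g : ℝ → ℂ}
    (hg : IntegrableOn g (Icc a b)) {w : ℝ × ℝ → ℝ} (hw : Integrable w μ) :
    Integrable (fun x => ‖extOp a b g x‖ ^ p * w x) μ := by
  refine hw.bdd_mul (c := (∫ ξ in Icc a b, ‖g ξ‖) ^ p) ?_ (Eventually.of_forall fun x => ?_)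
  · exact ((continuous_extOp hg).norm.rpow_const fun _ => Or.inr hp).aestronglyMeasurable
  · rw [Real.norm_of_nonneg (by positivity)]
    exact Real.rpow_le_rpow (norm_nonneg _) (norm_extOp_le g x) hp

lemma ofReal_integral_rpow_sq {μ : Measure (ℝ × ℝ)} {p : ℝ} (hp : 0 < p) {f : ℝ × ℝ → ℝ}
    (hf : Integrable f μ) (h0 : ∀ x, 0 ≤ f x) :
    ENNReal.ofReal (((∫ x, f x ∂μ) ^ (1 / p)) ^ 2) = (∫⁻ x, ENNReal.ofReal (f x) ∂μ) ^ (2 / p) := by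
  rw [← ofReal_integral_eq_lintegral_ofReal hf (Eventually.of_forall h0),
    ENNReal.ofReal_rpow_of_nonneg (integral_nonneg h0) (by positivity)]
  congr 1
  rw [← Real.rpow_natCast, ← Real.rpow_mul (integral_nonneg h0)]
  congr 1; push_cast; ring

lemma ofReal_norm_rpow {p : ℝ} (hp : 0 ≤ p) (z : ℂ) : ENNReal.ofReal (‖z‖ ^ p) = ‖z‖ₑ ^ p := by
  rw [← ENNReal.ofReal_rpow_of_nonneg (norm_nonneg z) hp, ofReal_norm]

lemma ofReal_sqLp_sq {p : ℝ} (hp : 0 < p) {g : ℝ → ℂ} {a b : ℝ} (hg : IntegrableOn g (Icc a b))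
    (c : ℝ × ℝ) (R : ℝ) :
    ENNReal.ofReal (sqLp p c R (extOp a b g) ^ 2) = sqNorm p (extOp a b g) (esqr c R) := by
  have hfin : IsFiniteMeasure ((volume : Measure (ℝ × ℝ)).restrict (sqr c R)) := by
    refine ⟨?_⟩
    rw [Measure.restrict_apply_univ]
    exact (isCompact_Icc.prod isCompact_Icc).measure_lt_top
  have hi := integrable_norm_rpow_mul (μ := volume.restrict (sqr c R)) hp.le hg
    (integrable_const (1 : ℝ))
  simp only [mul_one] at hi
  rw [sqLp, ofReal_integral_rpow_sq hp hi fun x => by positivity, sqNorm_esqr]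
  simp_rw [ofReal_norm_rpow hp.le]

lemma ofReal_wLp_sq {p : ℝ} (hp : 0 < p) {g : ℝ → ℂ} {a b : ℝ} (hg : IntegrableOn g (Icc a b))
    (c : ℝ × ℝ) {R : ℝ} (hR : 0 < R) :
    ENNReal.ofReal (wLp p (wB c R) (extOp a b g) ^ 2) = sqNorm p (extOp a b g) (ewB c R) := by
  have hi := integrable_norm_rpow_mul hp.le hg (integrable_wB c hR)
  rw [wLp, ofReal_integral_rpow_sq hp hi
    fun x => mul_nonneg (by positivity) (wB_pos c hR x).le, sqNorm]
  congr 2; ext x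
  rw [ENNReal.ofReal_mul (by positivity), ofReal_norm_rpow hp.le, ewB]

lemma Icc_piece_subset {n k : ℕ} (hk : k < n) :
    Icc ((k : ℝ) / (n : ℝ)) (((k : ℝ) + 1) / (n : ℝ)) ⊆ Icc 0 1 := by
  have hn : (0 : ℝ) < n := by exact_mod_cast (Nat.zero_le k).trans_lt hk
  have hk' : (k : ℝ) + 1 ≤ n := by exact_mod_cast hk
  exact Icc_subset_Icc (by positivity) (by rw [div_le_one hn]; exact hk')

lemma decIneq_iff {p : ℝ} (hp : 0 < p) {n : ℕ} (hn : 0 < n) {D : ℝ} (hD : 0 ≤ D) :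
    DecIneq p n D ↔ ∀ g : ℝ → ℂ, IntegrableOn g (Icc 0 1) → ∀ c : ℝ × ℝ,
      sqNorm p (extOp 0 1 g) (esqr c ((n : ℝ) ^ 2)) ≤ ENNReal.ofReal (D ^ 2) *
        ∑ k ∈ Finset.range n, sqNorm p (extPiece n k g) (ewB c ((n : ℝ) ^ 2)) := by
  have hR : (0 : ℝ) < (n : ℝ) ^ 2 := by positivity
  refine forall_congr' fun g => forall_congr' fun hg => forall_congr' fun c => ?_
  have hS : ∑ k ∈ Finset.range n, sqNorm p (extPiece n k g) (ewB c ((n : ℝ) ^ 2)) =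
      ENNReal.ofReal (∑ k ∈ Finset.range n, wLp p (wB c ((n : ℝ) ^ 2))
        (extOp ((k : ℝ) / (n : ℝ)) (((k : ℝ) + 1) / (n : ℝ)) g) ^ 2) := by
    rw [ENNReal.ofReal_sum_of_nonneg fun k _ => sq_nonneg _]
    refine Finset.sum_congr rfl fun k hk => ?_
    rw [ofReal_wLp_sq hp (hg.mono_set (Icc_piece_subset (Finset.mem_range.1 hk))) c hR]
    rfl
  rw [hS, ← ofReal_sqLp_sq hp hg, ← ENNReal.ofReal_mul (sq_nonneg D),
    ENNReal.ofReal_le_ofReal_iff (by positivity)]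
  set S := ∑ k ∈ Finset.range n, wLp p (wB c ((n : ℝ) ^ 2))
        (extOp ((k : ℝ) / (n : ℝ)) (((k : ℝ) + 1) / (n : ℝ)) g) ^ 2
  have hS0 : 0 ≤ S := by positivity
  have h0 : 0 ≤ sqLp p c ((n : ℝ) ^ 2) (extOp 0 1 g) := by
    unfold sqLp
    exact Real.rpow_nonneg (integral_nonneg fun x => by positivity) _
  rw [← Real.sqrt_eq_rpow, ← Real.sqrt_sq hD, ← Real.sqrt_mul (by positivity), Real.sqrt_sq hD,
    Real.le_sqrt h0 (by positivity)]

/-! ### Spreading out the amplitude along the parabola -/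

/-- The increment `R ((ξ + τ/R)² - ξ²)`. -/
noncomputable def lam (R τ ξ : ℝ) : ℝ := 2 * ξ * τ + τ ^ 2 / R

/-- The average of modulated translates of `G` at scale `1/R`. -/
noncomputable def twist (a G : ℝ → ℂ) (R u ξ : ℝ) : ℂ :=
  ∫ τ, a τ * G (ξ - τ / R) * ch (-(lam R τ (ξ - τ / R) * u))

/-- The extension of `twist a G R u` from the set `J`, as an integral over `ℝ × ℝ`. -/
noncomputable def twistExt (a G : ℝ → ℂ) (R : ℝ) (J : Set ℝ) (u : ℝ) (x : ℝ × ℝ) : ℂ :=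
  ∫ z : ℝ × ℝ, (a z.1 * J.indicator G z.2) *
    ch (z.2 * x.1 + z.2 ^ 2 * x.2 + z.1 * (x.1 / R) + lam R z.1 z.2 * (x.2 / R - u))

lemma continuous_lam (R : ℝ) : Continuous fun z : ℝ × ℝ => lam R z.1 z.2 := by
  unfold lam; fun_prop

lemma measurePreserving_shear (R : ℝ) :
    MeasurePreserving (fun z : ℝ × ℝ => (z.1, z.2 - z.1 / R)) volume volume :=
  (MeasurePreserving.id volume).skew_product (g := fun τ ξ : ℝ => ξ - τ / R)
    (by fun_prop) (Eventually.of_forall fun τ => (measurePreserving_sub_right volume (τ / R)).map_eq)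

lemma integrable_twist_integrand {a G : ℝ → ℂ} (ha : Integrable a) (hG : Integrable G)
    {φ : ℝ × ℝ → ℝ} (hφ : Continuous φ) :
    Integrable fun z : ℝ × ℝ => (a z.1 * G z.2) * ch (φ z) := by
  refine (ha.mul_prod hG).mul_bdd (c := 1) ?_ ?_
  · exact Continuous.aestronglyMeasurable (by fun_prop)
  · exact Eventually.of_forall fun _ => by simp

lemma integrable_twist_sheared {a G : ℝ → ℂ} (ha : Integrable a) (hG : Integrable G) (R u : ℝ) :
    Integrable fun z : ℝ × ℝ =>
      a z.1 * G (z.2 - z.1 / R) * ch (-(lam R z.1 (z.2 - z.1 / R) * u)) := by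
  have h1 := integrable_twist_integrand ha hG
    (φ := fun z => -(lam R z.1 z.2 * u)) (by unfold lam; fun_prop)
  exact (measurePreserving_shear R).integrable_comp_of_integrable h1

lemma integrable_twist {a G : ℝ → ℂ} (ha : Integrable a) (hG : Integrable G) (R u : ℝ) :
    Integrable (twist a G R u) :=
  (integrable_twist_sheared ha hG R u).integral_prod_right

lemma extOp_twist {a G : ℝ → ℂ} (ha : Integrable a) (hG : Integrable G) {R : ℝ} (hR : 0 < R)
    {s t : ℝ} (h : ∀ τ ξ, a τ ≠ 0 → G ξ ≠ 0 → (ξ ∈ Icc s t ↔ ξ + τ / R ∈ Icc s t))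
    (u : ℝ) (x : ℝ × ℝ) :
    extOp s t (twist a G R u) x = twistExt a G R (Icc s t) u x := by
  have hF := integrable_twist_sheared ha hG R u
  set F : ℝ × ℝ → ℂ := fun z =>
      a z.1 * G (z.2 - z.1 / R) * ch (-(lam R z.1 (z.2 - z.1 / R) * u)) with hFdef
  have hP : Integrable fun z : ℝ × ℝ => F z *
      ((Icc s t).indicator (fun ξ => ch (ξ * x.1 + ξ ^ 2 * x.2)) z.2) := by
    refine hF.mul_bdd (c := 1) ?_ ?_
    · refine Measurable.aestronglyMeasurable ?_
      exact ((Continuous.measurable (by fun_prop)).indicator measurableSet_Icc).comp measurable_snd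
    · refine Eventually.of_forall fun z => ?_
      by_cases hz : z.2 ∈ Icc s t <;> simp [hz]
  have e1 : extOp s t (twist a G R u) x = ∫ ξ, ∫ τ, F (τ, ξ) *
      ((Icc s t).indicator (fun ξ => ch (ξ * x.1 + ξ ^ 2 * x.2)) ξ) := by
    rw [extOp_eq, ← integral_indicator measurableSet_Icc]
    congr 1; ext ξ
    rw [integral_mul_const]
    by_cases hξ : ξ ∈ Icc s t
    · simp only [indicator_of_mem hξ]; rfl
    · simp only [indicator_of_notMem hξ, mul_zero]
  have hP2 : Integrable fun z : ℝ × ℝ => (a z.1 * (Icc s t).indicator G z.2) *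
    ch (z.2 * x.1 + z.2 ^ 2 * x.2 + z.1 * (x.1 / R) + lam R z.1 z.2 * (x.2 / R - u)) :=
    integrable_twist_integrand ha (hG.indicator measurableSet_Icc)
      (by unfold lam; fun_prop)
  rw [e1, ← integral_integral_swap (f := fun τ ξ => F (τ, ξ) *
      ((Icc s t).indicator (fun ξ => ch (ξ * x.1 + ξ ^ 2 * x.2)) ξ)) hP, twistExt,
      Measure.volume_eq_prod, integral_prod _ hP2]
  congr 1; ext τ
  rw [← integral_add_right_eq_self _ (τ / R)]
  congr 1; ext ξ
  simp only [hFdef, add_sub_cancel_right]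
  by_cases ha0 : a τ = 0
  · simp [ha0]
  by_cases hG0 : G ξ = 0
  · have : (Icc s t).indicator G ξ = 0 := by
      by_cases hξ : ξ ∈ Icc s t <;> simp [hξ, hG0]
    simp [hG0, this]
  have hiff := h τ ξ ha0 hG0
  by_cases hξ : ξ ∈ Icc s t
  · rw [indicator_of_mem (hiff.1 hξ), indicator_of_mem hξ, mul_assoc (a τ * G ξ), ← ch_add]
    congr 2
    unfold lam; field_simp; ring
  · rw [indicator_of_notMem (fun h' => hξ (hiff.2 h')), indicator_of_notMem hξ]
    simp

lemma twistExt_diag {a G : ℝ → ℂ} {R : ℝ} (s t : ℝ) (x : ℝ × ℝ) :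
    twistExt a G R (Icc s t) (x.2 / R) x = cft a (x.1 / R) * extOp s t G x := by
  rw [twistExt, cft, extOp_eq, ← integral_indicator measurableSet_Icc, ← integral_prod_mul]
  congr 1; ext z
  rw [sub_self, mul_zero, add_zero, ch_add]
  by_cases hz : z.2 ∈ Icc s t
  · simp only [indicator_of_mem hz]; ring
  · simp only [indicator_of_notMem hz]; ring

lemma continuous_twistExt {a G : ℝ → ℂ} (ha : Integrable a) (hG : Integrable G) (R : ℝ)
    {J : Set ℝ} (hJ : MeasurableSet J) :
    Continuous fun q : ℝ × (ℝ × ℝ) => twistExt a G R J q.1 q.2 := by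
  have hi := ha.mul_prod (hG.indicator hJ)
  unfold twistExt
  refine continuous_of_dominated (bound := fun z => ‖a z.1 * J.indicator G z.2‖) ?_ ?_ hi.norm ?_
  · intro q
    exact (integrable_twist_integrand ha (hG.indicator hJ)
      (by unfold lam; fun_prop)).aestronglyMeasurable
  · intro q; exact Eventually.of_forall fun z => by simp
  · exact Eventually.of_forall fun z => by fun_prop

/-! ### A one-dimensional Sobolev inequality -/

lemma enorm_integral_le_lintegral_phase {α : Type*} [MeasurableSpace α] {μ : Measure α}
    {m : α → ℂ} {l : α → ℝ} (hm : Integrable m μ) (hl : Measurable l)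
    (hlm : Integrable (fun z => (l z : ℂ) * m z) μ) {s : ℝ} (hs : s ∈ Icc (-(1 / 2) : ℝ) (1 / 2)) :
    ‖∫ z, m z ∂μ‖ₑ ≤ ∫⁻ u in Icc (-(1 / 2) : ℝ) (1 / 2),
      (‖∫ z, m z * ch (l z * (s - u)) ∂μ‖ₑ +
        ENNReal.ofReal (2 * Real.pi) * ‖∫ z, (l z : ℂ) * m z * ch (l z * (s - u)) ∂μ‖ₑ) := by
  set F : ℝ → ℂ := fun u => ∫ z, m z * ch (l z * (s - u)) ∂μ with hF
  set G : ℝ → ℂ := fun u => ∫ z, (l z : ℂ) * m z * ch (l z * (s - u)) ∂μ with hG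
  have hmeas : ∀ u, Measurable fun z => ch (l z * (s - u)) := fun u =>
    continuous_ch.measurable.comp (hl.mul_const _)
  have hmi : ∀ {f : α → ℂ}, Integrable f μ → ∀ u, Integrable (fun z => f z * ch (l z * (s - u))) μ :=
    fun hf u => hf.mul_bdd (c := 1) (hmeas u).aestronglyMeasurable
      (Eventually.of_forall fun _ => by simp)
  have hGc : Continuous G := by
    refine continuous_of_dominated (bound := fun z => ‖(l z : ℂ) * m z‖) ?_ ?_ hlm.norm ?_
    · exact fun u => (hmi hlm u).aestronglyMeasurable
    · exact fun u => Eventually.of_forall fun z => by simp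
    · exact Eventually.of_forall fun z => by fun_prop
  have hFc : Continuous F := by
    refine continuous_of_dominated (bound := fun z => ‖m z‖) ?_ ?_ hm.norm ?_
    · exact fun u => (hmi hm u).aestronglyMeasurable
    · exact fun u => Eventually.of_forall fun z => by simp
    · exact Eventually.of_forall fun z => by fun_prop
  have hderiv : ∀ u, HasDerivAt F (-(2 * Real.pi * Complex.I) * G u) u := by
    intro u
    have := (hasDerivAt_integral_of_dominated_loc_of_deriv_le (μ := μ) (s := univ) (x₀ := u)
      (F := fun u z => m z * ch (l z * (s - u)))
      (F' := fun u z => -(2 * Real.pi * Complex.I) * ((l z : ℂ) * m z * ch (l z * (s - u))))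
      (bound := fun z => 2 * Real.pi * ‖(l z : ℂ) * m z‖) univ_mem
      (Eventually.of_forall fun u => (hmi hm u).aestronglyMeasurable) (hmi hm u)
      ((hmi hlm u).const_mul _).aestronglyMeasurable
      (Eventually.of_forall fun z u _ => ?_) (hlm.norm.const_mul _)
      (Eventually.of_forall fun z u _ => ?_)).2
    · rwa [integral_const_mul] at this
    · simp [abs_of_pos Real.pi_pos]
    · have h1 : HasDerivAt (fun u : ℝ => l z * (s - u)) (l z * (-1)) u :=
        ((hasDerivAt_id u).const_sub s).const_mul (l z)
      have h2 := ((hasDerivAt_ch (l z * (s - u))).scomp u h1).const_mul (m z)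
      refine h2.congr_deriv ?_
      rw [Complex.real_smul]; push_cast; ring
  set I := Icc (-(1 / 2) : ℝ) (1 / 2)
  have hvol : volume I = 1 := by
    simp only [I, Real.volume_Icc]; norm_num
  have hpt : ∀ u ∈ I, ‖F s‖ₑ ≤ ‖F u‖ₑ + ∫⁻ v in I, ENNReal.ofReal (2 * Real.pi) * ‖G v‖ₑ := by
    intro u hu
    have hint := intervalIntegral.integral_eq_sub_of_hasDerivAt (a := u) (b := s)
      (fun v _ => hderiv v) ((by fun_prop : Continuous fun v => -(2 * Real.pi * Complex.I) * G v
        ).intervalIntegrable u s)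
    have e : F s = F u + ∫ v in u..s, -(2 * Real.pi * Complex.I) * G v := by rw [hint]; ring
    rw [e]
    refine (enorm_add_le _ _).trans (add_le_add le_rfl ?_)
    have hsub : Set.uIoc u s ⊆ I := uIoc_subset_uIcc.trans (uIcc_subset_Icc hu hs)
    calc ‖∫ v in u..s, -(2 * Real.pi * Complex.I) * G v‖ₑ
        = ‖∫ v in Set.uIoc u s, -(2 * Real.pi * Complex.I) * G v‖ₑ := by
          rw [← ofReal_norm, ← ofReal_norm, intervalIntegral.norm_intervalIntegral_eq]
      _ ≤ ∫⁻ v in Set.uIoc u s, ‖-(2 * Real.pi * Complex.I) * G v‖ₑ :=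
          enorm_integral_le_lintegral_enorm _
      _ ≤ ∫⁻ v in I, ‖-(2 * Real.pi * Complex.I) * G v‖ₑ := lintegral_mono_set hsub
      _ = _ := by
          congr 1; ext v
          rw [enorm_mul, ← ofReal_norm (-(2 * Real.pi * Complex.I))]
          congr 2
          simp [abs_of_pos Real.pi_pos]
  have hFs : F s = ∫ z, m z ∂μ := by simp [hF]
  rw [← hFs]
  calc ‖F s‖ₑ = ∫⁻ u in I, ‖F s‖ₑ := by rw [setLIntegral_const, hvol, mul_one]
    _ ≤ ∫⁻ u in I, (‖F u‖ₑ + ∫⁻ v in I, ENNReal.ofReal (2 * Real.pi) * ‖G v‖ₑ) :=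
        setLIntegral_mono' measurableSet_Icc hpt
    _ = (∫⁻ u in I, ‖F u‖ₑ) + ∫⁻ v in I, ENNReal.ofReal (2 * Real.pi) * ‖G v‖ₑ := by
        rw [lintegral_add_left hFc.enorm.measurable, setLIntegral_const, hvol, mul_one]
    _ = _ := by rw [lintegral_add_left hFc.enorm.measurable]

/-! ### Decaying weights -/

/-- The weight `(1 + |y|)^{-m}`. -/
noncomputable def jb (m : ℕ) (y : ℝ) : ℝ := ((1 + |y|) ^ m)⁻¹

lemma jb_pos (m : ℕ) (y : ℝ) : 0 < jb m y := by unfold jb; positivity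

lemma continuous_jb (m : ℕ) : Continuous (jb m) := by
  unfold jb
  exact Continuous.inv₀ (by fun_prop) fun y => by positivity

lemma jb_le (m : ℕ) (x y : ℝ) : jb m x ≤ jb m (x - y) * (1 + |y|) ^ m := by
  unfold jb
  rw [inv_mul_eq_div, inv_eq_one_div, div_le_div_iff₀ (by positivity) (by positivity), one_mul,
    ← mul_pow]
  refine pow_le_pow_left₀ (by positivity) ?_ m
  have := abs_sub x y
  nlinarith [abs_nonneg x, abs_nonneg y]

/-- The weight localized to a horizontal slab of height `R` and decaying horizontally. -/
noncomputable def slab (c : ℝ × ℝ) (R : ℝ) (x : ℝ × ℝ) : ℝ≥0∞ :=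
  (Icc (-(1 / 2) : ℝ) (1 / 2)).indicator 1 ((x.2 - c.2) / R) *
    ENNReal.ofReal (jb 102 ((x.1 - c.1) / R))

lemma measurable_slab_zero (R : ℝ) : Measurable (slab 0 R) := by
  unfold slab
  have h1 : Measurable fun y : ℝ => (Icc (-(1 / 2) : ℝ) (1 / 2)).indicator (1 : ℝ → ℝ≥0∞) y :=
    measurable_one.indicator measurableSet_Icc
  have h2 := (continuous_jb 102).measurable
  exact (h1.comp (by fun_prop : Measurable fun x : ℝ × ℝ => (x.2 - (0 : ℝ × ℝ).2) / R)).mul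
    (h2.comp (by fun_prop : Measurable fun x : ℝ × ℝ => (x.1 - (0 : ℝ × ℝ).1) / R)).ennreal_ofReal

lemma lintegral_eq_mul_lintegral_comp_mul {R : ℝ} (hR : 0 < R) {f : ℝ → ℝ≥0∞}
    (hf : Measurable f) : ∫⁻ x, f x = ENNReal.ofReal R * ∫⁻ u, f (u * R) := by
  conv_lhs => rw [← Real.smul_map_volume_mul_right hR.ne', lintegral_smul_measure,
    lintegral_map hf (by fun_prop), abs_of_pos hR]
  rfl

lemma ewB_le_jb {R : ℝ} (hR : 0 < R) (x : ℝ × ℝ) : ewB 0 R x ≤ ENNReal.ofReal (jb 100 (x.2 / R)) := by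
  refine ENNReal.ofReal_le_ofReal ?_
  rw [wB, jb, show (-100 : ℤ) = -((100 : ℕ) : ℤ) by norm_num, zpow_neg, zpow_natCast, abs_div,
    abs_of_pos hR]
  have hs : |x.2| ≤ Real.sqrt ((x.1 - (0 : ℝ × ℝ).1) ^ 2 + (x.2 - (0 : ℝ × ℝ).2) ^ 2) :=
    Real.abs_le_sqrt (by simp; positivity)
  gcongr

/-- The mass of `|E_J h|^p` in a square is controlled by its mass on a horizontal line. -/
lemma lintegral_ewB_le_line : ∃ C : ℝ≥0, ∀ p : ℝ, 1 ≤ p → p ≤ 6 → ∀ n : ℕ, 0 < n →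
    ∀ k < n, ∀ h : ℝ → ℂ, IntegrableOn h (Icc 0 1) → ∀ u ∈ Icc (-(1 / 2) : ℝ) (1 / 2),
    ∫⁻ x, ‖extPiece n k h x‖ₑ ^ p * ewB 0 ((n : ℝ) ^ 2) x ≤
      C * (ENNReal.ofReal ((n : ℝ) ^ 2) *
        ∫⁻ x₁, ‖extPiece n k h (x₁, u * (n : ℝ) ^ 2)‖ₑ ^ p) := by
  obtain ⟨C₀, hC₀⟩ := extOp_line_le
  refine ⟨(max C₀ 1) ^ 6 * (64 * Real.pi).toNNReal, fun p hp hp6 n hn k hk h hh u hu => ?_⟩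
  set R : ℝ := (n : ℝ) ^ 2 with hRdef
  have hn0 : (0 : ℝ) < n := by exact_mod_cast hn
  have hR : 0 < R := by positivity
  have hhk := hh.mono_set (Icc_piece_subset hk)
  have hend : ((k : ℝ) + 1) / n = (k : ℝ) / n + 1 / n := add_div _ _ _
  set L := ∫⁻ x₁, ‖extPiece n k h (x₁, u * R)‖ₑ ^ p with hL
  have hcont : Continuous (extPiece n k h) := continuous_extOp hhk
  have hew : Measurable (ewB 0 R) := (measurable_wB 0 R).ennreal_ofReal
  have hy : ∀ y : ℝ, jb 100 y * (1 + (y - u) ^ 2) ^ 6 ≤ 64 * (1 + y ^ 2)⁻¹ := by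
    intro y
    have hu' : |u| ≤ 1 := abs_le.2 ⟨by linarith [hu.1], by linarith [hu.2]⟩
    have h1 : 1 + (y - u) ^ 2 ≤ 2 * (1 + |y|) ^ 2 := by
      have h3 : |y - u| ≤ 1 + |y| := by
        have := abs_sub y u; linarith
      have h4 : (y - u) ^ 2 ≤ (1 + |y|) ^ 2 := by
        rw [← sq_abs (y - u)]; exact pow_le_pow_left₀ (abs_nonneg _) h3 2
      nlinarith [abs_nonneg y]
    have h2 : (1 + (y - u) ^ 2) ^ 6 ≤ 64 * (1 + |y|) ^ 12 := by
      calc (1 + (y - u) ^ 2) ^ 6 ≤ (2 * (1 + |y|) ^ 2) ^ 6 :=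
            pow_le_pow_left₀ (by positivity) h1 6
        _ = _ := by ring
    have h5 : jb 100 y * (1 + |y|) ^ 12 ≤ (1 + y ^ 2)⁻¹ := by
      rw [jb, inv_mul_eq_div, inv_eq_one_div, div_le_div_iff₀ (by positivity) (by positivity),
        one_mul]
      have h6 : 1 + y ^ 2 ≤ (1 + |y|) ^ 2 := by
        rw [← sq_abs y]; nlinarith [abs_nonneg y]
      have h7 : (1 + |y|) ^ 2 ≤ (1 + |y|) ^ 88 :=
        pow_le_pow_right₀ (by linarith [abs_nonneg y]) (by norm_num)
      calc (1 + |y|) ^ 12 * (1 + y ^ 2) ≤ (1 + |y|) ^ 12 * (1 + |y|) ^ 88 := by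
            gcongr; exact h6.trans h7
        _ = _ := by ring
    calc jb 100 y * (1 + (y - u) ^ 2) ^ 6 ≤ jb 100 y * (64 * (1 + |y|) ^ 12) := by
          gcongr; exact (jb_pos _ _).le
      _ = 64 * (jb 100 y * (1 + |y|) ^ 12) := by ring
      _ ≤ _ := by gcongr
  have hline : ∀ x₂, ∫⁻ x₁, ‖extPiece n k h (x₁, x₂)‖ₑ ^ p * ewB 0 R (x₁, x₂) ≤
      (((max C₀ 1) ^ 6 : ℝ≥0) * L) * ENNReal.ofReal (64 * (1 + (x₂ / R) ^ 2)⁻¹) := by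
    intro x₂
    have hl := hC₀ p hp n hn0 (k / n) x₂ (u * R) h (by rw [← hend]; exact hhk)
    rw [← hend] at hl
    have hT : (x₂ - u * R) / (n : ℝ) ^ 2 = x₂ / R - u := by
      rw [← hRdef]; field_simp
    rw [hT] at hl
    have hpow : ((C₀ : ℝ≥0∞) * ENNReal.ofReal (1 + (x₂ / R - u) ^ 2)) ^ p ≤
        (((max C₀ 1) ^ 6 : ℝ≥0) : ℝ≥0∞) * ENNReal.ofReal ((1 + (x₂ / R - u) ^ 2) ^ 6) := by
      have h1 : (1 : ℝ≥0∞) ≤ ((max C₀ 1 : ℝ≥0) : ℝ≥0∞) * ENNReal.ofReal (1 + (x₂ / R - u) ^ 2) := by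
        refine one_le_mul ?_ ?_
        · exact_mod_cast le_max_right _ _
        · rw [ENNReal.one_le_ofReal]; nlinarith [sq_nonneg (x₂ / R - u)]
      calc _ ≤ (((max C₀ 1 : ℝ≥0) : ℝ≥0∞) * ENNReal.ofReal (1 + (x₂ / R - u) ^ 2)) ^ p := by
            refine ENNReal.rpow_le_rpow ?_ (by linarith)
            gcongr
            exact le_max_left _ _
        _ ≤ _ := rpow_le_pow_six hp6 h1
        _ = _ := by
            rw [mul_pow, ENNReal.ofReal_pow (by positivity)]; push_cast; rfl
    calc ∫⁻ x₁, ‖extPiece n k h (x₁, x₂)‖ₑ ^ p * ewB 0 R (x₁, x₂)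
        ≤ ∫⁻ x₁, ‖extPiece n k h (x₁, x₂)‖ₑ ^ p * ENNReal.ofReal (jb 100 (x₂ / R)) := by
          gcongr with x₁; exact ewB_le_jb hR (x₁, x₂)
      _ = (∫⁻ x₁, ‖extPiece n k h (x₁, x₂)‖ₑ ^ p) * ENNReal.ofReal (jb 100 (x₂ / R)) :=
          lintegral_mul_const' _ _ ENNReal.ofReal_ne_top
      _ ≤ ((((max C₀ 1) ^ 6 : ℝ≥0) * ENNReal.ofReal ((1 + (x₂ / R - u) ^ 2) ^ 6)) * L) *
            ENNReal.ofReal (jb 100 (x₂ / R)) := by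
          gcongr
          exact hl.trans (mul_le_mul' hpow le_rfl)
      _ = (((max C₀ 1) ^ 6 : ℝ≥0) * L) *
            ENNReal.ofReal (jb 100 (x₂ / R) * (1 + (x₂ / R - u) ^ 2) ^ 6) := by
          rw [ENNReal.ofReal_mul (jb_pos _ _).le]; ring
      _ ≤ _ := mul_le_mul' le_rfl (ENNReal.ofReal_le_ofReal (hy _))
  rw [Measure.volume_eq_prod, lintegral_prod_symm _ (by fun_prop)]
  calc ∫⁻ x₂, ∫⁻ x₁, ‖extPiece n k h (x₁, x₂)‖ₑ ^ p * ewB 0 R (x₁, x₂)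
      ≤ ∫⁻ x₂, (((max C₀ 1) ^ 6 : ℝ≥0) * L) * ENNReal.ofReal (64 * (1 + (x₂ / R) ^ 2)⁻¹) :=
        lintegral_mono hline
    _ = (((max C₀ 1) ^ 6 : ℝ≥0) * L) * ∫⁻ x₂, ENNReal.ofReal (64 * (1 + (x₂ / R) ^ 2)⁻¹) :=
        lintegral_const_mul _ (by fun_prop)
    _ = (((max C₀ 1) ^ 6 : ℝ≥0) * L) * ENNReal.ofReal (64 * (R * Real.pi)) := by
        rw [← ofReal_integral_eq_lintegral_ofReal
          ((integrable_inv_one_add_sq.comp_div hR.ne').const_mul _)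
          (Eventually.of_forall fun y => by positivity), integral_const_mul,
          Measure.integral_comp_div (fun y : ℝ => (1 + y ^ 2)⁻¹), integral_univ_inv_one_add_sq,
          smul_eq_mul, abs_of_pos hR]
    _ = _ := by
        have : ENNReal.ofReal (64 * (R * Real.pi)) =
            ((64 * Real.pi).toNNReal : ℝ≥0∞) * ENNReal.ofReal R := by
          rw [show ((64 * Real.pi).toNNReal : ℝ≥0∞) = ENNReal.ofReal (64 * Real.pi) from rfl,
            ← ENNReal.ofReal_mul (by positivity)]
          congr 1; ring
        rw [this]; push_cast; ring

/-! ### Decoupling for the spread-out function -/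

/-- Translates by `τ/n²` with `a τ ≠ 0` keep the support of `G` inside the same intervals of
length `1/n`. -/
def IsSeparated (a G : ℝ → ℂ) (n : ℕ) : Prop :=
  ∀ τ ξ : ℝ, a τ ≠ 0 → G ξ ≠ 0 → ∃ k : ℕ, k < n ∧
    ξ ∈ Ioo ((k : ℝ) / (n : ℝ)) (((k : ℝ) + 1) / (n : ℝ)) ∧
    ξ + τ / (n : ℝ) ^ 2 ∈ Ioo ((k : ℝ) / (n : ℝ)) (((k : ℝ) + 1) / (n : ℝ))

lemma mem_piece_iff_of_mem_Ioo {n k j : ℕ} (hn : 0 < n) {ξ : ℝ}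
    (h : ξ ∈ Ioo ((k : ℝ) / (n : ℝ)) (((k : ℝ) + 1) / (n : ℝ))) :
    ξ ∈ Icc ((j : ℝ) / (n : ℝ)) (((j : ℝ) + 1) / (n : ℝ)) ↔ j = k := by
  have hn0 : (0 : ℝ) < n := by exact_mod_cast hn
  constructor
  · intro h'
    have h1 : (j : ℝ) < k + 1 := (div_lt_div_iff_of_pos_right hn0).1 (h'.1.trans_lt h.2)
    have h2 : (k : ℝ) < j + 1 := (div_lt_div_iff_of_pos_right hn0).1 (h.1.trans_le h'.2)
    have h1' : j < k + 1 := by exact_mod_cast h1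
    have h2' : k < j + 1 := by exact_mod_cast h2
    omega
  · rintro rfl
    exact ⟨h.1.le, h.2.le⟩

lemma IsSeparated.mem_piece_iff {a G : ℝ → ℂ} {n : ℕ} (hn : 0 < n) (h : IsSeparated a G n)
    (j : ℕ) (τ ξ : ℝ) (ha : a τ ≠ 0) (hG : G ξ ≠ 0) :
    ξ ∈ Icc ((j : ℝ) / (n : ℝ)) (((j : ℝ) + 1) / (n : ℝ)) ↔
      ξ + τ / (n : ℝ) ^ 2 ∈ Icc ((j : ℝ) / (n : ℝ)) (((j : ℝ) + 1) / (n : ℝ)) := by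
  obtain ⟨k, _, h1, h2⟩ := h τ ξ ha hG
  rw [mem_piece_iff_of_mem_Ioo hn h1, mem_piece_iff_of_mem_Ioo hn h2]

lemma IsSeparated.mem_unit_iff {a G : ℝ → ℂ} {n : ℕ} (h : IsSeparated a G n)
    (τ ξ : ℝ) (ha : a τ ≠ 0) (hG : G ξ ≠ 0) :
    ξ ∈ Icc (0 : ℝ) 1 ↔ ξ + τ / (n : ℝ) ^ 2 ∈ Icc (0 : ℝ) 1 := by
  obtain ⟨k, hk, h1, h2⟩ := h τ ξ ha hG
  exact iff_of_true (Icc_piece_subset hk (Ioo_subset_Icc_self h1))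
    (Icc_piece_subset hk (Ioo_subset_Icc_self h2))

lemma enorm_cft_rpow_le {a : ℝ → ℂ} (ha : ContDiff ℝ ∞ a) (hc : HasCompactSupport a) :
    ∃ C : ℝ≥0, ∀ p : ℝ, 4 < p → p < 6 → ∀ y, ‖cft a y‖ₑ ^ p ≤ C * ENNReal.ofReal (jb 102 y) := by
  obtain ⟨C₀, hC₀⟩ := cft_decay ha hc 26
  set C := max C₀ 1
  have hC1 : 1 ≤ C := le_max_right _ _
  refine ⟨(C ^ 6).toNNReal, fun p hp4 hp6 y => ?_⟩
  have h1 : 1 ≤ 1 + |y| := by linarith [abs_nonneg y]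
  have hj1 : jb 26 y ≤ 1 := inv_le_one_of_one_le₀ (one_le_pow₀ h1)
  have hn : ‖cft a y‖ ≤ C * jb 26 y := by
    rw [jb, ← div_eq_mul_inv, le_div_iff₀ (by positivity), mul_comm]
    exact (hC₀ y).trans (le_max_left _ _)
  have h2 : ‖cft a y‖ ^ p ≤ C ^ 6 * jb 102 y := by
    calc ‖cft a y‖ ^ p ≤ (C * jb 26 y) ^ p :=
          Real.rpow_le_rpow (norm_nonneg _) hn (by linarith)
      _ = C ^ p * jb 26 y ^ p := Real.mul_rpow (by positivity) (jb_pos _ _).le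
      _ ≤ C ^ (6 : ℝ) * jb 26 y ^ (4 : ℝ) := by
          exact mul_le_mul (Real.rpow_le_rpow_of_exponent_le hC1 hp6.le)
            (Real.rpow_le_rpow_of_exponent_ge (jb_pos _ _) hj1 hp4.le)
            (Real.rpow_nonneg (jb_pos _ _).le _) (by positivity)
      _ = C ^ 6 * jb 104 y := by
          rw [show (6 : ℝ) = ((6 : ℕ) : ℝ) by norm_num, show (4 : ℝ) = ((4 : ℕ) : ℝ) by norm_num,
            Real.rpow_natCast, Real.rpow_natCast]
          congr 1
          rw [jb, jb, inv_pow, ← pow_mul]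
      _ ≤ _ := by
          gcongr
          exact inv_anti₀ (by positivity) (pow_le_pow_right₀ h1 (by norm_num))
  rw [← ofReal_norm_rpow (by linarith), show (((C ^ 6).toNNReal : ℝ≥0) : ℝ≥0∞) =
    ENNReal.ofReal (C ^ 6) from rfl, ← ENNReal.ofReal_mul (by positivity)]
  exact ENNReal.ofReal_le_ofReal h2

lemma lintegral_slab {R : ℝ} (hR : 0 < R) {f : ℝ × ℝ → ℝ≥0∞} (hf : Measurable f) :
    ∫⁻ x, f x * slab 0 R x = ∫⁻ u in Icc (-(1 / 2) : ℝ) (1 / 2), ENNReal.ofReal R *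
      ∫⁻ x₁, f (x₁, u * R) * ENNReal.ofReal (jb 102 (x₁ / R)) := by
  have hj := (continuous_jb 102).measurable
  have hs := measurable_slab_zero R
  rw [Measure.volume_eq_prod, lintegral_prod_symm _ (by fun_prop),
    lintegral_eq_mul_lintegral_comp_mul hR
      (Measurable.lintegral_prod_left' (f := fun x : ℝ × ℝ => f x * slab 0 R x) (by fun_prop)),
    lintegral_const_mul _ (by fun_prop), ← lintegral_indicator measurableSet_Icc]
  congr 2; ext u
  by_cases hu : u ∈ Icc (-(1 / 2) : ℝ) (1 / 2)
  · simp only [slab, Prod.fst_zero, Prod.snd_zero, sub_zero, mul_div_cancel_right₀ u hR.ne',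
      indicator_of_mem hu, Pi.one_apply, one_mul]
  · simp only [slab, Prod.fst_zero, Prod.snd_zero, sub_zero, mul_div_cancel_right₀ u hR.ne',
      indicator_of_notMem hu, zero_mul, mul_zero, lintegral_zero]

/-- Decoupling applied to all the functions `twist a G R u`. -/
lemma decoupling_twist {a : ℝ → ℂ} (ha : ContDiff ℝ ∞ a) (hc : HasCompactSupport a) :
    ∃ C : ℝ≥0, ∀ p : ℝ, 4 < p → p < 6 → ∀ n : ℕ, 0 < n → ∀ D : ℝ, 0 ≤ D → DecIneq p n D →
    ∀ G : ℝ → ℂ, Integrable G → IsSeparated a G n →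
    (∫⁻ u in Icc (-(1 / 2) : ℝ) (1 / 2), ∫⁻ x in sqr 0 ((n : ℝ) ^ 2),
      ‖twistExt a G ((n : ℝ) ^ 2) (Icc 0 1) u x‖ₑ ^ p) ^ (2 / p) ≤
      C * ENNReal.ofReal (D ^ 2) *
        ∑ k ∈ Finset.range n, sqNorm p (extPiece n k G) (slab 0 ((n : ℝ) ^ 2)) := by
  obtain ⟨C₁, hC₁⟩ := lintegral_ewB_le_line
  obtain ⟨C₂, hC₂⟩ := enorm_cft_rpow_le ha hc
  set C : ℝ≥0 := max (C₁ * C₂) 1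
  refine ⟨C, fun p hp4 hp6 n hn D hD hdec G hG hsep => ?_⟩
  have hn0 : (0 : ℝ) < n := by exact_mod_cast hn
  set R : ℝ := (n : ℝ) ^ 2 with hRdef
  have hR : 0 < R := by positivity
  have hai : Integrable a := ha.continuous.integrable_of_hasCompactSupport hc
  set I := Icc (-(1 / 2) : ℝ) (1 / 2)
  have hmE : ∀ k, Measurable fun x : ℝ × ℝ => ‖extPiece n k G x‖ₑ ^ p := fun k =>
    (continuous_extOp hG.integrableOn).enorm.measurable.pow_const p
  have hj := (continuous_jb 102).measurable
  let Y : ℕ → ℝ → ℝ≥0∞ := fun k u => C * (ENNReal.ofReal R * ∫⁻ x₁,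
      ‖extPiece n k G (x₁, u * R)‖ₑ ^ p * ENNReal.ofReal (jb 102 (x₁ / R)))
  have hYm : ∀ k, Measurable (Y k) := by
    intro k
    refine Measurable.const_mul (Measurable.const_mul ?_ _) _
    refine Measurable.lintegral_prod_right' (f := fun q : ℝ × ℝ =>
      ‖extPiece n k G (q.2, q.1 * R)‖ₑ ^ p * ENNReal.ofReal (jb 102 (q.2 / R))) ?_
    exact ((hmE k).comp (by fun_prop : Measurable fun q : ℝ × ℝ => (q.2, q.1 * R))).mul
      (hj.comp (by fun_prop : Measurable fun q : ℝ × ℝ => q.2 / R)).ennreal_ofReal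
  have key : ∀ u ∈ I, (∫⁻ x in sqr 0 R, ‖twistExt a G R (Icc 0 1) u x‖ₑ ^ p) ^ (2 / p) ≤
      ENNReal.ofReal (D ^ 2) * ∑ k ∈ Finset.range n, Y k u ^ (2 / p) := by
    intro u hu
    have hh := (integrable_twist hai hG R u).integrableOn (s := Icc 0 1)
    have h1 := (decIneq_iff (by linarith) hn hD).1 hdec (twist a G R u) hh 0
    rw [sqNorm_esqr] at h1
    have e1 : ∀ x, extOp 0 1 (twist a G R u) x = twistExt a G R (Icc 0 1) u x :=
      extOp_twist hai hG hR (hsep.mem_unit_iff) u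
    simp_rw [e1] at h1
    refine h1.trans ?_
    gcongr with k hk
    have hk' := Finset.mem_range.1 hk
    refine ENNReal.rpow_le_rpow ?_ (by positivity)
    refine (hC₁ p (by linarith) hp6.le n hn k hk' _ hh u hu).trans ?_
    have e2 : ∀ x₁, extPiece n k (twist a G R u) (x₁, u * R) =
        cft a (x₁ / R) * extPiece n k G (x₁, u * R) := by
      intro x₁
      have h3 := extOp_twist hai hG hR (hsep.mem_piece_iff hn k) u (x₁, u * R)
      have h4 := twistExt_diag (a := a) (G := G) (R := R) ((k : ℝ) / n) (((k : ℝ) + 1) / n)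
        (x₁, u * R)
      simp only [mul_div_cancel_right₀ u hR.ne'] at h4
      exact h3.trans h4
    calc C₁ * (ENNReal.ofReal R * ∫⁻ x₁, ‖extPiece n k (twist a G R u) (x₁, u * R)‖ₑ ^ p)
        ≤ C₁ * (ENNReal.ofReal R * ∫⁻ x₁, C₂ * (‖extPiece n k G (x₁, u * R)‖ₑ ^ p *
            ENNReal.ofReal (jb 102 (x₁ / R)))) := by
          refine mul_le_mul' le_rfl (mul_le_mul' le_rfl (lintegral_mono fun x₁ => ?_))
          simp only [e2]
          rw [enorm_mul, ENNReal.mul_rpow_of_nonneg _ _ (by linarith)]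
          calc _ ≤ (C₂ * ENNReal.ofReal (jb 102 (x₁ / R))) *
                ‖extPiece n k G (x₁, u * R)‖ₑ ^ p := mul_le_mul' (hC₂ p hp4 hp6 _) le_rfl
            _ = _ := by ring
      _ = ((C₁ * C₂ : ℝ≥0) : ℝ≥0∞) * (ENNReal.ofReal R * ∫⁻ x₁,
            ‖extPiece n k G (x₁, u * R)‖ₑ ^ p * ENNReal.ofReal (jb 102 (x₁ / R))) := by
          rw [lintegral_const_mul' _ _ ENNReal.coe_ne_top]; push_cast; ring
      _ ≤ Y k u := by
          have hC : ((C₁ * C₂ : ℝ≥0) : ℝ≥0∞) ≤ C := by exact_mod_cast le_max_left (C₁ * C₂) 1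
          exact mul_le_mul' hC le_rfl
  have hX := lintegral_rpow_le_sum (μ := volume.restrict I) (p := p) (by linarith)
    (Finset.range n) (ENNReal.ofReal (D ^ 2))
    (X := I.indicator fun u => ∫⁻ x in sqr 0 R, ‖twistExt a G R (Icc 0 1) u x‖ₑ ^ p) (Y := Y)
    (fun k => (hYm k).aemeasurable) (fun u => by
      by_cases hu : u ∈ I
      · rw [indicator_of_mem hu]; exact key u hu
      · rw [indicator_of_notMem hu, ENNReal.zero_rpow_of_pos (by positivity)]
        exact bot_le)
  rw [setLIntegral_indicator measurableSet_Icc, inter_self] at hX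
  refine hX.trans ?_
  rw [mul_comm (C : ℝ≥0∞), mul_assoc]
  refine mul_le_mul' le_rfl ?_
  rw [Finset.mul_sum]
  refine Finset.sum_le_sum fun k _ => ?_
  rw [lintegral_const_mul' _ _ ENNReal.coe_ne_top, ← lintegral_slab hR (hmE k)]
  have hC1 : (1 : ℝ≥0∞) ≤ C := by exact_mod_cast le_max_right (C₁ * C₂) 1
  exact mul_rpow_two_div_le (by linarith) hC1 _

/-! ### Multipliers and the slab weight -/

lemma lintegral_cft_mul_lt_top {b : ℝ → ℂ} (hb : ContDiff ℝ ∞ b) (hc : HasCompactSupport b) :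
    ∫⁻ y, ‖cft b y‖ₑ * ENNReal.ofReal ((1 + |y|) ^ 102) < ⊤ := by
  obtain ⟨C, hC⟩ := cft_decay hb hc 104
  have hC0 : 0 ≤ C := le_trans (by positivity) (hC 0)
  have h : ∀ y, ‖cft b y‖ₑ * ENNReal.ofReal ((1 + |y|) ^ 102) ≤
      ENNReal.ofReal (C * (1 + y ^ 2)⁻¹) := by
    intro y
    rw [← ofReal_norm, ← ENNReal.ofReal_mul (norm_nonneg _)]
    refine ENNReal.ofReal_le_ofReal ?_
    rw [← div_eq_mul_inv, le_div_iff₀ (by positivity)]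
    refine le_trans ?_ (hC y)
    have h1 : 1 + y ^ 2 ≤ (1 + |y|) ^ 2 := by
      rw [← sq_abs y]; nlinarith [abs_nonneg y]
    calc ‖cft b y‖ * (1 + |y|) ^ 102 * (1 + y ^ 2)
        ≤ ‖cft b y‖ * (1 + |y|) ^ 102 * (1 + |y|) ^ 2 := by gcongr
      _ = _ := by ring
  refine (lintegral_mono h).trans_lt ?_
  rw [← ofReal_integral_eq_lintegral_ofReal (integrable_inv_one_add_sq.const_mul _)
    (Eventually.of_forall fun y => by positivity)]
  exact ENNReal.ofReal_lt_top

lemma sqNorm_slab_multiplier_le {b : ℝ → ℂ} (hb : ContDiff ℝ ∞ b) (hc : HasCompactSupport b) :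
    ∃ C : ℝ≥0, ∀ p : ℝ, 4 < p → ∀ (s t R l ξ₀ : ℝ) (G : ℝ → ℂ), IntegrableOn G (Icc s t) →
      0 < R → |l| ≤ R →
      sqNorm p (extOp s t fun ξ => b (l * (ξ - ξ₀)) * G ξ) (slab 0 R) ≤
        C * sqNorm p (extOp s t G) (slab 0 R) := by
  set B := ∫⁻ y, ‖cft b y‖ₑ * ENNReal.ofReal ((1 + |y|) ^ 102) with hB
  have hBtop : B ≠ ⊤ := (lintegral_cft_mul_lt_top hb hc).ne
  have hAB : ∫⁻ y, ‖cft b y‖ₑ ≤ B := by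
    refine lintegral_mono fun y => ?_
    refine le_mul_of_one_le_right' ?_
    rw [ENNReal.one_le_ofReal]
    exact one_le_pow₀ (by linarith [abs_nonneg y])
  refine ⟨B.toNNReal ^ 2, fun p hp s t R l ξ₀ G hG hR hl => ?_⟩
  have hj := (continuous_jb 102).measurable
  have hbG : IntegrableOn (fun ξ => b (l * (ξ - ξ₀)) * G ξ) (Icc s t) := by
    obtain ⟨M, hM⟩ := hc.exists_bound_of_continuous hb.continuous
    refine hG.bdd_mul (c := M) ?_ (Eventually.of_forall fun ξ => hM _)
    exact (hb.continuous.comp (by fun_prop : Continuous fun ξ : ℝ => l * (ξ - ξ₀))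
      ).aestronglyMeasurable
  have hm : ∀ {H : ℝ → ℂ}, IntegrableOn H (Icc s t) →
      Measurable fun x : ℝ × ℝ => ‖extOp s t H x‖ₑ ^ p := fun hH =>
    (continuous_extOp hH).enorm.measurable.pow_const p
  have hpow : B ^ (p - 1) * B = B ^ p := by
    nth_rewrite 2 [← ENNReal.rpow_one B]
    rw [← ENNReal.rpow_add_of_nonneg _ _ (by linarith) (by norm_num)]
    congr 1; ring
  unfold sqNorm
  rw [ENNReal.coe_pow, ENNReal.coe_toNNReal hBtop, ← rpow_mul_rpow_two_div (by linarith)]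
  refine ENNReal.rpow_le_rpow ?_ (by positivity)
  rw [lintegral_slab hR (hm hbG), lintegral_slab hR (hm hG), ← lintegral_const_mul' _ _
    (ENNReal.rpow_ne_top_of_nonneg (by linarith) hBtop)]
  refine lintegral_mono fun u => ?_
  rw [mul_left_comm]
  refine mul_le_mul' le_rfl ?_
  have h := lintegral_extOp_multiplier_le hb hc hG l ξ₀ (u * R) (p := p) (by linarith)
    (w := fun x => ENNReal.ofReal (jb 102 (x / R)))
    (ρ := fun y => ENNReal.ofReal ((1 + |y|) ^ 102)) (by fun_prop) (by fun_prop) ?_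
  · refine h.trans (mul_le_mul' ?_ le_rfl)
    rw [← hpow]
    refine mul_le_mul' (ENNReal.rpow_le_rpow hAB (by linarith)) le_rfl
  · intro x y
    rw [← ENNReal.ofReal_mul (jb_pos _ _).le]
    refine ENNReal.ofReal_le_ofReal ((jb_le 102 (x / R) (l * y / R)).trans ?_)
    rw [← sub_div]
    have h1 : |l * y / R| ≤ |y| := by
      rw [abs_div, abs_mul, abs_of_pos hR, div_le_iff₀ hR, mul_comm |y|]
      exact mul_le_mul_of_nonneg_right hl (abs_nonneg y)
    have := (jb_pos 102 ((x - l * y) / R)).le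
    gcongr

/-! ### Decoupling for separated functions -/

lemma le_norm_cft {c : ℝ} (f : ContDiffBump c) (hf : ∀ τ, f τ ≠ 0 → |τ| ≤ 1 / 3) {y : ℝ}
    (hy : |y| ≤ 1 / 2) : (∫ τ, f τ) / 2 ≤ ‖cft (fun τ => ((f τ : ℝ) : ℂ)) y‖ := by
  have hfi : Integrable fun τ => ((f τ : ℝ) : ℂ) :=
    (contDiff_ofReal_bump f).continuous.integrable_of_hasCompactSupport
      (hasCompactSupport_ofReal_bump f)
  have hint := integrable_mul_ch hfi (φ := fun τ => τ * y) (by fun_prop)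
  refine le_trans ?_ (Complex.re_le_norm _)
  have hre : (cft (fun τ => ((f τ : ℝ) : ℂ)) y).re =
      ∫ τ, (((f τ : ℝ) : ℂ) * ch (τ * y)).re :=
    (Complex.reCLM.integral_comp_comm hint).symm
  rw [hre, ← integral_div]
  refine integral_mono (f.integrable.div_const 2) (Complex.reCLM.integrable_comp hint) fun τ => ?_
  have e : (((f τ : ℝ) : ℂ) * ch (τ * y)).re = f τ * Real.cos (2 * Real.pi * (τ * y)) := by
    rw [ch_eq, Complex.re_ofReal_mul, Complex.exp_ofReal_mul_I_re]
  simp only [e]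
  by_cases h0 : f τ = 0
  · simp [h0]
  have h1 : |2 * Real.pi * (τ * y)| ≤ Real.pi / 3 := by
    rw [abs_mul, abs_mul τ, abs_of_pos (by positivity : (0 : ℝ) < 2 * Real.pi)]
    have : |τ| * |y| ≤ 1 / 3 * (1 / 2) := mul_le_mul (hf τ h0) hy (abs_nonneg _) (by norm_num)
    nlinarith [Real.pi_pos]
  have h2 : 1 / 2 ≤ Real.cos (2 * Real.pi * (τ * y)) := by
    rw [← Real.cos_abs, ← Real.cos_pi_div_three]
    exact Real.cos_le_cos_of_nonneg_of_le_pi (abs_nonneg _) (by linarith [Real.pi_pos]) h1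
  have h3 : 0 ≤ f τ := f.nonneg
  nlinarith

lemma enorm_cft_mul_extOp_le {a G : ℝ → ℂ} (ha : ContDiff ℝ ∞ a) (hc : HasCompactSupport a)
    (hG : Integrable G) (hG1 : Integrable fun ξ : ℝ => (ξ : ℂ) * G ξ) {R : ℝ} (hR : 1 ≤ R) {x : ℝ × ℝ}
    (hx : x.2 / R ∈ Icc (-(1 / 2) : ℝ) (1 / 2)) :
    ‖cft a (x.1 / R)‖ₑ * ‖extOp 0 1 G x‖ₑ ≤ ENNReal.ofReal (4 * Real.pi) *
      ∫⁻ u in Icc (-(1 / 2) : ℝ) (1 / 2), (‖twistExt a G R (Icc 0 1) u x‖ₑ +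
        (‖twistExt (fun τ : ℝ => (τ : ℂ) * a τ) (fun ξ : ℝ => (ξ : ℂ) * G ξ) R (Icc 0 1) u x‖ₑ +
          ‖twistExt (fun τ : ℝ => (τ : ℂ) ^ 2 * a τ) G R (Icc 0 1) u x‖ₑ)) := by
  have hR0 : 0 < R := by linarith
  have ha0 : Integrable a := ha.continuous.integrable_of_hasCompactSupport hc
  have hac := ha.continuous
  have ha1 : Integrable fun τ : ℝ => (τ : ℂ) * a τ :=
    (by fun_prop : Continuous fun τ : ℝ => (τ : ℂ) * a τ).integrable_of_hasCompactSupport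
      (HasCompactSupport.mul_left (f := fun τ : ℝ => (τ : ℂ)) hc)
  have ha2 : Integrable fun τ : ℝ => (τ : ℂ) ^ 2 * a τ :=
    (by fun_prop : Continuous fun τ : ℝ => (τ : ℂ) ^ 2 * a τ).integrable_of_hasCompactSupport
      (HasCompactSupport.mul_left (f := fun τ : ℝ => (τ : ℂ) ^ 2) hc)
  have hJ : MeasurableSet (Icc (0 : ℝ) 1) := measurableSet_Icc
  let φ : ℝ × ℝ → ℝ := fun z => z.2 * x.1 + z.2 ^ 2 * x.2 + z.1 * (x.1 / R)
  have hφ : Continuous φ := by fun_prop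
  let m : ℝ × ℝ → ℂ := fun z => (a z.1 * (Icc (0 : ℝ) 1).indicator G z.2) * ch (φ z)
  let m1 : ℝ × ℝ → ℂ := fun z => ((z.1 : ℂ) * a z.1 *
    (Icc (0 : ℝ) 1).indicator (fun ξ : ℝ => (ξ : ℂ) * G ξ) z.2) * ch (φ z)
  let m2 : ℝ × ℝ → ℂ := fun z => ((z.1 : ℂ) ^ 2 * a z.1 *
    (Icc (0 : ℝ) 1).indicator G z.2) * ch (φ z)
  have hm : Integrable m := integrable_twist_integrand ha0 (hG.indicator hJ) hφ
  have hm1 : Integrable m1 := integrable_twist_integrand ha1 (hG1.indicator hJ) hφ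
  have hm2 : Integrable m2 := integrable_twist_integrand ha2 (hG.indicator hJ) hφ
  have hlm : ∀ z : ℝ × ℝ, ((lam R z.1 z.2 : ℝ) : ℂ) * m z = 2 * m1 z + (R : ℂ)⁻¹ * m2 z := by
    intro z
    simp only [m, m1, m2, lam]
    by_cases hz : z.2 ∈ Icc (0 : ℝ) 1
    · simp only [indicator_of_mem hz]; push_cast; ring
    · simp only [indicator_of_notMem hz]; ring
  have hlmi : Integrable fun z : ℝ × ℝ => ((lam R z.1 z.2 : ℝ) : ℂ) * m z := by
    simp_rw [hlm]; exact (hm1.const_mul _).add (hm2.const_mul _)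
  have key := enorm_integral_le_lintegral_phase hm (continuous_lam R).measurable hlmi hx
  have hcomb : ∀ (f : ℝ × ℝ → ℂ) (u : ℝ) (z : ℝ × ℝ),
      f z * ch (φ z) * ch (lam R z.1 z.2 * (x.2 / R - u)) =
      f z * ch (z.2 * x.1 + z.2 ^ 2 * x.2 + z.1 * (x.1 / R) +
        lam R z.1 z.2 * (x.2 / R - u)) := by
    intro f u z
    rw [mul_assoc, ← ch_add]
  have e0 : ∫ z, m z = cft a (x.1 / R) * extOp 0 1 G x := by
    rw [← twistExt_diag, twistExt]
    congr 1; ext z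
    rw [sub_self, mul_zero, add_zero]
  have e1 : ∀ u, ∫ z, m z * ch (lam R z.1 z.2 * (x.2 / R - u)) =
      twistExt a G R (Icc 0 1) u x := by
    intro u
    exact integral_congr_ae (Eventually.of_forall fun z =>
      hcomb (fun z => a z.1 * (Icc (0 : ℝ) 1).indicator G z.2) u z)
  have hb : ∀ (u : ℝ) {f : ℝ × ℝ → ℂ}, Integrable f →
      Integrable fun z : ℝ × ℝ => f z * ch (lam R z.1 z.2 * (x.2 / R - u)) := by
    intro u f hf
    refine hf.mul_bdd (c := 1) ?_ (Eventually.of_forall fun _ => by simp)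
    exact (continuous_ch.comp ((continuous_lam R).mul continuous_const)).aestronglyMeasurable
  have e2 : ∀ u, ∫ z, ((lam R z.1 z.2 : ℝ) : ℂ) * m z * ch (lam R z.1 z.2 * (x.2 / R - u)) =
      2 * twistExt (fun τ : ℝ => (τ : ℂ) * a τ) (fun ξ : ℝ => (ξ : ℂ) * G ξ) R (Icc 0 1) u x +
      (R : ℂ)⁻¹ * twistExt (fun τ : ℝ => (τ : ℂ) ^ 2 * a τ) G R (Icc 0 1) u x := by
    intro u
    have f1 : ∫ z, m1 z * ch (lam R z.1 z.2 * (x.2 / R - u)) =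
        twistExt (fun τ : ℝ => (τ : ℂ) * a τ) (fun ξ : ℝ => (ξ : ℂ) * G ξ) R (Icc 0 1) u x :=
      integral_congr_ae (Eventually.of_forall fun z => hcomb (fun z => (z.1 : ℂ) * a z.1 *
        (Icc (0 : ℝ) 1).indicator (fun ξ : ℝ => (ξ : ℂ) * G ξ) z.2) u z)
    have f2 : ∫ z, m2 z * ch (lam R z.1 z.2 * (x.2 / R - u)) =
        twistExt (fun τ : ℝ => (τ : ℂ) ^ 2 * a τ) G R (Icc 0 1) u x :=
      integral_congr_ae (Eventually.of_forall fun z => hcomb (fun z => (z.1 : ℂ) ^ 2 * a z.1 *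
        (Icc (0 : ℝ) 1).indicator G z.2) u z)
    rw [← f1, ← f2, ← integral_const_mul, ← integral_const_mul,
      ← integral_add ((hb u hm1).const_mul _) ((hb u hm2).const_mul _)]
    congr 1; ext z
    rw [hlm]; ring
  rw [e0, enorm_mul] at key
  refine key.trans ?_
  rw [← lintegral_const_mul' _ _ ENNReal.ofReal_ne_top]
  refine lintegral_mono fun u => ?_
  simp only [e1, e2]
  have hpi := Real.pi_gt_three
  have g1 : ‖(2 : ℂ)‖ₑ = ENNReal.ofReal 2 := by rw [← ofReal_norm]; simp
  have g2 : ‖(R : ℂ)⁻¹‖ₑ ≤ ENNReal.ofReal 2 := by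
    rw [← ofReal_norm]
    refine ENNReal.ofReal_le_ofReal ?_
    rw [norm_inv, Complex.norm_real, Real.norm_of_nonneg hR0.le]
    exact (inv_le_one_of_one_le₀ hR).trans (by norm_num)
  rw [mul_add]
  refine add_le_add (le_mul_of_one_le_left' ?_) ?_
  · rw [ENNReal.one_le_ofReal]; linarith
  · have h4 : ENNReal.ofReal (4 * Real.pi) = ENNReal.ofReal (2 * Real.pi) * ENNReal.ofReal 2 := by
      rw [← ENNReal.ofReal_mul (by positivity)]; congr 1; ring
    rw [h4, mul_assoc, mul_add]
    refine mul_le_mul' le_rfl ((_root_.enorm_add_le (2 * _) (_ * _)).trans ?_)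
    rw [enorm_mul, enorm_mul, g1]
    exact add_le_add le_rfl (mul_le_mul' g2 le_rfl)

lemma add_rpow_le_mul {p : ℝ} (hp : 1 ≤ p) (hp6 : p ≤ 6) (a b : ℝ≥0∞) :
    (a + b) ^ p ≤ 32 * (a ^ p + b ^ p) := by
  refine (ENNReal.rpow_add_le_mul_rpow_add_rpow a b hp).trans (mul_le_mul' ?_ le_rfl)
  calc (2 : ℝ≥0∞) ^ (p - 1) ≤ 2 ^ ((5 : ℕ) : ℝ) :=
        ENNReal.rpow_le_rpow_of_exponent_le (by norm_num) (by push_cast; linarith)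
    _ = 32 := by rw [ENNReal.rpow_natCast]; norm_num

lemma add_three_rpow_le {p : ℝ} (hp : 1 ≤ p) (hp6 : p ≤ 6) (a b d : ℝ≥0∞) :
    (a + (b + d)) ^ p ≤ 1024 * (a ^ p + (b ^ p + d ^ p)) := by
  calc (a + (b + d)) ^ p ≤ 32 * (a ^ p + (b + d) ^ p) := add_rpow_le_mul hp hp6 _ _
    _ ≤ 32 * (32 * a ^ p + 32 * (b ^ p + d ^ p)) := by
        refine mul_le_mul' le_rfl (add_le_add ?_ (add_rpow_le_mul hp hp6 _ _))
        exact le_mul_of_one_le_left' (by norm_num)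
    _ = _ := by ring

lemma rpow_setLIntegral_unit_le {p : ℝ} (hp : 1 ≤ p) {f : ℝ → ℝ≥0∞} (hf : Measurable f) :
    (∫⁻ u in Icc (-(1 / 2) : ℝ) (1 / 2), f u) ^ p ≤
      ∫⁻ u in Icc (-(1 / 2) : ℝ) (1 / 2), f u ^ p := by
  have h := rpow_lintegral_mul_le (μ := volume.restrict (Icc (-(1 / 2) : ℝ) (1 / 2))) hp
    (k := fun _ => 1) aemeasurable_const hf.aemeasurable
  have hv : volume (Icc (-(1 / 2) : ℝ) (1 / 2)) = 1 := by
    rw [Real.volume_Icc]; norm_num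
  rw [setLIntegral_const, hv, mul_one, ENNReal.one_rpow, one_mul] at h
  simpa only [one_mul] using h

lemma lintegral_swap_add_three {α β : Type*} [MeasurableSpace α] [MeasurableSpace β]
    {μ : Measure α} {ν : Measure β} [SFinite μ] [SFinite ν] {f g h : α → β → ℝ≥0∞}
    (hf : Measurable fun z : α × β => f z.1 z.2) (hg : Measurable fun z : α × β => g z.1 z.2)
    (hh : Measurable fun z : α × β => h z.1 z.2) :
    ∫⁻ y, ∫⁻ x, (f x y + (g x y + h x y)) ∂μ ∂ν =
      (∫⁻ x, ∫⁻ y, f x y ∂ν ∂μ) + ((∫⁻ x, ∫⁻ y, g x y ∂ν ∂μ) + ∫⁻ x, ∫⁻ y, h x y ∂ν ∂μ) := by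
  rw [← lintegral_lintegral_swap (hf.add (hg.add hh)).aemeasurable]
  have n₀ : ∀ x, Measurable fun y => f x y := fun x => hf.comp measurable_prodMk_left
  have n₁ : ∀ x, Measurable fun y => g x y := fun x => hg.comp measurable_prodMk_left
  simp only [lintegral_add_left (n₀ _), lintegral_add_left (n₁ _)]
  have m₁ := hg.lintegral_prod_right' (ν := ν)
  rw [lintegral_add_left hf.lintegral_prod_right', lintegral_add_left m₁]

/-- An `L^p` bound for a function which is pointwise an average over a unit interval. -/
lemma setLIntegral_rpow_le_of_le_average {p : ℝ} (hp : 4 < p) (hp6 : p ≤ 6) {S : Set (ℝ × ℝ)}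
    (hS : MeasurableSet S) {F : ℝ × ℝ → ℝ≥0∞} {f g h : ℝ → ℝ × ℝ → ℝ≥0∞}
    (hf : Measurable (Function.uncurry f)) (hg : Measurable (Function.uncurry g))
    (hh : Measurable (Function.uncurry h)) {K : ℝ≥0∞} (hK : K ≠ ⊤)
    (hF : ∀ x ∈ S, F x ≤ K * ∫⁻ u in Icc (-(1 / 2) : ℝ) (1 / 2), (f u x + (g u x + h u x))) :
    (∫⁻ x in S, F x ^ p) ^ (2 / p) ≤ K ^ 2 * (1024 *
      ((∫⁻ u in Icc (-(1 / 2) : ℝ) (1 / 2), ∫⁻ x in S, f u x ^ p) ^ (2 / p) +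
        ((∫⁻ u in Icc (-(1 / 2) : ℝ) (1 / 2), ∫⁻ x in S, g u x ^ p) ^ (2 / p) +
          (∫⁻ u in Icc (-(1 / 2) : ℝ) (1 / 2), ∫⁻ x in S, h u x ^ p) ^ (2 / p)))) := by
  set I := Icc (-(1 / 2) : ℝ) (1 / 2)
  have hpt : ∀ x ∈ S, F x ^ p ≤
      K ^ p * (1024 * ∫⁻ u in I, (f u x ^ p + (g u x ^ p + h u x ^ p))) := by
    intro x hx
    refine (ENNReal.rpow_le_rpow (hF x hx) (by linarith)).trans ?_
    rw [ENNReal.mul_rpow_of_nonneg _ _ (by linarith)]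
    refine mul_le_mul' le_rfl ((rpow_setLIntegral_unit_le (by linarith) ?_).trans ?_)
    · exact hf.of_uncurry_right.add (hg.of_uncurry_right.add hh.of_uncurry_right)
    · rw [← lintegral_const_mul' _ _ (by norm_num)]
      exact lintegral_mono fun u => add_three_rpow_le (by linarith) hp6 _ _ _
  have hT : ∫⁻ x in S, F x ^ p ≤ K ^ p * (1024 * ((∫⁻ u in I, ∫⁻ x in S, f u x ^ p) +
        ((∫⁻ u in I, ∫⁻ x in S, g u x ^ p) + ∫⁻ u in I, ∫⁻ x in S, h u x ^ p))) := by
    refine (setLIntegral_mono' hS hpt).trans ?_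
    rw [lintegral_const_mul' _ _ (ENNReal.rpow_ne_top_of_nonneg (by linarith) hK),
      lintegral_const_mul' _ _ (by norm_num)]
    exact mul_le_mul' le_rfl (mul_le_mul' le_rfl (le_of_eq (lintegral_swap_add_three
      (hf.pow_const p) (hg.pow_const p) (hh.pow_const p))))
  have hp2 : 0 ≤ 2 / p := by positivity
  have hp2' : 2 / p ≤ 1 := by rw [div_le_one (by linarith)]; linarith
  refine (ENNReal.rpow_le_rpow hT hp2).trans ?_
  rw [rpow_mul_rpow_two_div (by linarith)]
  refine mul_le_mul' le_rfl ((mul_rpow_two_div_le (by linarith) (by norm_num) _).trans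
    (mul_le_mul' le_rfl ?_))
  exact (ENNReal.rpow_add_le_add_rpow _ _ hp2 hp2').trans
    (add_le_add le_rfl (ENNReal.rpow_add_le_add_rpow _ _ hp2 hp2'))

lemma mem_unit_of_mem_sqr {R : ℝ} (hR : 0 < R) {x : ℝ × ℝ} (hx : x ∈ sqr 0 R) :
    x.1 / R ∈ Icc (-(1 / 2) : ℝ) (1 / 2) ∧ x.2 / R ∈ Icc (-(1 / 2) : ℝ) (1 / 2) := by
  simp only [sqr, mem_prod, mem_Icc, Prod.fst_zero, Prod.snd_zero, zero_sub, zero_add] at hx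
  obtain ⟨⟨h1, h2⟩, h3, h4⟩ := hx
  refine ⟨⟨?_, ?_⟩, ?_, ?_⟩
  · rw [le_div_iff₀ hR]; linarith
  · rw [div_le_iff₀ hR]; linarith
  · rw [le_div_iff₀ hR]; linarith
  · rw [div_le_iff₀ hR]; linarith

lemma IsSeparated.mono {a a' G G' : ℝ → ℂ} {n : ℕ} (h : IsSeparated a G n)
    (ha : ∀ τ, a' τ ≠ 0 → a τ ≠ 0) (hG : ∀ ξ, G' ξ ≠ 0 → G ξ ≠ 0) : IsSeparated a' G' n :=
  fun τ ξ h1 h2 => h τ ξ (ha τ h1) (hG ξ h2)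

/-- Decoupling with the slab weight for functions supported away from the endpoints of the
intervals of length `1/n`. -/
lemma decoupling_separated {c : ℝ} (ψ : ContDiffBump c) (hψ : ∀ τ, ψ τ ≠ 0 → |τ| ≤ 1 / 3) :
    ∃ C : ℝ≥0, ∀ p : ℝ, 4 < p → p < 6 → ∀ n : ℕ, 0 < n → ∀ D : ℝ, 0 ≤ D → DecIneq p n D →
    ∀ G : ℝ → ℂ, Integrable G → (∀ ξ ∉ Icc (0 : ℝ) 1, G ξ = 0) →
    IsSeparated (fun τ => ((ψ τ : ℝ) : ℂ)) G n →
    sqNorm p (extOp 0 1 G) (esqr 0 ((n : ℝ) ^ 2)) ≤ C * ENNReal.ofReal (D ^ 2) *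
      ∑ k ∈ Finset.range n, sqNorm p (extPiece n k G) (slab 0 ((n : ℝ) ^ 2)) := by
  set a₀ : ℝ → ℂ := fun τ => ((ψ τ : ℝ) : ℂ) with ha₀
  set a₁ : ℝ → ℂ := fun τ : ℝ => (τ : ℂ) * a₀ τ with ha₁
  set a₂ : ℝ → ℂ := fun τ : ℝ => (τ : ℂ) ^ 2 * a₀ τ with ha₂
  have hid : ContDiff ℝ ∞ fun τ : ℝ => (τ : ℂ) := Complex.ofRealCLM.contDiff
  have s₀ : ContDiff ℝ ∞ a₀ := contDiff_ofReal_bump ψ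
  have c₀ : HasCompactSupport a₀ := hasCompactSupport_ofReal_bump ψ
  have s₁ : ContDiff ℝ ∞ a₁ := hid.mul s₀
  have c₁ : HasCompactSupport a₁ := HasCompactSupport.mul_left (f := fun τ : ℝ => (τ : ℂ)) c₀
  have s₂ : ContDiff ℝ ∞ a₂ := (hid.pow 2).mul s₀
  have c₂ : HasCompactSupport a₂ :=
    HasCompactSupport.mul_left (f := fun τ : ℝ => (τ : ℂ) ^ 2) c₀
  obtain ⟨C₀, h₀⟩ := decoupling_twist s₀ c₀
  obtain ⟨C₁, h₁⟩ := decoupling_twist s₁ c₁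
  obtain ⟨C₂, h₂⟩ := decoupling_twist s₂ c₂
  obtain ⟨M, hM⟩ := sqNorm_slab_multiplier_le (hid.mul contDiff_bump)
    (HasCompactSupport.mul_left (f := fun τ : ℝ => (τ : ℂ)) hasCompactSupport_bump)
  have hq0 : 0 < (∫ τ, ψ τ) / 2 := half_pos ψ.integral_pos
  set q := ENNReal.ofReal ((∫ τ, ψ τ) / 2) with hq
  have hqpos : q ≠ 0 := (ENNReal.ofReal_pos.2 hq0).ne'
  set K : ℝ≥0∞ := q⁻¹ * ENNReal.ofReal (4 * Real.pi) with hK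
  have hKtop : K ≠ ⊤ := ENNReal.mul_ne_top (ENNReal.inv_ne_top.2 hqpos) ENNReal.ofReal_ne_top
  refine ⟨K.toNNReal ^ 2 * (1024 * (C₀ + (C₁ * M + C₂))),
    fun p hp4 hp6 n hn D hD hdec G hG hG0 hsep => ?_⟩
  have hn1 : (1 : ℝ) ≤ n := by exact_mod_cast hn
  set R : ℝ := (n : ℝ) ^ 2 with hRdef
  have hR1 : 1 ≤ R := one_le_pow₀ hn1
  have hR : 0 < R := by linarith
  set I := Icc (-(1 / 2) : ℝ) (1 / 2)
  set G₁ : ℝ → ℂ := fun ξ : ℝ => (ξ : ℂ) * G ξ with hG₁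
  have hG₁eq : G₁ = fun ξ : ℝ => (fun η : ℝ => (η : ℂ) * bump η) (1 * (ξ - 0)) * G ξ := by
    ext ξ
    by_cases hξ : ξ ∈ Icc (0 : ℝ) 1
    · simp [hG₁, bump_eq_one hξ.1 hξ.2]
    · simp [hG₁, hG0 ξ hξ]
  have hG₁i : Integrable G₁ := by
    obtain ⟨B, hB⟩ := (HasCompactSupport.mul_left (f := fun τ : ℝ => (τ : ℂ))
      hasCompactSupport_bump).exists_bound_of_continuous (hid.mul contDiff_bump).continuous
    rw [hG₁eq]
    refine hG.bdd_mul (c := B) ?_ (Eventually.of_forall fun ξ => hB _)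
    exact ((hid.mul contDiff_bump).continuous.comp
      (by fun_prop : Continuous fun ξ : ℝ => 1 * (ξ - 0))).aestronglyMeasurable
  have i₀ : Integrable a₀ := s₀.continuous.integrable_of_hasCompactSupport c₀
  have i₁ : Integrable a₁ := s₁.continuous.integrable_of_hasCompactSupport c₁
  have i₂ : Integrable a₂ := s₂.continuous.integrable_of_hasCompactSupport c₂
  have hG₁ne : ∀ ξ, G₁ ξ ≠ 0 → G ξ ≠ 0 := fun ξ h => right_ne_zero_of_mul h
  have hJ : MeasurableSet (Icc (0 : ℝ) 1) := measurableSet_Icc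
  have hpt : ∀ x ∈ sqr 0 R, ‖extOp 0 1 G x‖ₑ ≤ K * ∫⁻ u in I,
      (‖twistExt a₀ G R (Icc 0 1) u x‖ₑ + (‖twistExt a₁ G₁ R (Icc 0 1) u x‖ₑ +
        ‖twistExt a₂ G R (Icc 0 1) u x‖ₑ)) := by
    intro x hx
    obtain ⟨hx1, hx2⟩ := mem_unit_of_mem_sqr hR hx
    have h := enorm_cft_mul_extOp_le s₀ c₀ hG hG₁i hR1 hx2
    have hlow : q ≤ ‖cft a₀ (x.1 / R)‖ₑ := by
      rw [← ofReal_norm]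
      exact ENNReal.ofReal_le_ofReal (le_norm_cft ψ hψ (abs_le.2 ⟨hx1.1, hx1.2⟩))
    rw [hK, mul_assoc, ← ENNReal.mul_le_iff_le_inv hqpos ENNReal.ofReal_ne_top]
    exact (mul_le_mul' hlow le_rfl).trans h
  have hmain := setLIntegral_rpow_le_of_le_average hp4 hp6.le (measurableSet_sqr 0 R)
    (f := fun u x => ‖twistExt a₀ G R (Icc 0 1) u x‖ₑ)
    (g := fun u x => ‖twistExt a₁ G₁ R (Icc 0 1) u x‖ₑ)
    (h := fun u x => ‖twistExt a₂ G R (Icc 0 1) u x‖ₑ)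
    (continuous_twistExt i₀ hG R hJ).enorm.measurable
    (continuous_twistExt i₁ hG₁i R hJ).enorm.measurable
    (continuous_twistExt i₂ hG R hJ).enorm.measurable hKtop hpt
  have e₀ := h₀ p hp4 hp6 n hn D hD hdec G hG hsep
  have e₁ := h₁ p hp4 hp6 n hn D hD hdec G₁ hG₁i
    (hsep.mono (fun τ h => right_ne_zero_of_mul h) hG₁ne)
  have e₂ := h₂ p hp4 hp6 n hn D hD hdec G hG
    (hsep.mono (fun τ h => right_ne_zero_of_mul h) fun _ h => h)
  set Q := ∑ k ∈ Finset.range n, sqNorm p (extPiece n k G) (slab 0 R) with hQ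
  have e₁' : ∑ k ∈ Finset.range n, sqNorm p (extPiece n k G₁) (slab 0 R) ≤ M * Q := by
    rw [hQ, Finset.mul_sum]
    refine Finset.sum_le_sum fun k _ => ?_
    rw [hG₁eq]
    exact hM p hp4 _ _ R 1 0 G hG.integrableOn hR (by simpa using hR1)
  rw [sqNorm_esqr]
  refine hmain.trans ?_
  have hKc : ((K.toNNReal : ℝ≥0) : ℝ≥0∞) = K := ENNReal.coe_toNNReal hKtop
  push_cast
  rw [hKc]
  calc _ ≤ K ^ 2 * (1024 * (C₀ * ENNReal.ofReal (D ^ 2) * Q +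
        (C₁ * ENNReal.ofReal (D ^ 2) * (M * Q) + C₂ * ENNReal.ofReal (D ^ 2) * Q))) :=
        mul_le_mul' le_rfl (mul_le_mul' le_rfl (add_le_add e₀
          (add_le_add (e₁.trans (mul_le_mul' le_rfl e₁')) e₂)))
    _ = _ := by ring

/-! ### Decoupling with the slab weight -/

/-- The union of the open intervals `(k/n, (k+1)/n)` for `k < n`. -/
def pieces (n : ℕ) : Set ℝ :=
  ⋃ k : ℕ, ⋃ _ : k < n, Ioo ((k : ℝ) / (n : ℝ)) (((k : ℝ) + 1) / (n : ℝ))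

/-- Multiplication of `g` on each interval `(k/n, (k+1)/n)` by a rescaled copy of `b`. -/
noncomputable def cut (b : ℝ → ℂ) (n : ℕ) (g : ℝ → ℂ) : ℝ → ℂ :=
  (pieces n).indicator fun ξ => b (Int.fract ((n : ℝ) * ξ)) * g ξ

lemma mem_pieces {n : ℕ} {ξ : ℝ} : ξ ∈ pieces n ↔
    ∃ k < n, ξ ∈ Ioo ((k : ℝ) / (n : ℝ)) (((k : ℝ) + 1) / (n : ℝ)) := by
  simp only [pieces, mem_iUnion, exists_prop]

lemma measurableSet_pieces (n : ℕ) : MeasurableSet (pieces n) :=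
  MeasurableSet.iUnion fun _ => MeasurableSet.iUnion fun _ => measurableSet_Ioo

lemma pieces_subset (n : ℕ) : pieces n ⊆ Icc 0 1 := by
  intro ξ hξ
  obtain ⟨k, hk, h⟩ := mem_pieces.1 hξ
  exact Icc_piece_subset hk (Ioo_subset_Icc_self h)

lemma fract_of_mem_Ioo {n k : ℕ} (hn : 0 < n) {ξ : ℝ}
    (h : ξ ∈ Ioo ((k : ℝ) / (n : ℝ)) (((k : ℝ) + 1) / (n : ℝ))) :
    Int.fract ((n : ℝ) * ξ) = n * (ξ - k / n) ∧ 0 < n * (ξ - (k : ℝ) / n) ∧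
      n * (ξ - (k : ℝ) / n) < 1 := by
  have hn0 : (0 : ℝ) < n := by exact_mod_cast hn
  have e : (n : ℝ) * (ξ - k / n) = n * ξ - k := by field_simp
  have h1 := (div_lt_iff₀ hn0).1 h.1
  have h2 := (lt_div_iff₀ hn0).1 h.2
  rw [e]
  refine ⟨?_, by linarith, by linarith⟩
  rw [Int.fract_eq_iff]
  exact ⟨by linarith, by linarith, k, by simp⟩

lemma cut_of_mem {b : ℝ → ℂ} {n k : ℕ} (hn : 0 < n) (hk : k < n) {g : ℝ → ℂ} {ξ : ℝ}
    (h : ξ ∈ Ioo ((k : ℝ) / (n : ℝ)) (((k : ℝ) + 1) / (n : ℝ))) :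
    cut b n g ξ = b (n * (ξ - k / n)) * g ξ := by
  rw [cut, indicator_of_mem (mem_pieces.2 ⟨k, hk, h⟩), (fract_of_mem_Ioo hn h).1]

lemma cut_eq_zero {b : ℝ → ℂ} {n : ℕ} {g : ℝ → ℂ} {ξ : ℝ} (h : ξ ∉ Icc (0 : ℝ) 1) :
    cut b n g ξ = 0 :=
  indicator_of_notMem (fun h' => h (pieces_subset n h')) _

lemma integrable_cut {b : ℝ → ℂ} (hb : Continuous b) (hc : HasCompactSupport b) (n : ℕ)
    {g : ℝ → ℂ} (hg : IntegrableOn g (Icc 0 1)) : Integrable (cut b n g) := by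
  obtain ⟨B, hB⟩ := hc.exists_bound_of_continuous hb
  rw [cut, integrable_indicator_iff (measurableSet_pieces n)]
  refine (hg.mono_set (pieces_subset n)).bdd_mul (c := B) ?_ (Eventually.of_forall fun ξ => hB _)
  exact (hb.measurable.comp
    ((measurable_const_mul (n : ℝ)).fract)).aestronglyMeasurable

lemma extPiece_cut {b : ℝ → ℂ} {n k : ℕ} (hn : 0 < n) (hk : k < n) (g : ℝ → ℂ) :
    extPiece n k (cut b n g) =
      extOp ((k : ℝ) / n) (((k : ℝ) + 1) / n) fun ξ => b (n * (ξ - k / n)) * g ξ := by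
  ext x
  rw [extPiece, extOp_eq, extOp_eq, integral_Icc_eq_integral_Ioo, integral_Icc_eq_integral_Ioo]
  refine setIntegral_congr_fun measurableSet_Ioo fun ξ hξ => ?_
  simp only [cut_of_mem hn hk hξ]

lemma ae_mem_pieces {n : ℕ} (hn : 0 < n) : ∀ᵐ ξ : ℝ, ξ ∈ Icc (0 : ℝ) 1 → ξ ∈ pieces n := by
  have hn0 : (0 : ℝ) < n := by exact_mod_cast hn
  have hN : ∀ᵐ ξ : ℝ, ξ ∉ range fun m : ℤ => (m : ℝ) / n :=
    (countable_range _).ae_notMem _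
  filter_upwards [hN] with ξ hξ h01
  have hne : ∀ m : ℕ, (n : ℝ) * ξ ≠ m := by
    intro m hm
    refine hξ ⟨m, ?_⟩
    simp only [Int.cast_natCast]
    rw [div_eq_iff hn0.ne', ← hm]; ring
  have hpos : 0 ≤ (n : ℝ) * ξ := mul_nonneg hn0.le h01.1
  have h1 := Nat.floor_le hpos
  have h2 := Nat.lt_floor_add_one ((n : ℝ) * ξ)
  have h3 : ((⌊(n : ℝ) * ξ⌋₊ : ℕ) : ℝ) < n * ξ := lt_of_le_of_ne h1 (hne _).symm
  have h4 : (n : ℝ) * ξ ≤ n := by nlinarith [h01.2]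
  refine mem_pieces.2 ⟨⌊(n : ℝ) * ξ⌋₊, ?_, ?_, ?_⟩
  · exact_mod_cast h3.trans_le h4
  · rw [div_lt_iff₀ hn0]; linarith
  · rw [lt_div_iff₀ hn0]; linarith

lemma extOp_eq_cut_add_cut {b₁ b₂ : ℝ → ℂ} (hb₁ : Continuous b₁) (hc₁ : HasCompactSupport b₁)
    (hb₂ : Continuous b₂) (hc₂ : HasCompactSupport b₂)
    (h : ∀ t, 0 ≤ t → t ≤ 1 → b₁ t + b₂ t = 1) {n : ℕ} (hn : 0 < n) {g : ℝ → ℂ}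
    (hg : IntegrableOn g (Icc 0 1)) :
    extOp 0 1 g = fun x => extOp 0 1 (cut b₁ n g) x + extOp 0 1 (cut b₂ n g) x := by
  ext x
  have i₁ := integrable_mul_ch (integrable_cut hb₁ hc₁ n hg).integrableOn.integrable
    (μ := volume.restrict (Icc 0 1)) (φ := fun ξ => ξ * x.1 + ξ ^ 2 * x.2) (by fun_prop)
  have i₂ := integrable_mul_ch (integrable_cut hb₂ hc₂ n hg).integrableOn.integrable
    (μ := volume.restrict (Icc 0 1)) (φ := fun ξ => ξ * x.1 + ξ ^ 2 * x.2) (by fun_prop)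
  rw [extOp_eq, extOp_eq, extOp_eq, ← integral_add i₁ i₂]
  refine setIntegral_congr_ae measurableSet_Icc ?_
  filter_upwards [ae_mem_pieces hn] with ξ hξ h01
  have hf := h (Int.fract ((n : ℝ) * ξ)) (Int.fract_nonneg _) (Int.fract_lt_one _).le
  simp only [cut, indicator_of_mem (hξ h01)]
  rw [← add_mul, ← add_mul, hf, one_mul]

lemma isSeparated_cut {a b : ℝ → ℂ} {n : ℕ} (hn : 0 < n) (g : ℝ → ℂ)
    (h : ∀ τ t, a τ ≠ 0 → b t ≠ 0 → 0 < t → t < 1 → ∀ s, 0 ≤ s → s ≤ 1 →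
      t + s * τ ∈ Ioo (0 : ℝ) 1) : IsSeparated a (cut b n g) n := by
  intro τ ξ ha hξ
  have hn1 : (1 : ℝ) ≤ n := by exact_mod_cast hn
  have hn0 : (0 : ℝ) < n := by linarith
  have hmem : ξ ∈ pieces n := by
    by_contra hh
    exact hξ (indicator_of_notMem hh _)
  obtain ⟨k, hk, hI⟩ := mem_pieces.1 hmem
  obtain ⟨-, h0, h1⟩ := fract_of_mem_Ioo hn hI
  rw [cut_of_mem hn hk hI] at hξ
  obtain ⟨h2, h3⟩ := h τ _ ha (left_ne_zero_of_mul hξ) h0 h1 (1 / n) (by positivity)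
    (by rw [div_le_one hn0]; exact hn1)
  refine ⟨k, hk, hI, ?_⟩
  have e : (n : ℝ) * (ξ - k / n) + 1 / n * τ = n * (ξ + τ / n ^ 2) - k := by field_simp; ring
  rw [e] at h2 h3
  constructor
  · rw [div_lt_iff₀ hn0]; linarith
  · rw [lt_div_iff₀ hn0]; linarith

lemma sqNorm_add_le {p : ℝ} (hp : 2 ≤ p) (hp6 : p ≤ 6) {f g : ℝ × ℝ → ℂ}
    {w : ℝ × ℝ → ℝ≥0∞} (hf : Measurable f) (hw : Measurable w) :
    sqNorm p (fun x => f x + g x) w ≤ 32 * (sqNorm p f w + sqNorm p g w) := by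
  have hp2' : 2 / p ≤ 1 := by rw [div_le_one (by linarith)]; linarith
  unfold sqNorm
  calc (∫⁻ x, ‖f x + g x‖ₑ ^ p * w x) ^ (2 / p)
      ≤ (32 * ((∫⁻ x, ‖f x‖ₑ ^ p * w x) + ∫⁻ x, ‖g x‖ₑ ^ p * w x)) ^ (2 / p) := by
        refine ENNReal.rpow_le_rpow ?_ (by positivity)
        rw [← lintegral_add_left (f := fun x => ‖f x‖ₑ ^ p * w x) ((hf.enorm.pow_const p).mul hw),
          ← lintegral_const_mul' _ _ (by norm_num)]
        refine lintegral_mono fun x => ?_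
        calc ‖f x + g x‖ₑ ^ p * w x ≤ 32 * (‖f x‖ₑ ^ p + ‖g x‖ₑ ^ p) * w x := by
              refine mul_le_mul' (le_trans ?_ (add_rpow_le_mul (by linarith) hp6 _ _)) le_rfl
              exact ENNReal.rpow_le_rpow (enorm_add_le _ _) (by linarith)
          _ = _ := by ring
    _ ≤ _ := (mul_rpow_two_div_le hp (by norm_num) _).trans
        (mul_le_mul' le_rfl (ENNReal.rpow_add_le_add_rpow _ _ (by positivity) hp2'))

lemma abs_sub_lt_rOut {c : ℝ} (f : ContDiffBump c) {τ : ℝ} (h : ((f τ : ℝ) : ℂ) ≠ 0) :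
    |τ - c| < f.rOut := by
  have : τ ∈ Function.support f := by simpa using h
  rw [f.support_eq] at this
  simpa [Real.dist_eq] using this

/-- Decoupling with the slab weight, centered at the origin. -/
lemma decoupling_slab_zero : ∃ C : ℝ≥0, ∀ p : ℝ, 4 < p → p < 6 → ∀ n : ℕ, 0 < n → ∀ D : ℝ, 0 ≤ D →
    DecIneq p n D → ∀ g : ℝ → ℂ, IntegrableOn g (Icc 0 1) →
    sqNorm p (extOp 0 1 g) (esqr 0 ((n : ℝ) ^ 2)) ≤ C * ENNReal.ofReal (D ^ 2) *
      ∑ k ∈ Finset.range n, sqNorm p (extPiece n k g) (slab 0 ((n : ℝ) ^ 2)) := by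
  let ψ₁ : ContDiffBump (1 / 6 : ℝ) := ⟨1 / 12, 1 / 6, by norm_num, by norm_num⟩
  let ψ₂ : ContDiffBump (-(1 / 6) : ℝ) := ⟨1 / 12, 1 / 6, by norm_num, by norm_num⟩
  let β : ContDiffBump (0 : ℝ) := ⟨1 / 3, 2 / 3, by norm_num, by norm_num⟩
  let b₁ : ℝ → ℂ := fun t => ((β t : ℝ) : ℂ)
  let b₂ : ℝ → ℂ := fun t => bump t - b₁ t
  have s₁ : ContDiff ℝ ∞ b₁ := contDiff_ofReal_bump β
  have c₁ : HasCompactSupport b₁ := hasCompactSupport_ofReal_bump β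
  have s₂ : ContDiff ℝ ∞ b₂ := contDiff_bump.sub s₁
  have c₂ : HasCompactSupport b₂ := hasCompactSupport_bump.sub c₁
  have hψ₁ : ∀ τ, ((ψ₁ τ : ℝ) : ℂ) ≠ 0 → 0 < τ ∧ τ < 1 / 3 := fun τ h => by
    have := abs_lt.1 (abs_sub_lt_rOut ψ₁ h)
    change -(1 / 6) < τ - 1 / 6 ∧ τ - 1 / 6 < 1 / 6 at this
    constructor <;> linarith [this.1, this.2]
  have hψ₂ : ∀ τ, ((ψ₂ τ : ℝ) : ℂ) ≠ 0 → -(1 / 3) < τ ∧ τ < 0 := fun τ h => by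
    have := abs_lt.1 (abs_sub_lt_rOut ψ₂ h)
    change -(1 / 6) < τ - -(1 / 6) ∧ τ - -(1 / 6) < 1 / 6 at this
    constructor <;> linarith [this.1, this.2]
  have hb₁ : ∀ t, b₁ t ≠ 0 → t < 2 / 3 := fun t h => by
    have := abs_lt.1 (abs_sub_lt_rOut β h)
    change -(2 / 3) < t - 0 ∧ t - 0 < 2 / 3 at this
    linarith [this.2]
  have hb₂ : ∀ t, b₂ t ≠ 0 → 0 < t → t < 1 → 1 / 3 < t := fun t h h0 h1 => by
    by_contra hh
    refine h ?_
    have : β t = 1 := β.one_of_mem_closedBall (by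
      rw [mem_closedBall_zero_iff, Real.norm_of_nonneg h0.le]; exact not_lt.1 hh)
    simp [b₂, b₁, bump_eq_one h0.le h1.le, this]
  obtain ⟨C₁, h₁⟩ := decoupling_separated ψ₁ fun τ h => by
    have := hψ₁ τ (by exact_mod_cast h)
    exact abs_le.2 ⟨by linarith, by linarith⟩
  obtain ⟨C₂, h₂⟩ := decoupling_separated ψ₂ fun τ h => by
    have := hψ₂ τ (by exact_mod_cast h)
    exact abs_le.2 ⟨by linarith, by linarith⟩
  obtain ⟨M₁, hM₁⟩ := sqNorm_slab_multiplier_le s₁ c₁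
  obtain ⟨M₂, hM₂⟩ := sqNorm_slab_multiplier_le s₂ c₂
  refine ⟨32 * (C₁ * M₁ + C₂ * M₂), fun p hp4 hp6 n hn D hD hdec g hg => ?_⟩
  have hn1 : (1 : ℝ) ≤ n := by exact_mod_cast hn
  have hR : (0 : ℝ) < (n : ℝ) ^ 2 := by positivity
  have hnR : |(n : ℝ)| ≤ (n : ℝ) ^ 2 := by
    rw [abs_of_nonneg (by linarith)]; nlinarith
  set Q := ∑ k ∈ Finset.range n, sqNorm p (extPiece n k g) (slab 0 ((n : ℝ) ^ 2)) with hQ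
  have i₁ := integrable_cut s₁.continuous c₁ n hg
  have i₂ := integrable_cut s₂.continuous c₂ n hg
  have q : ∀ {b : ℝ → ℂ} {M : ℝ≥0}, (∀ p : ℝ, 4 < p → ∀ (s t R l ξ₀ : ℝ) (G : ℝ → ℂ),
      IntegrableOn G (Icc s t) → 0 < R → |l| ≤ R →
      sqNorm p (extOp s t fun ξ => b (l * (ξ - ξ₀)) * G ξ) (slab 0 R) ≤
        M * sqNorm p (extOp s t G) (slab 0 R)) →
      ∑ k ∈ Finset.range n, sqNorm p (extPiece n k (cut b n g)) (slab 0 ((n : ℝ) ^ 2)) ≤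
        M * Q := by
    intro b M hM
    rw [hQ, Finset.mul_sum]
    refine Finset.sum_le_sum fun k hk => ?_
    have hk' := Finset.mem_range.1 hk
    rw [extPiece_cut hn hk']
    exact hM p hp4 _ _ _ n _ g (hg.mono_set (Icc_piece_subset hk')) hR hnR
  have e₁ := h₁ p hp4 hp6 n hn D hD hdec (cut b₁ n g) i₁ (fun ξ h => cut_eq_zero h)
    (isSeparated_cut hn g fun τ t hτ ht h0 h1 s hs0 hs1 => by
      have a1 := hψ₁ τ hτ
      have a2 := hb₁ t ht
      constructor <;> nlinarith)
  have e₂ := h₂ p hp4 hp6 n hn D hD hdec (cut b₂ n g) i₂ (fun ξ h => cut_eq_zero h)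
    (isSeparated_cut hn g fun τ t hτ ht h0 h1 s hs0 hs1 => by
      have a1 := hψ₂ τ hτ
      have a2 := hb₂ t ht h0 h1
      constructor <;> nlinarith)
  rw [extOp_eq_cut_add_cut s₁.continuous c₁ s₂.continuous c₂ (fun t h0 h1 => by
    simp [b₂, bump_eq_one h0 h1]) hn hg]
  refine (sqNorm_add_le (by linarith) hp6.le (continuous_extOp i₁.integrableOn).measurable
    (measurable_esqr _ _)).trans ?_
  push_cast
  calc _ ≤ 32 * (C₁ * ENNReal.ofReal (D ^ 2) * (M₁ * Q) + C₂ * ENNReal.ofReal (D ^ 2) * (M₂ * Q)) :=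
        mul_le_mul' le_rfl (add_le_add (e₁.trans (mul_le_mul' le_rfl (q hM₁)))
          (e₂.trans (mul_le_mul' le_rfl (q hM₂))))
    _ = _ := by ring

/-! ### Translations -/

lemma extOp_modulate (s t : ℝ) (g : ℝ → ℂ) (c x : ℝ × ℝ) :
    extOp s t (fun ξ => g ξ * ch (ξ * c.1 + ξ ^ 2 * c.2)) x = extOp s t g (x + c) := by
  rw [extOp_eq, extOp_eq]
  congr 1; ext ξ
  rw [mul_assoc, ← ch_add]
  congr 2
  simp only [Prod.fst_add, Prod.snd_add]; ring

lemma sqNorm_translate (p : ℝ) (f : ℝ × ℝ → ℂ) (w : ℝ × ℝ → ℝ≥0∞) (c : ℝ × ℝ) :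
    sqNorm p (fun x => f (x + c)) (fun x => w (x + c)) = sqNorm p f w := by
  rw [sqNorm, sqNorm, lintegral_add_right_eq_self (fun x => ‖f x‖ₑ ^ p * w x) c]

lemma esqr_translate (c : ℝ × ℝ) (R : ℝ) : (fun x => esqr c R (x + c)) = esqr 0 R := by
  ext x
  have : x + c ∈ sqr c R ↔ x ∈ sqr 0 R := by
    simp only [sqr, mem_prod, mem_Icc, Prod.fst_add, Prod.snd_add, Prod.fst_zero, Prod.snd_zero]
    constructor <;> rintro ⟨⟨h1, h2⟩, h3, h4⟩ <;>
      refine ⟨⟨?_, ?_⟩, ?_, ?_⟩ <;> linarith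
  by_cases h : x ∈ sqr 0 R <;> simp [esqr, this, h]

lemma slab_translate (c : ℝ × ℝ) (R : ℝ) : (fun x => slab c R (x + c)) = slab 0 R := by
  ext x; simp [slab]

/-- Decoupling on a square with the slab weight. -/
lemma decoupling_slab : ∃ C : ℝ≥0, ∀ p : ℝ, 4 < p → p < 6 → ∀ n : ℕ, 0 < n → ∀ D : ℝ, 0 ≤ D →
    DecIneq p n D → ∀ g : ℝ → ℂ, IntegrableOn g (Icc 0 1) → ∀ c : ℝ × ℝ,
    sqNorm p (extOp 0 1 g) (esqr c ((n : ℝ) ^ 2)) ≤ C * ENNReal.ofReal (D ^ 2) *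
      ∑ k ∈ Finset.range n, sqNorm p (extPiece n k g) (slab c ((n : ℝ) ^ 2)) := by
  obtain ⟨C, hC⟩ := decoupling_slab_zero
  refine ⟨C, fun p hp4 hp6 n hn D hD hdec g hg c => ?_⟩
  have h := hC p hp4 hp6 n hn D hD hdec (fun ξ => g ξ * ch (ξ * c.1 + ξ ^ 2 * c.2))
    (integrable_mul_ch hg (φ := fun ξ => ξ * c.1 + ξ ^ 2 * c.2) (by fun_prop))
  have e : ∀ s t, extOp s t (fun ξ => g ξ * ch (ξ * c.1 + ξ ^ 2 * c.2)) =
      fun x => extOp s t g (x + c) := fun s t => funext fun x => extOp_modulate s t g c x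
  simp only [extPiece, e, ← esqr_translate c, ← slab_translate c, sqNorm_translate] at h
  exact h

/-! ### Averaging over squares -/

/-- The weight `W` varies slowly at scale `r`. -/
def SlowlyVarying (r : ℝ) (W : ℝ × ℝ → ℝ≥0∞) : Prop :=
  ∀ x y : ℝ × ℝ, W x ≤
    ENNReal.ofReal ((1 + (|x.1 - y.1| + 3 * |x.2 - y.2|) / r) ^ 100) * W y

lemma mem_sqr_iff {r : ℝ} {c x : ℝ × ℝ} :
    x ∈ sqr c r ↔ |x.1 - c.1| ≤ r / 2 ∧ |x.2 - c.2| ≤ r / 2 := by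
  simp only [sqr, mem_prod, mem_Icc, abs_le]
  constructor
  · rintro ⟨⟨h1, h2⟩, h3, h4⟩
    exact ⟨⟨by linarith, by linarith⟩, by linarith, by linarith⟩
  · rintro ⟨⟨h1, h2⟩, h3, h4⟩
    exact ⟨⟨by linarith, by linarith⟩, by linarith, by linarith⟩

lemma mem_sqr_comm {r : ℝ} {c x : ℝ × ℝ} : x ∈ sqr c r ↔ c ∈ sqr x r := by
  rw [mem_sqr_iff, mem_sqr_iff, abs_sub_comm, abs_sub_comm x.2]

lemma esqr_comm (r : ℝ) (c x : ℝ × ℝ) : esqr c r x = esqr x r c := by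
  unfold esqr
  by_cases h : x ∈ sqr c r
  · rw [indicator_of_mem h, indicator_of_mem (mem_sqr_comm.1 h)]; rfl
  · rw [indicator_of_notMem h, indicator_of_notMem fun h' => h (mem_sqr_comm.2 h')]

lemma volume_sqr (c : ℝ × ℝ) {r : ℝ} (hr : 0 ≤ r) : volume (sqr c r) = ENNReal.ofReal (r ^ 2) := by
  rw [sqr, Measure.volume_eq_prod, Measure.prod_prod, Real.volume_Icc, Real.volume_Icc,
    ← ENNReal.ofReal_mul (by linarith)]
  congr 1; ring

lemma measurable_esqr_uncurry (r : ℝ) :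
    Measurable fun z : (ℝ × ℝ) × (ℝ × ℝ) => esqr z.1 r z.2 := by
  have hS : MeasurableSet {z : (ℝ × ℝ) × (ℝ × ℝ) | |z.2.1 - z.1.1| ≤ r / 2 ∧
      |z.2.2 - z.1.2| ≤ r / 2} := by
    refine IsClosed.measurableSet (IsClosed.and ?_ ?_)
    · exact isClosed_le (by fun_prop) continuous_const
    · exact isClosed_le (by fun_prop) continuous_const
  have : (fun z : (ℝ × ℝ) × (ℝ × ℝ) => esqr z.1 r z.2) =
      {z : (ℝ × ℝ) × (ℝ × ℝ) | |z.2.1 - z.1.1| ≤ r / 2 ∧ |z.2.2 - z.1.2| ≤ r / 2}.indicator 1 := by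
    ext z
    by_cases h : z.2 ∈ sqr z.1 r
    · rw [esqr, indicator_of_mem h, indicator_of_mem (by exact mem_sqr_iff.1 h)]; rfl
    · have h' : z ∉ {z : (ℝ × ℝ) × (ℝ × ℝ) | |z.2.1 - z.1.1| ≤ r / 2 ∧ |z.2.2 - z.1.2| ≤ r / 2} :=
        fun h' => h (mem_sqr_iff.2 h')
      rw [esqr, indicator_of_notMem h, indicator_of_notMem h']
  rw [this]
  exact measurable_one.indicator hS

lemma measurable_slab_uncurry (r : ℝ) :
    Measurable fun z : (ℝ × ℝ) × (ℝ × ℝ) => slab z.1 r z.2 := by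
  have h := (measurable_slab_zero r).comp
    (by fun_prop : Measurable fun z : (ℝ × ℝ) × (ℝ × ℝ) => z.2 - z.1)
  have e : (fun z : (ℝ × ℝ) × (ℝ × ℝ) => slab z.1 r z.2) =
      slab 0 r ∘ fun z : (ℝ × ℝ) × (ℝ × ℝ) => z.2 - z.1 := by
    ext z; simp [slab]
  rw [e]; exact h

lemma SlowlyVarying.le_lintegral {r : ℝ} (hr : 0 < r) {W : ℝ × ℝ → ℝ≥0∞}
    (hW : SlowlyVarying r W) (x : ℝ × ℝ) :
    ENNReal.ofReal (r ^ 2) * W x ≤ 3 ^ 100 * ∫⁻ c, W c * esqr c r x := by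
  have h : ∫⁻ c, W c * esqr c r x = ∫⁻ c in sqr x r, W c := by
    rw [← lintegral_indicator (measurableSet_sqr x r)]
    congr 1; ext c
    rw [esqr_comm]
    by_cases hc : c ∈ sqr x r <;> simp [esqr, hc]
  rw [h, ← volume_sqr x hr.le, mul_comm, ← setLIntegral_const,
    ← lintegral_const_mul' _ _ (by finiteness)]
  refine setLIntegral_mono' (measurableSet_sqr x r) fun c hc => ?_
  refine (hW x c).trans (mul_le_mul' ?_ le_rfl)
  obtain ⟨h1, h2⟩ := mem_sqr_iff.1 hc
  rw [abs_sub_comm] at h1 h2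
  rw [show (3 ^ 100 : ℝ≥0∞) = ENNReal.ofReal (3 ^ 100) by
    rw [ENNReal.ofReal_pow (by norm_num)]; norm_num]
  refine ENNReal.ofReal_le_ofReal (pow_le_pow_left₀ (by positivity) ?_ _)
  have : (|x.1 - c.1| + 3 * |x.2 - c.2|) / r ≤ 2 := by
    rw [div_le_iff₀ hr]; linarith
  linarith

lemma SlowlyVarying.lintegral_mul_slab_le {r : ℝ} (hr : 0 < r) {W : ℝ × ℝ → ℝ≥0∞}
    (hW : SlowlyVarying r W) (y : ℝ × ℝ) :
    ∫⁻ c, W c * slab c r y ≤ ENNReal.ofReal (r ^ 2) * ((4 * 3 ^ 100) * W y) := by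
  set f : ℝ → ℝ≥0∞ := fun t => ENNReal.ofReal (3 ^ 100 * (1 + ((t - y.1) / r) ^ 2)⁻¹) with hf
  set g : ℝ → ℝ≥0∞ := (Icc (y.2 - r / 2) (y.2 + r / 2)).indicator 1 with hg
  have hpt : ∀ c, W c * slab c r y ≤ W y * (f c.1 * g c.2) := by
    intro c
    by_cases hc : (y.2 - c.2) / r ∈ Icc (-(1 / 2) : ℝ) (1 / 2)
    swap
    · rw [slab, indicator_of_notMem hc, zero_mul, mul_zero]; exact bot_le
    have hc2 : c.2 ∈ Icc (y.2 - r / 2) (y.2 + r / 2) := by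
      have h1 := (le_div_iff₀ hr).1 hc.1
      have h2 := (div_le_iff₀ hr).1 hc.2
      constructor <;> linarith
    rw [slab, indicator_of_mem hc, hg, indicator_of_mem hc2, Pi.one_apply, Pi.one_apply, one_mul,
      mul_one, mul_comm (W y)]
    refine (mul_le_mul' (hW c y) le_rfl).trans ?_
    rw [mul_right_comm, ← ENNReal.ofReal_mul (by positivity)]
    refine mul_le_mul' (ENNReal.ofReal_le_ofReal ?_) le_rfl
    set a := |c.1 - y.1| / r with ha
    have ha0 : 0 ≤ a := by positivity
    have h1 : (|c.1 - y.1| + 3 * |c.2 - y.2|) / r ≤ a + 3 / 2 := by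
      have : |c.2 - y.2| ≤ r / 2 := abs_le.2 ⟨by linarith [hc2.1], by linarith [hc2.2]⟩
      rw [add_div, ← ha]
      have : 3 * |c.2 - y.2| / r ≤ 3 / 2 := by rw [div_le_iff₀ hr]; linarith
      linarith
    have h2 : (1 + (|c.1 - y.1| + 3 * |c.2 - y.2|) / r) ^ 100 ≤ 3 ^ 100 * (1 + a) ^ 100 := by
      rw [← mul_pow]
      exact pow_le_pow_left₀ (by positivity) (by linarith) _
    have h3 : jb 102 ((y.1 - c.1) / r) = ((1 + a) ^ 102)⁻¹ := by
      rw [jb, abs_div, abs_of_pos hr, abs_sub_comm]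
    have h4 : 1 + ((c.1 - y.1) / r) ^ 2 ≤ (1 + a) ^ 2 := by
      have : ((c.1 - y.1) / r) ^ 2 = a ^ 2 := by rw [ha, div_pow, div_pow, sq_abs]
      rw [this]; nlinarith
    rw [h3]
    calc _ ≤ 3 ^ 100 * (1 + a) ^ 100 * ((1 + a) ^ 102)⁻¹ := by gcongr
      _ = 3 ^ 100 * ((1 + a) ^ 2)⁻¹ := by field_simp
      _ ≤ _ := by gcongr
  have hfm : Measurable f := by fun_prop
  have hgm : Measurable g := measurable_one.indicator measurableSet_Icc
  have hgi : ∫⁻ t, g t = ENNReal.ofReal r := by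
    rw [hg, lintegral_indicator_one measurableSet_Icc, Real.volume_Icc]
    congr 1; ring
  have hfi : ∫⁻ t, f t ≤ ENNReal.ofReal (4 * 3 ^ 100 * r) := by
    have hi : Integrable fun t : ℝ => 3 ^ 100 * (1 + ((t - y.1) / r) ^ 2)⁻¹ :=
      (((integrable_inv_one_add_sq.comp_div hr.ne').comp_sub_right y.1).const_mul _)
    rw [hf, ← ofReal_integral_eq_lintegral_ofReal hi (Eventually.of_forall fun t => by positivity),
      integral_const_mul, integral_sub_right_eq_self (fun t : ℝ => (1 + (t / r) ^ 2)⁻¹) y.1,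
      Measure.integral_comp_div (fun y : ℝ => (1 + y ^ 2)⁻¹), integral_univ_inv_one_add_sq,
      smul_eq_mul, abs_of_pos hr]
    refine ENNReal.ofReal_le_ofReal ?_
    nlinarith [Real.pi_le_four, mul_le_mul_of_nonneg_left Real.pi_le_four hr.le]
  refine (lintegral_mono hpt).trans ?_
  rw [lintegral_const_mul (f := fun c : ℝ × ℝ => f c.1 * g c.2) _
      ((hfm.comp measurable_fst).mul (hgm.comp measurable_snd)),
    Measure.volume_eq_prod, lintegral_prod_mul hfm.aemeasurable hgm.aemeasurable, hgi]
  calc _ ≤ W y * (ENNReal.ofReal (4 * 3 ^ 100 * r) * ENNReal.ofReal r) :=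
        mul_le_mul' le_rfl (mul_le_mul' hfi le_rfl)
    _ = _ := by
        rw [← ENNReal.ofReal_mul (by positivity), show 4 * 3 ^ 100 * r * r = 4 * 3 ^ 100 * r ^ 2 by
          ring, ENNReal.ofReal_mul (by positivity), ENNReal.ofReal_mul (by norm_num),
          ENNReal.ofReal_pow (by norm_num)]
        norm_num
        ring

/-- Local inequalities on all squares of side length `r` imply weighted inequalities for weights
varying slowly at scale `r`. -/
lemma sqNorm_le_of_local {ι : Type*} {p : ℝ} (hp : 2 ≤ p) (s : Finset ι) {f : ℝ × ℝ → ℂ}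
    {F : ι → ℝ × ℝ → ℂ} (hf : Measurable f) (hF : ∀ k, Measurable (F k)) {r : ℝ} (hr : 0 < r)
    {K : ℝ≥0∞} (hloc : ∀ c, sqNorm p f (esqr c r) ≤ K * ∑ k ∈ s, sqNorm p (F k) (slab c r))
    {W : ℝ × ℝ → ℝ≥0∞} (hWm : Measurable W) (hW : SlowlyVarying r W) :
    sqNorm p f W ≤ (3 ^ 100 * (4 * 3 ^ 100)) * K * ∑ k ∈ s, sqNorm p (F k) W := by
  have hp0 : 0 < p := by linarith
  have hfp : Measurable fun x => ‖f x‖ₑ ^ p := hf.enorm.pow_const p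
  have hFp : ∀ k, Measurable fun x => ‖F k x‖ₑ ^ p := fun k => (hF k).enorm.pow_const p
  have hgen : ∀ {A : ℝ × ℝ → ℝ≥0∞} {w : ℝ × ℝ → ℝ × ℝ → ℝ≥0∞}, Measurable A →
      Measurable (fun z : (ℝ × ℝ) × (ℝ × ℝ) => w z.1 z.2) →
      Measurable (fun c => W c * ∫⁻ x, A x * w c x) ∧
      ∫⁻ c, W c * ∫⁻ x, A x * w c x = ∫⁻ x, A x * ∫⁻ c, W c * w c x := by
    intro A w hA hw
    have hAw : Measurable fun z : (ℝ × ℝ) × (ℝ × ℝ) => A z.2 * w z.1 z.2 :=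
      (hA.comp measurable_snd).mul hw
    refine ⟨hWm.mul hAw.lintegral_prod_right', ?_⟩
    have h1 : ∀ c, W c * ∫⁻ x, A x * w c x = ∫⁻ x, W c * (A x * w c x) := fun c =>
      (lintegral_const_mul _ (hAw.comp measurable_prodMk_left)).symm
    simp_rw [h1]
    rw [lintegral_lintegral_swap ((hWm.comp measurable_fst).mul hAw).aemeasurable]
    refine lintegral_congr fun x => ?_
    rw [← lintegral_const_mul (f := fun c => W c * w c x) _
      (hWm.mul (hw.comp measurable_prodMk_right))]
    refine lintegral_congr fun c => ?_
    ring
  have h := lintegral_rpow_le_sum (μ := volume) hp s K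
    (X := fun c => W c * ∫⁻ x, ‖f x‖ₑ ^ p * esqr c r x)
    (Y := fun k c => W c * ∫⁻ x, ‖F k x‖ₑ ^ p * slab c r x)
    (fun k => (hgen (w := fun c x => slab c r x) (hFp k)
      (measurable_slab_uncurry r)).1.aemeasurable) (fun c => by
      simp_rw [ENNReal.mul_rpow_of_nonneg _ _ (by positivity : 0 ≤ 2 / p)]
      rw [← Finset.mul_sum, mul_left_comm]
      exact mul_le_mul' le_rfl (hloc c))
  simp_rw [(hgen (w := fun c x => esqr c r x) hfp (measurable_esqr_uncurry r)).2,
    fun k => (hgen (w := fun c x => slab c r x) (hFp k)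
      (measurable_slab_uncurry r)).2] at h
  set ρ := ENNReal.ofReal (r ^ 2) with hρ
  have hρ0 : ρ ≠ 0 := (ENNReal.ofReal_pos.2 (by positivity)).ne'
  have hρt : ρ ≠ ⊤ := ENNReal.ofReal_ne_top
  have hl : ρ ^ (2 / p) * sqNorm p f W ≤
      3 ^ 100 * (∫⁻ x, ‖f x‖ₑ ^ p * ∫⁻ c, W c * esqr c r x) ^ (2 / p) := by
    refine le_trans ?_ (mul_rpow_two_div_le hp (one_le_pow₀ (by norm_num)) _)
    rw [sqNorm, ← ENNReal.mul_rpow_of_nonneg _ _ (by positivity)]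
    refine ENNReal.rpow_le_rpow ?_ (by positivity)
    rw [← lintegral_const_mul' _ _ hρt, ← lintegral_const_mul' _ _ (by finiteness)]
    refine lintegral_mono fun x => ?_
    rw [mul_left_comm, mul_left_comm (3 ^ 100)]
    exact mul_le_mul' le_rfl (hW.le_lintegral hr x)
  have hr' : ∀ k, (∫⁻ x, ‖F k x‖ₑ ^ p * ∫⁻ c, W c * slab c r x) ^ (2 / p) ≤
      ρ ^ (2 / p) * ((4 * 3 ^ 100) * sqNorm p (F k) W) := by
    intro k
    have h4 : (1 : ℝ≥0∞) ≤ 4 * 3 ^ 100 := one_le_mul (by norm_num) (one_le_pow₀ (by norm_num))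
    refine le_trans ?_ (mul_le_mul' le_rfl (mul_rpow_two_div_le hp h4 _))
    rw [← ENNReal.mul_rpow_of_nonneg _ _ (by positivity)]
    refine ENNReal.rpow_le_rpow ?_ (by positivity)
    rw [← lintegral_const_mul' _ _ (by finiteness), ← lintegral_const_mul' _ _ hρt]
    refine lintegral_mono fun x => ?_
    refine (mul_le_mul' le_rfl (hW.lintegral_mul_slab_le hr x)).trans_eq ?_
    ring
  have hρp0 : ρ ^ (2 / p) ≠ 0 := by simp [hρ0, hρt]
  have hρpt : ρ ^ (2 / p) ≠ ⊤ := ENNReal.rpow_ne_top_of_nonneg (by positivity) hρt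
  rw [← ENNReal.mul_le_mul_iff_right hρp0 hρpt]
  refine hl.trans ?_
  calc _ ≤ 3 ^ 100 * (K * ∑ k ∈ s, ρ ^ (2 / p) * ((4 * 3 ^ 100) * sqNorm p (F k) W)) :=
        mul_le_mul' le_rfl (h.trans (mul_le_mul' le_rfl (Finset.sum_le_sum fun k _ => hr' k)))
    _ = _ := by
        rw [← Finset.mul_sum, ← Finset.mul_sum]; ring

/-! ### Parabolic rescaling -/

lemma sqrt_add_sq_le (u₁ u₂ v₁ v₂ : ℝ) :
    √((u₁ + v₁) ^ 2 + (u₂ + v₂) ^ 2) ≤ √(u₁ ^ 2 + u₂ ^ 2) + (|v₁| + |v₂|) := by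
  have hs := Real.sqrt_nonneg (u₁ ^ 2 + u₂ ^ 2)
  have hsq := Real.sq_sqrt (by positivity : 0 ≤ u₁ ^ 2 + u₂ ^ 2)
  have h1 : |u₁| ≤ √(u₁ ^ 2 + u₂ ^ 2) := Real.abs_le_sqrt (by nlinarith)
  have h2 : |u₂| ≤ √(u₁ ^ 2 + u₂ ^ 2) := Real.abs_le_sqrt (by nlinarith)
  refine Real.sqrt_le_iff.2 ⟨by positivity, ?_⟩
  have h3 : u₁ * v₁ ≤ √(u₁ ^ 2 + u₂ ^ 2) * |v₁| :=
    (le_abs_self _).trans (by rw [abs_mul]; gcongr)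
  have h4 : u₂ * v₂ ≤ √(u₁ ^ 2 + u₂ ^ 2) * |v₂| :=
    (le_abs_self _).trans (by rw [abs_mul]; gcongr)
  have h5 : 0 ≤ |v₁| * |v₂| := by positivity
  nlinarith [sq_abs v₁, sq_abs v₂]

lemma wB_le_mul_wB (c : ℝ × ℝ) {R ρ : ℝ} (hR : 0 < R) {z z' : ℝ × ℝ}
    (h : |z'.1 - z.1| + |z'.2 - z.2| ≤ ρ * R) : wB c R z ≤ (1 + ρ) ^ 100 * wB c R z' := by
  have hρ : 0 ≤ ρ := by
    have : 0 ≤ ρ * R := le_trans (by positivity) h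
    exact nonneg_of_mul_nonneg_left this hR
  have key : ∀ x, wB c R x = ((1 + √((x.1 - c.1) ^ 2 + (x.2 - c.2) ^ 2) / R) ^ 100)⁻¹ := fun x => by
    rw [wB, show (-100 : ℤ) = -((100 : ℕ) : ℤ) by norm_num, zpow_neg, zpow_natCast]
  rw [key, key, ← div_eq_mul_inv, inv_eq_one_div, div_le_div_iff₀ (by positivity) (by positivity),
    one_mul, ← mul_pow]
  refine pow_le_pow_left₀ (by positivity) ?_ _
  have h1 := sqrt_add_sq_le (z.1 - c.1) (z.2 - c.2) (z'.1 - z.1) (z'.2 - z.2)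
  rw [show z.1 - c.1 + (z'.1 - z.1) = z'.1 - c.1 by ring,
    show z.2 - c.2 + (z'.2 - z.2) = z'.2 - c.2 by ring] at h1
  have h2 : √((z'.1 - c.1) ^ 2 + (z'.2 - c.2) ^ 2) / R ≤
      √((z.1 - c.1) ^ 2 + (z.2 - c.2) ^ 2) / R + ρ := by
    rw [div_le_iff₀ hR, add_mul, div_mul_cancel₀ _ hR.ne']; linarith
  have h3 : 0 ≤ ρ * (√((z.1 - c.1) ^ 2 + (z.2 - c.2) ^ 2) / R) := by positivity
  nlinarith

/-- The linear change of variables on `ℝ²` dual to the affine map `η ↦ (k + η) / L`. -/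
noncomputable def shear (k : ℝ) {L : ℝ} (hL : L ≠ 0) : (ℝ × ℝ) ≃ₗ[ℝ] (ℝ × ℝ) where
  toFun x := (x.1 / L + 2 * k * x.2 / L ^ 2, x.2 / L ^ 2)
  invFun y := (L * y.1 - 2 * k * L * y.2, L ^ 2 * y.2)
  map_add' x y := by ext <;> simp <;> ring
  map_smul' a x := by ext <;> simp <;> ring
  left_inv x := by ext <;> simp <;> field_simp; ring
  right_inv x := by ext <;> simp <;> field_simp; ring

lemma shear_apply (k : ℝ) {L : ℝ} (hL : L ≠ 0) (x : ℝ × ℝ) :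
    shear k hL x = (x.1 / L + 2 * k * x.2 / L ^ 2, x.2 / L ^ 2) := rfl

lemma shear_symm_apply (k : ℝ) {L : ℝ} (hL : L ≠ 0) (y : ℝ × ℝ) :
    (shear k hL).symm y = (L * y.1 - 2 * k * L * y.2, L ^ 2 * y.2) := rfl

lemma slowlyVarying_shear {k L r R : ℝ} (hk : 0 ≤ k) (hkL : k ≤ L) (hL : 1 ≤ L) (hr : 0 < r)
    (hR : L ^ 2 * r ≤ R) (c : ℝ × ℝ) :
    SlowlyVarying r fun y => ewB c R ((shear k (by positivity : L ≠ 0)).symm y) := by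
  intro x y
  have hR0 : 0 < R := lt_of_lt_of_le (by positivity) hR
  simp only [ewB]
  rw [← ENNReal.ofReal_mul (by positivity)]
  refine ENNReal.ofReal_le_ofReal (wB_le_mul_wB c hR0 ?_)
  simp only [shear_symm_apply]
  rw [show L * y.1 - 2 * k * L * y.2 - (L * x.1 - 2 * k * L * x.2) =
      2 * k * L * (x.2 - y.2) - L * (x.1 - y.1) by ring,
    show L ^ 2 * y.2 - L ^ 2 * x.2 = -(L ^ 2 * (x.2 - y.2)) by ring, abs_neg]
  have h1 := abs_sub (2 * k * L * (x.2 - y.2)) (L * (x.1 - y.1))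
  rw [abs_mul (2 * k * L), abs_mul L, abs_of_nonneg (by positivity : 0 ≤ 2 * k * L),
    abs_of_nonneg (by positivity : 0 ≤ L)] at h1
  rw [abs_mul (L ^ 2), abs_of_nonneg (by positivity : 0 ≤ L ^ 2)]
  have h2 : L * |x.1 - y.1| ≤ L ^ 2 * |x.1 - y.1| := by gcongr; nlinarith
  have h3 : 2 * k * L * |x.2 - y.2| ≤ 2 * L ^ 2 * |x.2 - y.2| := by
    refine mul_le_mul_of_nonneg_right ?_ (abs_nonneg _)
    nlinarith
  set d := |x.1 - y.1| + 3 * |x.2 - y.2| with hd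
  have hd0 : 0 ≤ d := by positivity
  calc _ ≤ L ^ 2 * d := by rw [hd]; linarith
    _ = d / r * (L ^ 2 * r) := by field_simp
    _ ≤ d / r * R := by gcongr

lemma exists_sqNorm_comp_shear (p k : ℝ) {L : ℝ} (hL : L ≠ 0) :
    ∃ κ : ℝ≥0∞, ∀ (f : ℝ × ℝ → ℂ) (w : ℝ × ℝ → ℝ≥0∞), Measurable f → Measurable w → 0 < p →
      sqNorm p (fun x => f (shear k hL x)) w =
        κ * sqNorm p f fun y => w ((shear k hL).symm y) := by
  set T := shear k hL with hT
  refine ⟨ENNReal.ofReal |(LinearMap.det (T : (ℝ × ℝ) →ₗ[ℝ] (ℝ × ℝ)))⁻¹| ^ (2 / p),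
    fun f w hf hw hp => ?_⟩
  have hTm : Measurable (T : (ℝ × ℝ) →ₗ[ℝ] (ℝ × ℝ)) :=
    (LinearMap.continuous_of_finiteDimensional _).measurable
  have hSm : Measurable fun y => T.symm y :=
    (LinearMap.continuous_of_finiteDimensional (T.symm : (ℝ × ℝ) →ₗ[ℝ] (ℝ × ℝ))).measurable
  have hmap := Measure.map_linearMap_addHaar_eq_smul_addHaar (volume : Measure (ℝ × ℝ))
    (T.isUnit_det').ne_zero
  have hG : Measurable fun y => ‖f y‖ₑ ^ p * w (T.symm y) :=
    (hf.enorm.pow_const p).mul (hw.comp hSm)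
  have h := lintegral_map (μ := volume) hG hTm
  rw [hmap, lintegral_smul_measure, smul_eq_mul] at h
  rw [sqNorm, sqNorm, ← ENNReal.mul_rpow_of_nonneg _ _ (by positivity), h]
  simp

lemma extOp_rescale {k L s t : ℝ} (hL : 0 < L) (hst : s ≤ t) (g : ℝ → ℂ) (x : ℝ × ℝ) :
    ‖extOp ((k + s) / L) ((k + t) / L) g x‖ₑ =
      ‖extOp s t (fun η => (L⁻¹ : ℂ) * g ((k + η) / L)) (shear k hL.ne' x)‖ₑ := by
  have hle : (k + s) / L ≤ (k + t) / L := by gcongr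
  rw [extOp_eq, extOp_eq, integral_Icc_eq_integral_Ioc, integral_Icc_eq_integral_Ioc,
    ← intervalIntegral.integral_of_le hle, ← intervalIntegral.integral_of_le hst]
  have h := intervalIntegral.integral_comp_div_add (a := s) (b := t)
    (fun ξ => g ξ * ch (ξ * x.1 + ξ ^ 2 * x.2)) hL.ne' (k / L)
  rw [show s / L + k / L = (k + s) / L by ring, show t / L + k / L = (k + t) / L by ring] at h
  have e : ∀ η, (L⁻¹ : ℂ) * g ((k + η) / L) * ch (η * (shear k hL.ne' x).1 +
      η ^ 2 * (shear k hL.ne' x).2) = ((L⁻¹ : ℂ) * ch (-(k / L * x.1 + (k / L) ^ 2 * x.2))) *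
      (g (η / L + k / L) * ch ((η / L + k / L) * x.1 + (η / L + k / L) ^ 2 * x.2)) := by
    intro η
    rw [show (k + η) / L = η / L + k / L by ring, mul_mul_mul_comm (L⁻¹ : ℂ),
      ← ch_add]
    congr 2
    rw [shear_apply]
    field_simp
    ring
  simp_rw [e]
  rw [intervalIntegral.integral_const_mul, h, enorm_mul, enorm_mul, enorm_ch, enorm_smul]
  rw [mul_one, ← mul_assoc, ← Complex.ofReal_inv]
  have : ‖((L⁻¹ : ℝ) : ℂ)‖ₑ * ‖L‖ₑ = 1 := by
    rw [show ‖((L⁻¹ : ℝ) : ℂ)‖ₑ = ‖L⁻¹‖ₑ by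
      rw [← ofReal_norm, ← ofReal_norm, Complex.norm_real], ← enorm_mul,
      inv_mul_cancel₀ hL.ne', enorm_one]
  rw [this, one_mul]

lemma integrableOn_rescale {k L : ℝ} (hL : 0 < L) {g : ℝ → ℂ}
    (hg : IntegrableOn g (Icc (k / L) ((k + 1) / L))) :
    IntegrableOn (fun η => (L⁻¹ : ℂ) * g ((k + η) / L)) (Icc 0 1) := by
  refine Integrable.const_mul ?_ _
  have h0 : IntervalIntegrable g volume (k / L) ((k + 1) / L) :=
    (intervalIntegrable_iff_integrableOn_Icc_of_le (by gcongr; linarith)).2 hg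
  have h1 := (h0.comp_mul_right (c := L⁻¹)).comp_add_left k
  rw [div_inv_eq_mul, div_inv_eq_mul, div_mul_cancel₀ _ hL.ne', div_mul_cancel₀ _ hL.ne',
    sub_self, add_sub_cancel_left, intervalIntegrable_iff_integrableOn_Icc_of_le zero_le_one] at h1
  simpa only [div_eq_mul_inv, IntegrableOn] using h1

/-- Decoupling of `E g` on an interval of length `1/L` into intervals of length `1/(Ln)`. -/
lemma decoupling_rescaled : ∃ C : ℝ≥0, ∀ p : ℝ, 4 < p → p < 6 → ∀ n : ℕ, 0 < n → ∀ D : ℝ, 0 ≤ D →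
    DecIneq p n D → ∀ L k : ℕ, k < L → ∀ g : ℝ → ℂ, IntegrableOn g (Icc 0 1) →
    ∀ R : ℝ, (L : ℝ) ^ 2 * (n : ℝ) ^ 2 ≤ R → ∀ c : ℝ × ℝ,
    sqNorm p (extPiece L k g) (ewB c R) ≤ C * ENNReal.ofReal (D ^ 2) *
      ∑ j ∈ Finset.range n, sqNorm p (extPiece (L * n) (k * n + j) g) (ewB c R) := by
  obtain ⟨C, hC⟩ := decoupling_slab
  refine ⟨3 ^ 100 * (4 * 3 ^ 100) * C, fun p hp4 hp6 n hn D hD hdec L k hk g hg R hR c => ?_⟩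
  have hL1 : (1 : ℝ) ≤ L := by exact_mod_cast (Nat.zero_le k).trans_lt hk
  have hL : (0 : ℝ) < L := by linarith
  have hn' : (0 : ℝ) < n := by exact_mod_cast hn
  have hR0 : 0 < R := lt_of_lt_of_le (by positivity) hR
  set h : ℝ → ℂ := fun η => ((L : ℝ)⁻¹ : ℂ) * g ((k + η) / L) with hh
  have hhi : IntegrableOn h (Icc 0 1) := integrableOn_rescale hL (hg.mono_set (Icc_piece_subset hk))
  obtain ⟨κ, hκ⟩ := exists_sqNorm_comp_shear p k hL.ne'
  have hw : Measurable (ewB c R) := (measurable_wB c R).ennreal_ofReal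
  have hconv : ∀ s t : ℝ, s ≤ t → Measurable (extOp s t h) →
      sqNorm p (extOp ((k + s) / L) ((k + t) / L) g) (ewB c R) =
      κ * sqNorm p (extOp s t h) fun y => ewB c R ((shear k hL.ne').symm y) := by
    intro s t hst hm
    rw [← hκ _ _ hm hw (by linarith), sqNorm, sqNorm]
    simp_rw [extOp_rescale hL hst g, hh]
  have hm0 : Measurable (extOp 0 1 h) := (continuous_extOp hhi).measurable
  have hmj : ∀ j : Fin n, Measurable (extPiece n j h) := fun j =>
    (continuous_extOp (hhi.mono_set (Icc_piece_subset j.2))).measurable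
  have hSm : Measurable fun y => (shear k hL.ne').symm y :=
    (LinearMap.continuous_of_finiteDimensional
      ((shear k hL.ne').symm : (ℝ × ℝ) →ₗ[ℝ] (ℝ × ℝ))).measurable
  have key := sqNorm_le_of_local (p := p) (by linarith) (Finset.univ : Finset (Fin n)) hm0
    (F := fun j => extPiece n j h) hmj (r := (n : ℝ) ^ 2) (by positivity)
    (K := C * ENNReal.ofReal (D ^ 2)) (fun c => by
      rw [Fin.sum_univ_eq_sum_range fun j => sqNorm p (extPiece n j h) (slab c ((n : ℝ) ^ 2))]
      exact hC p hp4 hp6 n hn D hD hdec h hhi c)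
    (W := fun y => ewB c R ((shear k hL.ne').symm y)) (hw.comp hSm) (slowlyVarying_shear (Nat.cast_nonneg k) (by exact_mod_cast hk.le) hL1
      (by positivity) hR c)
  rw [Fin.sum_univ_eq_sum_range fun j => sqNorm p (extPiece n j h)
    fun y => ewB c R ((shear k hL.ne').symm y)] at key
  have e0 := hconv 0 1 zero_le_one hm0
  rw [add_zero] at e0
  rw [extPiece, e0]
  refine (mul_le_mul' le_rfl key).trans_eq ?_
  have e1 : ∑ j ∈ Finset.range n, sqNorm p (extPiece (L * n) (k * n + j) g) (ewB c R) =
      ∑ j ∈ Finset.range n, κ * sqNorm p (extPiece n j h)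
        fun y => ewB c R ((shear k hL.ne').symm y) := by
    refine Finset.sum_congr rfl fun j hj => ?_
    rw [extPiece, extPiece, ← hconv _ _ (by gcongr; linarith) (hmj ⟨j, Finset.mem_range.1 hj⟩)]
    congr 2
    · push_cast; field_simp
    · push_cast; field_simp; ring
  rw [e1, ← Finset.mul_sum]
  push_cast
  ring

/-! ### Iteration -/

lemma sum_range_mul_eq {M : Type*} [AddCommMonoid M] (f : ℕ → M) (m n : ℕ) :
    ∑ i ∈ Finset.range (m * n), f i =
      ∑ k ∈ Finset.range m, ∑ j ∈ Finset.range n, f (k * n + j) := by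
  induction m with
  | zero => simp
  | succ m ih => rw [Nat.succ_mul, Finset.sum_range_add, ih, Finset.sum_range_succ]

lemma esqr_le_ewB (c : ℝ × ℝ) {R : ℝ} (hR : 0 < R) (x : ℝ × ℝ) :
    esqr c R x ≤ ((2 ^ 100 : ℝ≥0) : ℝ≥0∞) * ewB c R x := by
  by_cases hx : x ∈ sqr c R
  swap
  · rw [esqr, indicator_of_notMem hx]; exact bot_le
  obtain ⟨h1, h2⟩ := mem_sqr_iff.1 hx
  have hc : wB c R c = 1 := by simp [wB]
  have h := wB_le_mul_wB c hR (ρ := 1) (z := c) (z' := x) (by linarith)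
  rw [hc] at h
  rw [esqr, indicator_of_mem hx, Pi.one_apply, ewB, ← ENNReal.ofReal_coe_nnreal,
    ← ENNReal.ofReal_mul (by positivity), ← ENNReal.ofReal_one]
  refine ENNReal.ofReal_le_ofReal (h.trans_eq ?_)
  norm_num

lemma extOp_eq_sum {n : ℕ} (hn : 0 < n) {g : ℝ → ℂ} (hg : IntegrableOn g (Icc 0 1)) (x : ℝ × ℝ) :
    extOp 0 1 g x = ∑ k ∈ Finset.range n, extPiece n k g x := by
  have hn' : (0 : ℝ) < n := by exact_mod_cast hn
  have hle : ∀ k : ℕ, (k : ℝ) / n ≤ ((k : ℝ) + 1) / n := fun k => by gcongr; linarith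
  have h := intervalIntegral.sum_integral_adjacent_intervals (μ := volume) (n := n)
    (f := fun ξ => g ξ * ch (ξ * x.1 + ξ ^ 2 * x.2)) (a := fun k : ℕ => (k : ℝ) / n)
    (fun k hk => by
      push_cast
      rw [intervalIntegrable_iff_integrableOn_Icc_of_le (hle k)]
      exact integrable_mul_ch (hg.mono_set (Icc_piece_subset hk)) (by fun_prop))
  rw [extOp_eq, integral_Icc_eq_integral_Ioc, ← intervalIntegral.integral_of_le zero_le_one]
  rw [Nat.cast_zero, zero_div, div_self hn'.ne'] at h
  rw [← h]
  refine Finset.sum_congr rfl fun k _ => ?_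
  rw [extPiece, extOp_eq, integral_Icc_eq_integral_Ioc,
    ← intervalIntegral.integral_of_le (hle k)]
  push_cast
  rfl

lemma exists_decIneq {p : ℝ} (hp : 2 ≤ p) {n : ℕ} (hn : 0 < n) :
    ∃ D : ℝ, 0 ≤ D ∧ DecIneq p n D := by
  have hn' : (0 : ℝ) < n := by exact_mod_cast hn
  have hR : (0 : ℝ) < (n : ℝ) ^ 2 := by positivity
  refine ⟨2 ^ 50 * n, by positivity,
    (decIneq_iff (by linarith) hn (by positivity)).2 fun g hg c => ?_⟩
  refine (sqNorm_const_mul_le hp _ (one_le_pow₀ (by norm_num)) (esqr_le_ewB c hR)).trans ?_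
  have hw : Measurable (ewB c ((n : ℝ) ^ 2)) := (measurable_wB c _).ennreal_ofReal
  have h := lintegral_rpow_le_sum (μ := volume) hp (Finset.univ : Finset (Fin n)) (n : ℝ≥0∞)
    (X := fun x => ‖extOp 0 1 g x‖ₑ ^ p * ewB c ((n : ℝ) ^ 2) x)
    (Y := fun k x => ‖extPiece n k g x‖ₑ ^ p * ewB c ((n : ℝ) ^ 2) x)
    (fun k => (((continuous_extOp (hg.mono_set (Icc_piece_subset k.2))).measurable.enorm.pow_const
      p).mul hw).aemeasurable) (fun x => by
      simp_rw [ENNReal.mul_rpow_of_nonneg _ _ (by positivity : 0 ≤ 2 / p), ← ENNReal.rpow_mul,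
        mul_div_cancel₀ 2 (by linarith : p ≠ 0)]
      rw [← Finset.sum_mul, ← mul_assoc]
      refine mul_le_mul' ?_ le_rfl
      rw [extOp_eq_sum hn hg x,
        ← Fin.sum_univ_eq_sum_range fun k => extPiece n k g x]
      simp_rw [ENNReal.rpow_two, enorm_eq_nnnorm]
      have h1 : ‖∑ k : Fin n, extPiece n k g x‖₊ ^ 2 ≤
          n * ∑ k : Fin n, ‖extPiece n k g x‖₊ ^ 2 := by
        refine (pow_le_pow_left₀ zero_le (nnnorm_sum_le _ _) 2).trans ?_
        have := sq_sum_le_card_mul_sum_sq (s := (Finset.univ : Finset (Fin n)))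
          (f := fun k => ‖extPiece n k g x‖₊)
        simpa using this
      exact_mod_cast h1)
  rw [Fin.sum_univ_eq_sum_range fun k =>
    (∫⁻ x, ‖extPiece n k g x‖ₑ ^ p * ewB c ((n : ℝ) ^ 2) x) ^ (2 / p)] at h
  refine (mul_le_mul' le_rfl h).trans ?_
  rw [← mul_assoc]
  refine mul_le_mul' ?_ le_rfl
  rw [← ENNReal.ofReal_coe_nnreal, ← ENNReal.ofReal_natCast, ← ENNReal.ofReal_mul (by positivity)]
  refine ENNReal.ofReal_le_ofReal ?_
  have h1 : (1 : ℝ) ≤ n := by exact_mod_cast hn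
  push_cast
  rw [mul_pow, ← pow_mul]
  norm_num
  nlinarith

lemma le_mul_sInf {S : Set ℝ} (hS : S.Nonempty) {a x : ℝ} (ha : 0 ≤ a) (h : ∀ d ∈ S, x ≤ a * d) :
    x ≤ a * sInf S := by
  rcases ha.eq_or_lt with rfl | ha
  · obtain ⟨d, hd⟩ := hS
    simpa using h d hd
  · rw [← div_le_iff₀' ha]
    exact le_csInf hS fun d hd => (div_le_iff₀' ha).2 (h d hd)

/-- Admissible constants at scales `1/n₁` and `1/n₂` give an admissible constant at scale
`1/(n₁n₂)`. -/
lemma exists_decIneq_mul : ∃ c : ℝ, 0 < c ∧ ∀ p : ℝ, 4 < p → p < 6 → ∀ n₁ n₂ : ℕ, 0 < n₁ → 0 < n₂ →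
    ∀ D₁ D₂ : ℝ, 0 ≤ D₁ → 0 ≤ D₂ → DecIneq p n₁ D₁ → DecIneq p n₂ D₂ →
      DecIneq p (n₁ * n₂) (c * D₁ * D₂) := by
  obtain ⟨C, hC⟩ := decoupling_rescaled
  refine ⟨2 ^ 50 * C + 1, by positivity,
    fun p hp4 hp6 n₁ n₂ hn₁ hn₂ D₁ D₂ hD₁ hD₂ h₁ h₂ => ?_⟩
  have hn : 0 < n₁ * n₂ := Nat.mul_pos hn₁ hn₂
  have hn₂' : (1 : ℝ) ≤ n₂ := by exact_mod_cast hn₂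
  refine (decIneq_iff (by linarith) hn (by positivity)).2 fun g hg c => ?_
  have hR : (0 : ℝ) < ((n₁ * n₂ : ℕ) : ℝ) ^ 2 := by positivity
  set R : ℝ := ((n₁ * n₂ : ℕ) : ℝ) ^ 2 with hRdef
  have hR' : R = (n₁ : ℝ) ^ 2 * (n₂ : ℝ) ^ 2 := by rw [hRdef]; push_cast; ring
  have s0 := sqNorm_const_mul_le (p := p) (by linarith) (extOp 0 1 g)
    (one_le_pow₀ (by norm_num)) (esqr_le_ewB c hR)
  have s1 := hC p hp4 hp6 n₁ hn₁ D₁ hD₁ h₁ 1 0 zero_lt_one g hg R (by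
    rw [hR', Nat.cast_one, one_pow, one_mul]
    exact le_mul_of_one_le_right (by positivity) (one_le_pow₀ hn₂')) c
  have s2 := fun k (hk : k < n₁) => hC p hp4 hp6 n₂ hn₂ D₂ hD₂ h₂ n₁ k hk g hg R hR'.ge c
  have e0 : extPiece 1 0 g = extOp 0 1 g := by simp [extPiece]
  simp only [e0, one_mul, zero_mul, zero_add] at s1
  calc sqNorm p (extOp 0 1 g) (esqr c R)
      ≤ ((2 ^ 100 : ℝ≥0) : ℝ≥0∞) * (C * ENNReal.ofReal (D₁ ^ 2) * ∑ k ∈ Finset.range n₁,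
          (C * ENNReal.ofReal (D₂ ^ 2) * ∑ j ∈ Finset.range n₂,
            sqNorm p (extPiece (n₁ * n₂) (k * n₂ + j) g) (ewB c R))) :=
        s0.trans (mul_le_mul' le_rfl (s1.trans (mul_le_mul' le_rfl
          (Finset.sum_le_sum fun k hk => s2 k (Finset.mem_range.1 hk)))))
    _ = ENNReal.ofReal ((2 ^ 50 * C * D₁ * D₂) ^ 2) * ∑ i ∈ Finset.range (n₁ * n₂),
          sqNorm p (extPiece (n₁ * n₂) i g) (ewB c R) := by
        rw [sum_range_mul_eq, ← Finset.mul_sum,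
          show (2 ^ 50 * (C : ℝ) * D₁ * D₂) ^ 2 = 2 ^ 100 * (C * (D₁ ^ 2 * (C * D₂ ^ 2))) by ring,
          ENNReal.ofReal_mul (by positivity), ENNReal.ofReal_mul (by positivity),
          ENNReal.ofReal_mul (by positivity), ENNReal.ofReal_mul (by positivity),
          ENNReal.ofReal_coe_nnreal, ← ENNReal.ofReal_coe_nnreal (p := 2 ^ 100)]
        push_cast
        ring
    _ ≤ _ := by
        refine mul_le_mul' (ENNReal.ofReal_le_ofReal ?_) le_rfl
        gcongr
        linarith

end ParabolaDecoupling

/-- Almost multiplicativity: `D_p(δ₁δ₂) ≤ c D_p(δ₁) D_p(δ₂)` for `δ₁ = 1/n₁`,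
`δ₂ = 1/n₂`. -/
theorem decoupling_almost_multiplicative :
    ∃ c : ℝ, 0 < c ∧ ∀ p : ℝ, 4 < p → p < 6 → ∀ n₁ n₂ : ℕ, 0 < n₁ → 0 < n₂ →
      Dconst p (n₁ * n₂) ≤ c * Dconst p n₁ * Dconst p n₂ := by
  obtain ⟨c, hc, h⟩ := ParabolaDecoupling.exists_decIneq_mul
  refine ⟨c, hc, fun p hp4 hp6 n₁ n₂ hn₁ hn₂ => ?_⟩
  have hne : ∀ n : ℕ, 0 < n → {D : ℝ | 0 ≤ D ∧ DecIneq p n D}.Nonempty := fun n hn =>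
    ParabolaDecoupling.exists_decIneq (by linarith) hn
  have h0 : 0 ≤ Dconst p n₁ := Real.sInf_nonneg fun D hD => hD.1
  refine ParabolaDecoupling.le_mul_sInf (hne n₂ hn₂) (by positivity) fun D₂ hD₂ => ?_
  rw [mul_right_comm]
  refine ParabolaDecoupling.le_mul_sInf (hne n₁ hn₁) (mul_nonneg hc.le hD₂.1) fun D₁ hD₁ => ?_
  rw [mul_right_comm]
  have hD₁' := hD₁.1
  have hD₂' := hD₂.1
  exact csInf_le ⟨0, fun D hD => hD.1⟩
    ⟨by positivity, h p hp4 hp6 n₁ n₂ hn₁ hn₂ D₁ D₂ hD₁' hD₂' hD₁.2 hD₂.2⟩
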